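/- There exist constants c > 0 and C > 0 such that for all real x ≥ 3, |M(x)| ≤ c · x · exp(−C (log x)^{3/5} (log log x)^{−1/5}), where M(x) = Σ_{n ≤ x} μ(n) is the Mertens sum. -/

import Mathlib

/-- The Mertens sum `M(x) = Σ_{n ≤ x} μ(n)`. -/
noncomputable def mertensM (x : ℝ) : ℤ :=
  ∑ n ∈ Finset.Icc 1 ⌊x⌋₊, ArithmeticFunction.moebius n

namespace VinogradovKorobov

open Finset

/-! ### Congruences between power sums -/

/-- By Newton's identities, equal power sums force equal elementary symmetric functions when
`1, …, k` are invertible. -/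
theorem esymm_eq_of_powerSum_eq {R : Type*} [CommRing R] {k : ℕ} (x y : Fin k → R)
    (hu : ∀ j, 1 ≤ j → j ≤ k → IsUnit (j : R))
    (h : ∀ j, 1 ≤ j → j ≤ k → ∑ i, x i ^ j = ∑ i, y i ^ j) (j : ℕ) (hj : j ≤ k) :
    MvPolynomial.aeval x (MvPolynomial.esymm (Fin k) R j) =
      MvPolynomial.aeval y (MvPolynomial.esymm (Fin k) R j) := by
  induction j using Nat.strong_induction_on with
  | _ j ih =>
    rcases Nat.eq_zero_or_pos j with rfl | hpos
    · simp
    have key : ∀ z : Fin k → R, (j : R) * MvPolynomial.aeval z (MvPolynomial.esymm (Fin k) R j) =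
        (-1) ^ (j + 1) * ∑ a ∈ antidiagonal j with a.1 < j, (-1) ^ a.1 *
          MvPolynomial.aeval z (MvPolynomial.esymm (Fin k) R a.1) * ∑ i, z i ^ a.2 := by
      intro z
      have := congrArg (MvPolynomial.aeval z) (MvPolynomial.mul_esymm_eq_sum (Fin k) R j)
      simpa [MvPolynomial.psum] using this
    apply (hu j hpos hj).mul_left_cancel
    rw [key x, key y]
    congr 1
    refine sum_congr rfl fun a ha => ?_
    simp only [mem_filter, HasAntidiagonal.mem_antidiagonal] at ha
    rw [ih a.1 ha.2 (by omega), h a.2 (by omega) (by omega)]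

theorem prod_sub_eq_of_powerSum_eq {R : Type*} [CommRing R] {k : ℕ} (x y : Fin k → R)
    (hu : ∀ j, 1 ≤ j → j ≤ k → IsUnit (j : R))
    (h : ∀ j, 1 ≤ j → j ≤ k → ∑ i, x i ^ j = ∑ i, y i ^ j) (z : R) :
    ∏ i, (z - x i) = ∏ i, (z - y i) := by
  have key : ∀ w : Fin k → R, ∏ i, (z - w i) = ∑ j ∈ range (k + 1),
      (-1) ^ j * (MvPolynomial.aeval w (MvPolynomial.esymm (Fin k) R j) * z ^ (k - j)) := by
    intro w
    have := congrArg (Polynomial.eval z)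
      (Multiset.prod_X_sub_X_eq_sum_esymm (univ.val.map w))
    simp only [Multiset.map_map, Polynomial.eval_multiset_prod, Multiset.card_map, card_val,
      Fintype.card_fin, Polynomial.eval_finsetSum, card_univ] at this
    simp only [MvPolynomial.aeval_esymm_eq_multiset_esymm]
    simpa [Function.comp_def, Finset.prod] using this
  rw [key x, key y]
  refine sum_congr rfl fun j hj => ?_
  rw [esymm_eq_of_powerSum_eq x y hu h j (by simpa [Nat.lt_succ_iff] using hj)]

/-- In `ℤ/p^k`, tuples with equal power sums, the first having entries distinct modulo `p`,
only differ by a reindexing. -/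
theorem exists_reindex_of_powerSum_eq {p k : ℕ} [Fact p.Prime] (hk : k < p) (hk0 : 0 < k)
    (x y : Fin k → ZMod (p ^ k))
    (hx : Function.Injective fun i => ZMod.castHom (dvd_pow_self p hk0.ne') (ZMod p) (x i))
    (h : ∀ j, 1 ≤ j → j ≤ k → ∑ i, x i ^ j = ∑ i, y i ^ j) (i : Fin k) :
    ∃ j, y i = x j := by
  have hp : p.Prime := Fact.out
  have hunit : ∀ z : ZMod (p ^ k), ZMod.castHom (dvd_pow_self p hk0.ne') (ZMod p) z ≠ 0 →
      IsUnit z := by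
    intro z hz
    have : NeZero (p ^ k) := ⟨(pow_pos hp.pos k).ne'⟩
    obtain ⟨n, rfl⟩ := ZMod.natCast_zmod_surjective z
    rw [ZMod.isUnit_iff_coprime]
    apply Nat.Coprime.pow_right
    rw [Nat.coprime_comm, hp.coprime_iff_not_dvd]
    intro hd
    apply hz
    rw [map_natCast]
    exact (ZMod.natCast_eq_zero_iff n p).2 hd
  have hprod := prod_sub_eq_of_powerSum_eq x y (fun j hj1 hj => by
    apply hunit
    rw [map_natCast, Ne, ZMod.natCast_eq_zero_iff]
    exact Nat.not_dvd_of_pos_of_lt hj1 (by omega)) h (y i)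
  rw [prod_eq_zero (i := i) (f := fun j => y i - y j) (mem_univ i) (sub_self _)] at hprod
  have hp0 := congrArg (ZMod.castHom (dvd_pow_self p hk0.ne') (ZMod p)) hprod
  rw [map_prod, map_zero, prod_eq_zero_iff] at hp0
  obtain ⟨j, -, hj⟩ := hp0
  refine ⟨j, ?_⟩
  rw [← mul_prod_erase univ _ (mem_univ j)] at hprod
  have hu : IsUnit (∏ l ∈ univ.erase j, (y i - x l)) := by
    rw [IsUnit.prod_iff]
    intro l hl
    apply hunit
    intro hl0
    apply (mem_erase.1 hl).1
    apply hx
    simp only [map_sub, sub_eq_zero] at hj hl0 ⊢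
    rw [← hl0, hj]
  exact sub_eq_zero.1 ((hu.mul_left_eq_zero).1 hprod)

/-- The number of `k`-tuples with entries distinct modulo `p`, whose shifted power sums of order
`j` lie in a given class modulo `p ^ j` for all `1 ≤ j ≤ k`. -/
theorem card_powerSum_congruence_le {p k P : ℕ} [Fact p.Prime] (hk : k < p) (hk0 : 0 < k)
    (hP : P ≤ p ^ k) (a : ℤ) (h₀ : ℕ → ℤ) (S : Finset (Fin k → Fin P))
    (hinj : ∀ x ∈ S, Function.Injective fun i => ((x i : ℕ) : ZMod p))
    (hS : ∀ x ∈ S, ∀ j : Fin k,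
      (p : ℤ) ^ (j + 1 : ℕ) ∣ ∑ i, (((x i : ℕ) : ℤ) - a) ^ (j + 1 : ℕ) - h₀ j) :
    S.card ≤ k ^ k * p ^ (k * (k - 1) / 2) := by
  classical
  have hp : p.Prime := Fact.out
  have : NeZero (p ^ k) := ⟨(pow_pos hp.pos k).ne'⟩
  let φ : (Fin k → Fin P) → Fin k → ZMod (p ^ k) :=
    fun x j => ∑ i, (((x i : ℕ) : ZMod (p ^ k)) - a) ^ (j + 1 : ℕ)
  have hfib : ∀ b ∈ S.image φ, (S.filter fun x => φ x = b).card ≤ k ^ k := by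
    intro b hb
    obtain ⟨x₀, hx₀, rfl⟩ := mem_image.1 hb
    have hex : ∀ y ∈ S.filter (fun x => φ x = φ x₀), ∃ τ : Fin k → Fin k, y = x₀ ∘ τ := by
      intro y hy
      obtain ⟨hyS, hyφ⟩ := mem_filter.1 hy
      have hr := exists_reindex_of_powerSum_eq hk hk0
        (fun i => ((x₀ i : ℕ) : ZMod (p ^ k)) - a) (fun i => ((y i : ℕ) : ZMod (p ^ k)) - a)
        (by
          intro i j hij
          apply hinj x₀ hx₀
          simpa only [map_sub, map_natCast, map_intCast, sub_left_inj] using hij)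
        (by
          intro j hj1 hj
          have := congrFun hyφ ⟨j - 1, by omega⟩
          simp only [φ, Nat.sub_add_cancel hj1] at this
          exact this.symm)
      choose τ hτ using hr
      refine ⟨τ, funext fun i => ?_⟩
      have h1 := hτ i
      rw [sub_left_inj, ZMod.natCast_eq_natCast_iff, Nat.ModEq,
        Nat.mod_eq_of_lt ((y i).2.trans_le hP), Nat.mod_eq_of_lt ((x₀ (τ i)).2.trans_le hP)] at h1
      exact Fin.ext h1
    have hsub : S.filter (fun x => φ x = φ x₀) ⊆
        (univ : Finset (Fin k → Fin k)).image fun τ => x₀ ∘ τ := by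
      intro y hy
      obtain ⟨τ, rfl⟩ := hex y hy
      exact mem_image_of_mem _ (mem_univ _)
    calc _ ≤ _ := card_le_card hsub
      _ ≤ _ := card_image_le
      _ = k ^ k := by simp
  refine (card_le_mul_card_image S (k ^ k) hfib).trans (Nat.mul_le_mul_left _ ?_)
  let B : Fin k → Finset (ZMod (p ^ k)) := fun j =>
    (range (p ^ (k - 1 - j))).image fun q : ℕ =>
      (h₀ j : ZMod (p ^ k)) + (p : ZMod (p ^ k)) ^ (j + 1 : ℕ) * q
  have himg : S.image φ ⊆ Fintype.piFinset B := by
    intro b hb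
    obtain ⟨x, hx, rfl⟩ := mem_image.1 hb
    rw [Fintype.mem_piFinset]
    intro j
    obtain ⟨q, hq⟩ := hS x hx j
    have hpos : (0 : ℤ) < (p ^ (k - 1 - j) : ℕ) := by exact_mod_cast pow_pos hp.pos _
    have hqn := Int.emod_nonneg q hpos.ne'
    have hql := Int.emod_lt_of_pos q hpos
    refine mem_image.2 ⟨(q % (p ^ (k - 1 - j) : ℕ)).toNat, ?_, ?_⟩
    · rw [mem_range]; omega
    · have h1 : ((∑ i, (((x i : ℕ) : ℤ) - a) ^ (j + 1 : ℕ) : ℤ) : ZMod (p ^ k)) =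
          ((h₀ j + (p : ℤ) ^ (j + 1 : ℕ) * q : ℤ) : ZMod (p ^ k)) := by
        congr 1; linarith
      have h2 : φ x j = ((∑ i, (((x i : ℕ) : ℤ) - a) ^ (j + 1 : ℕ) : ℤ) : ZMod (p ^ k)) := by
        simp [φ]
      have h3 : (((q % (p ^ (k - 1 - j) : ℕ)).toNat : ℕ) : ZMod (p ^ k)) =
          ((q % (p ^ (k - 1 - j) : ℕ) : ℤ) : ZMod (p ^ k)) := by
        rw [← Int.cast_natCast, Int.toNat_of_nonneg hqn]
      rw [h2, h1, h3]
      have h4 : ((p : ZMod (p ^ k)) ^ (j + 1 : ℕ)) * ((p : ZMod (p ^ k)) ^ (k - 1 - j)) = 0 := by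
        rw [← pow_add, show (j + 1 : ℕ) + (k - 1 - j) = k by omega]
        exact_mod_cast ZMod.natCast_self (p ^ k)
      have h5 := congrArg (Int.cast : ℤ → ZMod (p ^ k))
        (Int.emod_add_mul_ediv q (p ^ (k - 1 - j) : ℕ))
      rw [Int.cast_add, Int.cast_mul, Int.cast_natCast] at h5
      have h6 : ((p ^ (k - 1 - j) : ℕ) : ZMod (p ^ k)) = (p : ZMod (p ^ k)) ^ (k - 1 - j) :=
        Nat.cast_pow p _
      rw [h6] at h5
      rw [Int.cast_add, Int.cast_mul, Int.cast_pow, Int.cast_natCast]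
      linear_combination (p : ZMod (p ^ k)) ^ (j + 1 : ℕ) * h5 -
        ((q / (p ^ (k - 1 - j) : ℕ) : ℤ) : ZMod (p ^ k)) * h4
  calc _ ≤ _ := card_le_card himg
    _ = ∏ j, (B j).card := Fintype.card_piFinset B
    _ ≤ ∏ j : Fin k, p ^ (k - 1 - j) :=
        prod_le_prod' fun j _ => card_image_le.trans (by simp)
    _ = p ^ (k * (k - 1) / 2) := by
        rw [Fin.prod_univ_eq_prod_range (fun j => p ^ (k - 1 - j)), prod_pow_eq_pow_sum,
          sum_range_reflect (fun j => j), sum_range_id]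

/-! ### Additive energy -/

section Energy

theorem addChar_map_sum {G ι : Type*} [AddCommGroup G] (χ : AddChar G ℂ) (s : Finset ι)
    (f : ι → G) : χ (∑ i ∈ s, f i) = ∏ i ∈ s, χ (f i) := by
  classical
  induction s using Finset.induction_on with
  | empty => simp
  | insert a s ha ih => rw [sum_insert ha, prod_insert ha, AddChar.map_add_eq_mul, ih]

variable {X Y G : Type*} [DecidableEq G]

/-- The additive energy of `σ` on `S`: the number of pairs in `S` with equal image. -/
def energy (σ : X → G) (S : Finset X) : ℕ :=
  ((S ×ˢ S).filter fun q => σ q.1 = σ q.2).card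

theorem energy_le_of_injOn {H : Type*} [DecidableEq H] {σ : X → G} {τ : Y → H} {S : Finset X}
    {T : Finset Y} (f : X → Y) (hf : Set.InjOn f S) (hST : ∀ x ∈ S, f x ∈ T)
    (h : ∀ x ∈ S, ∀ y ∈ S, σ x = σ y → τ (f x) = τ (f y)) : energy σ S ≤ energy τ T := by
  refine card_le_card_of_injOn (fun q => (f q.1, f q.2)) ?_ ?_
  · intro q hq
    simp only [coe_filter, mem_product, Set.mem_ofPred_eq] at hq ⊢
    exact ⟨⟨hST _ hq.1.1, hST _ hq.1.2⟩, h _ hq.1.1 _ hq.1.2 hq.2⟩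
  · intro q hq r hr hqr
    simp only [coe_filter, mem_product, Set.mem_ofPred_eq] at hq hr
    simp only [Prod.mk.injEq] at hqr
    exact Prod.ext (hf hq.1.1 hr.1.1 hqr.1) (hf hq.1.2 hr.1.2 hqr.2)

theorem energy_eq_sum_sq (σ : X → G) (S : Finset X) (W : Finset G) (hW : ∀ x ∈ S, σ x ∈ W) :
    energy σ S = ∑ w ∈ W, (S.filter fun x => σ x = w).card ^ 2 := by
  classical
  unfold energy
  rw [card_eq_sum_card_fiberwise (f := fun q => σ q.1) (t := W)]
  · refine sum_congr rfl fun w _ => ?_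
    rw [sq, ← card_product]
    congr 1
    ext q
    simp only [mem_filter, mem_product]
    constructor
    · rintro ⟨⟨⟨h1, h2⟩, h3⟩, h4⟩
      exact ⟨⟨h1, h4⟩, h2, h3 ▸ h4⟩
    · rintro ⟨⟨h1, h4⟩, h2, h3⟩
      exact ⟨⟨⟨h1, h2⟩, h4.trans h3.symm⟩, h4⟩
  · intro q hq
    simp only [coe_filter, mem_product, Set.mem_ofPred_eq] at hq
    exact hW _ hq.1.1

theorem energy_le_card_mul_sum {C : Type*} [Fintype C] (σ : X → G) (S : Finset X)
    (T : C → Finset X) (hcov : ∀ x ∈ S, ∃ c, x ∈ T c) :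
    energy σ S ≤ Fintype.card C * ∑ c, energy σ (T c) := by
  classical
  let W : Finset G := S.image σ ∪ univ.biUnion fun c => (T c).image σ
  rw [energy_eq_sum_sq σ S W (fun x hx => mem_union_left _ (mem_image_of_mem _ hx))]
  have hT : ∀ c, energy σ (T c) = ∑ w ∈ W, ((T c).filter fun x => σ x = w).card ^ 2 := fun c =>
    energy_eq_sum_sq σ (T c) W fun x hx =>
      mem_union_right _ (mem_biUnion.2 ⟨c, mem_univ c, mem_image_of_mem _ hx⟩)
  simp only [hT]
  rw [sum_comm, mul_sum]
  refine sum_le_sum fun w _ => ?_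
  have h1 : (S.filter fun x => σ x = w).card ≤ ∑ c, ((T c).filter fun x => σ x = w).card := by
    refine (card_le_card ?_).trans card_biUnion_le
    intro x hx
    obtain ⟨hxS, hxw⟩ := mem_filter.1 hx
    obtain ⟨c, hc⟩ := hcov x hxS
    exact mem_biUnion.2 ⟨c, mem_univ c, mem_filter.2 ⟨hc, hxw⟩⟩
  calc _ ≤ (∑ c, ((T c).filter fun x => σ x = w).card) ^ 2 := Nat.pow_le_pow_left h1 2
    _ ≤ _ := by
      have := sq_sum_le_card_mul_sum_sq (s := (univ : Finset C))
        (f := fun c => ((T c).filter fun x => σ x = w).card)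
      simpa using this

theorem card_sub_eq_le_energy [AddCommGroup G] (σ : X → G) (S : Finset X) (v : G) :
    ((S ×ˢ S).filter fun q => σ q.1 - σ q.2 = v).card ≤ energy σ S := by
  classical
  let r : G → ℕ := fun w => (S.filter fun x => σ x = w).card
  have h0 : ((S ×ˢ S).filter fun q => σ q.1 - σ q.2 = v).card =
      ∑ w ∈ S.image σ, r (w + v) * r w := by
    rw [card_eq_sum_card_fiberwise (f := fun q => σ q.2) (t := S.image σ)]
    · refine sum_congr rfl fun w _ => ?_
      rw [← card_product]
      congr 1
      ext q
      simp only [mem_filter, mem_product]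
      constructor
      · rintro ⟨⟨⟨h1, h2⟩, h3⟩, h4⟩
        refine ⟨⟨h1, ?_⟩, h2, h4⟩
        rw [← h3, ← h4]; abel
      · rintro ⟨⟨h1, h4⟩, h2, h3⟩
        refine ⟨⟨⟨h1, h2⟩, ?_⟩, h3⟩
        rw [h4, h3]; abel
    · intro q hq
      simp only [coe_filter, mem_product, Set.mem_ofPred_eq] at hq
      exact mem_image_of_mem _ hq.1.2
  have h1 := energy_eq_sum_sq σ S (S.image σ) fun x hx => mem_image_of_mem _ hx
  have h2 : ∑ w ∈ S.image σ, r (w + v) ^ 2 ≤ energy σ S := by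
    rw [energy_eq_sum_sq σ S (S.image σ ∪ (S.image σ).image (· + v))
      (fun x hx => mem_union_left _ (mem_image_of_mem _ hx))]
    rw [← sum_image (s := S.image σ) (g := (· + v)) (f := fun w => r w ^ 2)
      (fun _ _ _ _ h => add_right_cancel h)]
    exact sum_le_sum_of_subset subset_union_right
  have h3 : 2 * ∑ w ∈ S.image σ, r (w + v) * r w ≤
      ∑ w ∈ S.image σ, r (w + v) ^ 2 + ∑ w ∈ S.image σ, r w ^ 2 := by
    rw [mul_sum, ← sum_add_distrib]
    refine sum_le_sum fun w _ => ?_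
    have := two_mul_le_add_sq (r (w + v)) (r w)
    linarith
  have h4 : ∑ w ∈ S.image σ, r w ^ 2 = energy σ S := h1.symm
  omega

/-- Fourier expansion of the energy in a finite abelian group. -/
theorem card_mul_energy_eq_sum_characters [AddCommGroup G] [Fintype G] (σ : X → G)
    (S : Finset X) :
    (Fintype.card G : ℝ) * energy σ S = ∑ χ : AddChar G ℂ, ‖∑ x ∈ S, χ (σ x)‖ ^ 2 := by
  have h : ((Fintype.card G : ℝ) * energy σ S : ℂ) =
      ∑ χ : AddChar G ℂ, ((‖∑ x ∈ S, χ (σ x)‖ ^ 2 : ℝ) : ℂ) := by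
    have h1 : ∀ χ : AddChar G ℂ, ((‖∑ x ∈ S, χ (σ x)‖ ^ 2 : ℝ) : ℂ) =
        ∑ q ∈ S ×ˢ S, χ (σ q.1 - σ q.2) := by
      intro χ
      rw [Complex.ofReal_pow, ← Complex.mul_conj', map_sum, sum_mul_sum, sum_product]
      refine sum_congr rfl fun x _ => sum_congr rfl fun y _ => ?_
      rw [sub_eq_add_neg, AddChar.map_add_eq_mul, AddChar.map_neg_eq_conj]
    simp only [h1]
    rw [sum_comm]
    simp only [AddChar.sum_apply_eq_ite, sub_eq_zero]
    rw [← sum_filter, sum_const, nsmul_eq_mul, mul_comm]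
    simp [energy]
  exact_mod_cast h

theorem prod_le_sum_pow_div_card {ι : Type*} [Fintype ι] [Nonempty ι] (a : ι → ℝ)
    (ha : ∀ i, 0 ≤ a i) :
    ∏ i, a i ≤ ∑ i, (Fintype.card ι : ℝ)⁻¹ * a i ^ Fintype.card ι := by
  have hc : (Fintype.card ι : ℝ) ≠ 0 := by exact_mod_cast Fintype.card_ne_zero
  have := Real.geom_mean_le_arith_mean_weighted univ (fun _ : ι => (Fintype.card ι : ℝ)⁻¹)
    (fun i => a i ^ Fintype.card ι) (fun _ _ => by positivity)
    (by simp [hc]) (fun i _ => pow_nonneg (ha i) _)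
  refine le_trans (le_of_eq ?_) this
  refine prod_congr rfl fun i _ => ?_
  rw [← Real.rpow_natCast, ← Real.rpow_mul (ha i), mul_inv_cancel₀ hc, Real.rpow_one]

/-- Among product sets, the energy is dominated by that of some constant product. -/
theorem exists_energy_pi_le_of_finite [AddCommGroup G] [Finite G] {Z ι κ : Type*}
    [Fintype ι] [DecidableEq ι] [Nonempty ι] (σ : X → G) (ψ : Z → G) (S : Finset X)
    (T : κ → Finset Z) (c : ι → κ) :
    ∃ i₀, energy (fun q : X × (ι → Z) => σ q.1 + ∑ i, ψ (q.2 i))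
        (S ×ˢ Fintype.piFinset fun i => T (c i)) ≤
      energy (fun q : X × (ι → Z) => σ q.1 + ∑ i, ψ (q.2 i))
        (S ×ˢ Fintype.piFinset fun _ => T (c i₀)) := by
  have := Fintype.ofFinite G
  let n := Fintype.card ι
  have hn : (n : ℝ) ≠ 0 := by exact_mod_cast Fintype.card_ne_zero
  let A : AddChar G ℂ → ℝ := fun χ => ‖∑ x ∈ S, χ (σ x)‖ ^ 2
  let f : κ → AddChar G ℂ → ℝ := fun a χ => ‖∑ z ∈ T a, χ (ψ z)‖ ^ 2
  have key : ∀ d : ι → κ, (Fintype.card G : ℝ) *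
      energy (fun q : X × (ι → Z) => σ q.1 + ∑ i, ψ (q.2 i))
        (S ×ˢ Fintype.piFinset fun i => T (d i)) = ∑ χ, A χ * ∏ i, f (d i) χ := by
    intro d
    rw [card_mul_energy_eq_sum_characters]
    refine sum_congr rfl fun χ _ => ?_
    have : ∑ q ∈ S ×ˢ (Fintype.piFinset fun i => T (d i)), χ (σ q.1 + ∑ i, ψ (q.2 i)) =
        (∑ x ∈ S, χ (σ x)) * ∏ i, ∑ z ∈ T (d i), χ (ψ z) := by
      rw [prod_univ_sum, sum_mul_sum, sum_product]
      refine sum_congr rfl fun x _ => sum_congr rfl fun z _ => ?_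
      rw [AddChar.map_add_eq_mul, addChar_map_sum]
    rw [this, norm_mul, norm_prod, mul_pow, prod_pow]
  by_contra! hcon
  have hG : (0 : ℝ) < Fintype.card G := by exact_mod_cast Fintype.card_pos
  have h1 : ∑ χ, A χ * ∏ i, f (c i) χ ≤
      ∑ i, (n : ℝ)⁻¹ * ∑ χ, A χ * ∏ _j : ι, f (c i) χ := by
    simp only [mul_sum]
    rw [sum_comm]
    refine sum_le_sum fun χ _ => ?_
    refine (mul_le_mul_of_nonneg_left (prod_le_sum_pow_div_card (fun i => f (c i) χ)
      fun i => by positivity) (by positivity)).trans (le_of_eq ?_)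
    rw [mul_sum]
    refine sum_congr rfl fun i _ => ?_
    simp only [prod_const, card_univ, n]
    ring
  simp only [← key] at h1
  have h2 : ∑ i : ι, (n : ℝ)⁻¹ * ((Fintype.card G : ℝ) *
      energy (fun q : X × (ι → Z) => σ q.1 + ∑ j, ψ (q.2 j))
        (S ×ˢ Fintype.piFinset fun _ => T (c i))) <
      ∑ i : ι, (n : ℝ)⁻¹ * ((Fintype.card G : ℝ) *
      energy (fun q : X × (ι → Z) => σ q.1 + ∑ j, ψ (q.2 j))
        (S ×ˢ Fintype.piFinset fun j => T (c j))) := by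
    refine sum_lt_sum_of_nonempty univ_nonempty fun i _ => ?_
    have hn' : (0 : ℝ) < n := by exact_mod_cast Fintype.card_pos
    have : (energy (fun q : X × (ι → Z) => σ q.1 + ∑ j, ψ (q.2 j))
        (S ×ˢ Fintype.piFinset fun _ => T (c i)) : ℝ) <
        energy (fun q : X × (ι → Z) => σ q.1 + ∑ j, ψ (q.2 j))
        (S ×ˢ Fintype.piFinset fun j => T (c j)) := by exact_mod_cast hcon i
    gcongr
  rw [sum_const, card_univ, nsmul_eq_mul, ← mul_assoc] at h2
  change _ < (n : ℝ) * (n : ℝ)⁻¹ * _ at h2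
  rw [mul_inv_cancel₀ hn, one_mul] at h2
  exact absurd (h1.trans_lt h2) (lt_irrefl _)

end Energy

theorem exists_injOn_intCast_zmod {k : ℕ} (D : Finset (Fin k → ℤ)) :
    ∃ Q : ℕ, 0 < Q ∧ Set.InjOn (fun (v : Fin k → ℤ) j => (v j : ZMod Q)) D := by
  obtain ⟨Q, hQ⟩ : ∃ Q : ℕ, ∀ d ∈ D, ∀ e ∈ D, ∀ j, (d j - e j).natAbs ≤ Q := by
    refine ⟨∑ q ∈ D ×ˢ D, ∑ j, (q.1 j - q.2 j).natAbs, fun d hd e he j => ?_⟩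
    refine le_trans ?_ (single_le_sum (f := fun q : (Fin k → ℤ) × (Fin k → ℤ) =>
      ∑ j, (q.1 j - q.2 j).natAbs) (fun _ _ => Nat.zero_le _) (mk_mem_product hd he))
    exact single_le_sum (f := fun j => (d j - e j).natAbs) (fun _ _ => Nat.zero_le _)
      (mem_univ j)
  refine ⟨Q + 1, by omega, ?_⟩
  intro d hd e he hde
  funext j
  have h1 := congrFun hde j
  simp only at h1
  rw [ZMod.intCast_eq_intCast_iff_dvd_sub] at h1
  have h2 := hQ e he d hd j
  have h3 := Int.eq_zero_of_abs_lt_dvd h1 (by rw [Int.abs_eq_natAbs]; omega)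
  omega

theorem exists_energy_pi_le {k : ℕ} {X Z ι κ : Type*} [Fintype ι] [DecidableEq ι] [Nonempty ι]
    [Fintype X] [Fintype Z] (σ : X → Fin k → ℤ) (ψ : Z → Fin k → ℤ) (S : Finset X)
    (T : κ → Finset Z) (c : ι → κ) :
    ∃ i₀, energy (fun q : X × (ι → Z) => σ q.1 + ∑ i, ψ (q.2 i))
        (S ×ˢ Fintype.piFinset fun i => T (c i)) ≤
      energy (fun q : X × (ι → Z) => σ q.1 + ∑ i, ψ (q.2 i))
        (S ×ˢ Fintype.piFinset fun _ => T (c i₀)) := by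
  classical
  obtain ⟨Q, hQ, hinj⟩ := exists_injOn_intCast_zmod
    ((univ : Finset (X × (ι → Z))).image fun q => σ q.1 + ∑ i, ψ (q.2 i))
  have : NeZero Q := ⟨hQ.ne'⟩
  obtain ⟨i₀, hi₀⟩ := exists_energy_pi_le_of_finite (G := Fin k → ZMod Q)
    (fun x j => (σ x j : ZMod Q)) (fun z j => (ψ z j : ZMod Q)) S T c
  have hcast : ∀ q : X × (ι → Z), ((fun j => (σ q.1 j : ZMod Q)) +
      ∑ i, fun j => (ψ (q.2 i) j : ZMod Q))
      = fun j => ((σ q.1 + ∑ i, ψ (q.2 i)) j : ZMod Q) := by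
    intro q
    funext j
    simp
  refine ⟨i₀, le_trans ?_ (hi₀.trans ?_)⟩
  · refine energy_le_of_injOn id (Function.injective_id.injOn) (fun _ h => h) ?_
    intro x _ y _ hxy
    simp only [id]
    rw [hcast, hcast, hxy]
  · refine energy_le_of_injOn id (Function.injective_id.injOn) (fun _ h => h) ?_
    intro x _ y _ hxy
    rw [hcast, hcast] at hxy
    exact hinj (mem_coe.2 (mem_image_of_mem _ (mem_univ x)))
      (mem_coe.2 (mem_image_of_mem _ (mem_univ y))) hxy

/-! ### Vinogradov's mean value -/

/-- The vector of the first `k` positive powers of `x`. -/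
def powerVec (k x : ℕ) : Fin k → ℤ := fun j => (x : ℤ) ^ (j + 1 : ℕ)

/-- Vinogradov's mean value, as a number of solutions of a system of equations. -/
def meanValue (ι : Type*) [Fintype ι] [DecidableEq ι] (k P : ℕ) : ℕ :=
  energy (fun x : ι → Fin P => ∑ i, powerVec k (x i)) univ

theorem sum_powerVec_eq_iff {ι : Type*} [Fintype ι] {k : ℕ} {x y : ι → ℕ} :
    ∑ i, powerVec k (x i) = ∑ i, powerVec k (y i) ↔
      ∀ j : Fin k, ∑ i, (x i : ℤ) ^ (j + 1 : ℕ) = ∑ i, (y i : ℤ) ^ (j + 1 : ℕ) := by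
  rw [funext_iff]
  simp [powerVec, Finset.sum_apply]

theorem sum_sub_pow_eq {ι : Type*} [Fintype ι] {k : ℕ} {x y : ι → ℤ} (c : ℤ)
    (h : ∀ j : Fin k, ∑ i, x i ^ (j + 1 : ℕ) = ∑ i, y i ^ (j + 1 : ℕ)) (j : Fin k) :
    ∑ i, (x i - c) ^ (j + 1 : ℕ) = ∑ i, (y i - c) ^ (j + 1 : ℕ) := by
  have h' : ∀ m ≤ (j : ℕ) + 1, ∑ i, x i ^ m = ∑ i, y i ^ m := by
    intro m hm
    rcases m with _ | m
    · simp
    · exact h ⟨m, by omega⟩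
  have expand : ∀ z : ι → ℤ, ∑ i, (z i - c) ^ (j + 1 : ℕ) =
      ∑ m ∈ range (j + 1 + 1), (∑ i, z i ^ m) *
        ((-c) ^ ((j : ℕ) + 1 - m) * ((j : ℕ) + 1).choose m) := by
    intro z
    simp only [sub_eq_add_neg, add_pow, sum_mul]
    rw [sum_comm]
    simp only [mul_assoc]
  rw [expand, expand]
  refine sum_congr rfl fun m hm => ?_
  rw [h' m (by have := mem_range.1 hm; omega)]

theorem meanValue_le_of_equiv {ι κ : Type*} [Fintype ι] [DecidableEq ι] [Fintype κ]
    [DecidableEq κ] (e : ι ≃ κ) (k P : ℕ) : meanValue ι k P ≤ meanValue κ k P := by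
  refine energy_le_of_injOn (fun x => x ∘ e.symm) ?_ (fun _ _ => mem_univ _) ?_
  · exact (e.symm.surjective.injective_comp_right).injOn
  · intro x _ y _ h
    have : ∀ z : ι → Fin P, ∑ i, powerVec k ((z ∘ e.symm) i) = ∑ i, powerVec k (z i) :=
      fun z => e.symm.sum_comp fun i => powerVec k (z i)
    simp only [this]
    exact h

theorem energy_le_card_sq {X G : Type*} [DecidableEq G] (σ : X → G) (S : Finset X) :
    energy σ S ≤ S.card ^ 2 := by
  refine (card_filter_le _ _).trans ?_
  rw [card_product, sq]

theorem meanValue_le_pow (ι : Type*) [Fintype ι] [DecidableEq ι] (k P : ℕ) :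
    meanValue ι k P ≤ P ^ (2 * Fintype.card ι) := by
  refine (energy_le_card_sq _ _).trans ?_
  simp [card_univ, ← pow_mul, mul_comm]

theorem energy_sum_le {X Y G : Type*} [DecidableEq G] [AddCommGroup G] [DecidableEq X]
    (σ : X → G) (ψ : Y → G) (S : Finset X) (T : Finset Y) (B : Finset (X × X))
    (hB : ∀ x ∈ S, ∀ x' ∈ S, ∀ y ∈ T, ∀ y' ∈ T, σ x + ψ y = σ x' + ψ y' → (x, x') ∈ B) :
    energy (fun q : X × Y => σ q.1 + ψ q.2) (S ×ˢ T) ≤ B.card * energy ψ T := by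
  classical
  unfold energy
  rw [card_eq_sum_card_fiberwise (f := fun q => (q.1.1, q.2.1)) (t := B), ← smul_eq_mul]
  · refine sum_le_card_nsmul _ _ _ fun b _ => ?_
    refine le_trans ?_ (card_sub_eq_le_energy ψ T (σ b.2 - σ b.1))
    refine card_le_card_of_injOn (fun q => (q.1.2, q.2.2)) ?_ ?_
    · intro q hq
      simp only [coe_filter, mem_filter, mem_product, Set.mem_ofPred_eq] at hq ⊢
      obtain ⟨⟨⟨h1, h2⟩, h3⟩, h4⟩ := hq
      refine ⟨⟨h1.2, h2.2⟩, ?_⟩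
      rw [← h4]
      simp only
      rw [sub_eq_sub_iff_add_eq_add, add_comm, h3, add_comm]
    · intro q hq r hr hqr
      simp only [coe_filter, mem_filter, Set.mem_ofPred_eq] at hq hr
      have h := hq.2.trans hr.2.symm
      simp only [Prod.mk.injEq] at h hqr
      exact Prod.ext (Prod.ext h.1 hqr.1) (Prod.ext h.2 hqr.2)
  · intro q hq
    simp only [coe_filter, mem_product, Set.mem_ofPred_eq] at hq
    exact hB _ hq.1.1.1 _ hq.1.2.1 _ hq.1.1.2 _ hq.1.2.2 hq.2

/-- The integers below `P` in the residue class `a` modulo `p`. -/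
def residueClass (p P : ℕ) (a : ZMod p) : Finset (Fin P) :=
  univ.filter fun z => ((z : ℕ) : ZMod p) = a

theorem energy_residueClass_le {ι : Type*} [Fintype ι] [DecidableEq ι] {p : ℕ} [NeZero p]
    (k P : ℕ) (a : ZMod p) :
    energy (fun x : ι → Fin P => ∑ i, powerVec k (x i))
      (Fintype.piFinset fun _ => residueClass p P a) ≤ meanValue ι k (P / p + 1) := by
  have hp : 0 < p := NeZero.pos p
  have hmem : ∀ x ∈ Fintype.piFinset fun _ : ι => residueClass p P a, ∀ i,
      ((x i : ℕ) : ℤ) - (a.val : ℤ) = p * (((x i : ℕ) / p : ℕ) : ℤ) := by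
    intro x hx i
    have h1 := (mem_filter.1 (Fintype.mem_piFinset.1 hx i)).2
    have h2 : (x i : ℕ) % p = a.val := by rw [← h1, ZMod.val_natCast]
    have h3 := Nat.div_add_mod (x i : ℕ) p
    rw [h2] at h3
    have h4 : ((x i : ℕ) : ℤ) = p * (((x i : ℕ) / p : ℕ) : ℤ) + a.val := by exact_mod_cast h3.symm
    linarith
  refine energy_le_of_injOn
    (fun x i => ⟨(x i : ℕ) / p, Nat.lt_succ_of_le (Nat.div_le_div_right (x i).2.le)⟩) ?_
    (fun _ _ => mem_univ _) ?_
  · intro x hx y hy hxy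
    funext i
    have h1 := hmem x hx i
    have h2 := hmem y hy i
    have h3 := congrFun hxy i
    simp only [Fin.mk.injEq] at h3
    rw [h3] at h1
    apply Fin.ext
    omega
  · intro x hx y hy hxy
    rw [sum_powerVec_eq_iff] at hxy ⊢
    intro j
    have h := sum_sub_pow_eq (a.val : ℤ) hxy j
    simp only [hmem x hx, hmem y hy, mul_pow, ← mul_sum] at h
    exact mul_left_cancel₀ (by positivity) h

theorem meanValue_sum_le (ι κ : Type*) [Fintype ι] [DecidableEq ι] [Fintype κ] [DecidableEq κ]
    (k P : ℕ) :
    meanValue (ι ⊕ κ) k P ≤ P ^ (2 * Fintype.card ι) * meanValue κ k P := by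
  have h := energy_sum_le (fun x : ι → Fin P => ∑ i, powerVec k (x i))
    (fun x : κ → Fin P => ∑ i, powerVec k (x i)) univ univ univ
      (fun _ _ _ _ _ _ _ _ _ => mem_univ _)
  refine le_trans ?_ (h.trans (le_of_eq ?_))
  · refine energy_le_of_injOn (fun x => (x ∘ Sum.inl, x ∘ Sum.inr)) ?_ (by simp) ?_
    · intro x _ y _ hxy
      simp only [Prod.mk.injEq] at hxy
      funext i
      rcases i with i | i
      · exact congrFun hxy.1 i
      · exact congrFun hxy.2 i
    · intro x _ y _ hxy
      simpa [Fintype.sum_sum_type] using hxy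
  · simp [meanValue, card_univ, two_mul, pow_add]

/-- The `k`-tuples below `P` whose entries are distinct modulo `p`. -/
def distinctTuples (p k P : ℕ) : Finset (Fin k → Fin P) :=
  univ.filter fun x => Function.Injective fun i => ((x i : ℕ) : ZMod p)

theorem energy_distinct_residueClass_le {κ : Type*} [Fintype κ] [DecidableEq κ] {p k P : ℕ}
    [Fact p.Prime] (hk : k < p) (hk0 : 0 < k) (hP : P ≤ p ^ k) (a : ZMod p) :
    energy (fun q : (Fin k → Fin P) × (κ → Fin P) =>
        ∑ i, powerVec k (q.1 i) + ∑ i, powerVec k (q.2 i))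
      (distinctTuples p k P ×ˢ Fintype.piFinset fun _ => residueClass p P a) ≤
      P ^ k * (k ^ k * p ^ (k * (k - 1) / 2)) * meanValue κ k (P / p + 1) := by
  classical
  let B : Finset ((Fin k → Fin P) × (Fin k → Fin P)) := univ.filter fun b =>
    b.1 ∈ distinctTuples p k P ∧ ∀ j : Fin k, (p : ℤ) ^ (j + 1 : ℕ) ∣
      ∑ i, (((b.1 i : ℕ) : ℤ) - a.val) ^ (j + 1 : ℕ) -
        ∑ i, (((b.2 i : ℕ) : ℤ) - a.val) ^ (j + 1 : ℕ)
  have hBcard : B.card ≤ P ^ k * (k ^ k * p ^ (k * (k - 1) / 2)) := by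
    rw [card_eq_sum_card_fiberwise (f := Prod.snd) (t := univ) (fun _ _ => mem_univ _)]
    refine (sum_le_card_nsmul _ _ (k ^ k * p ^ (k * (k - 1) / 2)) fun y _ => ?_).trans
      (le_of_eq (by simp [card_univ]))
    let S : Finset (Fin k → Fin P) := univ.filter fun x => (x, y) ∈ B
    have hcard : (B.filter fun b => b.2 = y).card ≤ S.card := by
      refine card_le_card_of_injOn Prod.fst ?_ ?_
      · rintro ⟨b1, b2⟩ hb
        simp only [coe_filter, Set.mem_ofPred_eq] at hb
        obtain ⟨hb, rfl⟩ := hb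
        simpa [S] using hb
      · rintro ⟨b1, b2⟩ hb ⟨c1, c2⟩ hc h
        simp only [coe_filter, Set.mem_ofPred_eq] at hb hc
        exact Prod.ext h (hb.2.trans hc.2.symm)
    refine hcard.trans (card_powerSum_congruence_le hk hk0 hP (a.val : ℤ)
      (fun j => ∑ i, (((y i : ℕ) : ℤ) - a.val) ^ (j + 1 : ℕ)) S ?_ ?_)
    · intro x hx
      have := (mem_filter.1 (mem_filter.1 hx).2).2.1
      exact (mem_filter.1 this).2
    · intro x hx j
      exact (mem_filter.1 (mem_filter.1 hx).2).2.2 j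
  have hdvd : ∀ y ∈ Fintype.piFinset fun _ : κ => residueClass p P a, ∀ i,
      (p : ℤ) ∣ ((y i : ℕ) : ℤ) - (a.val : ℤ) := by
    intro y hy i
    have h1 := (mem_filter.1 (Fintype.mem_piFinset.1 hy i)).2
    rw [← ZMod.intCast_eq_intCast_iff_dvd_sub]
    simp [h1]
  refine (energy_sum_le (fun x : Fin k → Fin P => ∑ i, powerVec k (x i))
    (fun x : κ → Fin P => ∑ i, powerVec k (x i)) _ _ B ?_).trans
    (Nat.mul_le_mul hBcard (energy_residueClass_le k P a))
  intro x hx x' _ y hy y' hy' h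
  refine mem_filter.2 ⟨mem_univ _, hx, fun j => ?_⟩
  have h' : ∑ i : Fin k ⊕ κ, powerVec k (Sum.elim (fun i => (x i : ℕ)) (fun i => (y i : ℕ)) i) =
      ∑ i : Fin k ⊕ κ, powerVec k (Sum.elim (fun i => (x' i : ℕ)) (fun i => (y' i : ℕ)) i) := by
    simpa [Fintype.sum_sum_type] using h
  rw [sum_powerVec_eq_iff] at h'
  have h2 := sum_sub_pow_eq (a.val : ℤ) h' j
  simp only [Fintype.sum_sum_type, Sum.elim_inl, Sum.elim_inr] at h2
  have h3 : ∑ i, (((x i : ℕ) : ℤ) - a.val) ^ (j + 1 : ℕ) -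
      ∑ i, (((x' i : ℕ) : ℤ) - a.val) ^ (j + 1 : ℕ) =
      ∑ i, (((y' i : ℕ) : ℤ) - a.val) ^ (j + 1 : ℕ) -
      ∑ i, (((y i : ℕ) : ℤ) - a.val) ^ (j + 1 : ℕ) := by linarith
  simp only [h3]
  exact dvd_sub (dvd_sum fun i _ => pow_dvd_pow_of_dvd (hdvd y' hy' i) _)
    (dvd_sum fun i _ => pow_dvd_pow_of_dvd (hdvd y hy i) _)

theorem exists_perm_or_few_residues {p k s : ℕ} (r : Fin k ⊕ Fin s → ZMod p) :
    (∃ τ : Equiv.Perm (Fin k ⊕ Fin s), Function.Injective fun i => r (τ (Sum.inl i))) ∨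
      ∃ q : (Fin k ⊕ Fin s → Fin k) × (Fin k → ZMod p), ∀ i, r i = q.2 (q.1 i) := by
  classical
  rcases le_total k (univ.image r).card with h | h
  · left
    obtain ⟨I, hI, hIk⟩ := exists_subset_card_eq h
    have hch : ∀ c : I, ∃ i, r i = c := fun c => by
      simpa using hI c.2
    choose f hf using hch
    let g : Fin k → Fin k ⊕ Fin s := fun i => f ((I.equivFinOfCardEq hIk).symm i)
    have hrg : Function.Injective fun i => r (g i) := by
      intro i j hij
      simp only [g, hf] at hij
      exact (I.equivFinOfCardEq hIk).symm.injective (Subtype.ext hij)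
    have hg : Function.Injective g := fun i j hij => hrg (by simp only [hij])
    have hc : Fintype.card ((Set.range g)ᶜ : Set (Fin k ⊕ Fin s)) = Fintype.card (Fin s) := by
      rw [Fintype.card_compl_set, Set.card_range_of_injective hg]
      simp
    let τ : Equiv.Perm (Fin k ⊕ Fin s) :=
      (Equiv.sumCongr (Equiv.ofInjective g hg) (Fintype.equivOfCardEq hc).symm).trans
        (Equiv.Set.sumCompl (Set.range g))
    refine ⟨τ, ?_⟩
    have : ∀ i, τ (Sum.inl i) = g i := fun i => by simp [τ]
    simpa only [this] using hrg
  · right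
    let I := univ.image r
    let e : I ≃ Fin I.card := I.equivFin
    refine ⟨(fun i => Fin.castLE h (e ⟨r i, mem_image_of_mem _ (mem_univ i)⟩),
      fun j => if hj : (j : ℕ) < I.card then (e.symm ⟨j, hj⟩ : I) else 0), fun i => ?_⟩
    simp [(e ⟨r i, mem_image_of_mem _ (mem_univ i)⟩).2]

theorem meanValue_recursion {p k s P : ℕ} [Fact p.Prime] (hk : k < p) (hk0 : 0 < k) (hs : 0 < s)
    (hP : P ≤ p ^ k) :
    meanValue (Fin (k + s)) k P ≤
      2 * ((((k + s).factorial) ^ 2 * p ^ (2 * s) * (P ^ k * (k ^ k * p ^ (k * (k - 1) / 2))) +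
        (k ^ (k + s) * p ^ k) ^ 2 * (P / p + 1) ^ (2 * k)) *
          meanValue (Fin s) k (P / p + 1)) := by
  classical
  refine (meanValue_le_of_equiv finSumFinEquiv.symm k P).trans ?_
  let ι := Fin k ⊕ Fin s
  let σ : (ι → Fin P) → Fin k → ℤ := fun x => ∑ i, powerVec k (x i)
  let Good : Finset (ι → Fin P) := univ.filter fun x =>
    ∃ τ : Equiv.Perm ι, Function.Injective fun i => ((x (τ (Sum.inl i)) : ℕ) : ZMod p)
  let Bad : Finset (ι → Fin P) := univ.filter fun x =>
    ∃ q : (ι → Fin k) × (Fin k → ZMod p), ∀ i, ((x i : ℕ) : ZMod p) = q.2 (q.1 i)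
  have hcov : energy σ univ ≤ 2 * (energy σ Good + energy σ Bad) := by
    have := energy_le_card_mul_sum (C := Bool) σ univ (fun b => if b then Good else Bad) ?_
    · simpa using this
    · intro x _
      rcases exists_perm_or_few_residues (fun i => ((x i : ℕ) : ZMod p)) with h | h
      · exact ⟨true, mem_filter.2 ⟨mem_univ _, h⟩⟩
      · exact ⟨false, mem_filter.2 ⟨mem_univ _, h⟩⟩
  refine hcov.trans (Nat.mul_le_mul_left _ ?_)
  rw [add_mul]
  have : Nonempty (Fin s) := ⟨⟨0, hs⟩⟩
  refine add_le_add ?_ ?_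
  · let J := P ^ k * (k ^ k * p ^ (k * (k - 1) / 2)) * meanValue (Fin s) k (P / p + 1)
    let F : (Fin k → Fin P) × (Fin s → Fin P) → Fin k → ℤ := fun q =>
      ∑ i, powerVec k (q.1 i) + ∑ i, powerVec k (q.2 i)
    have h1 : energy F (distinctTuples p k P ×ˢ univ) ≤ p ^ (2 * s) * J := by
      have h := energy_le_card_mul_sum (C := Fin s → ZMod p) F (distinctTuples p k P ×ˢ univ)
        (fun c => distinctTuples p k P ×ˢ Fintype.piFinset fun i => residueClass p P (c i)) (by
          intro x hx
          refine ⟨fun i => ((x.2 i : ℕ) : ZMod p), mem_product.2 ⟨(mem_product.1 hx).1, ?_⟩⟩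
          simp [residueClass])
      refine h.trans ?_
      have h2 : ∀ c : Fin s → ZMod p, energy F (distinctTuples p k P ×ˢ
          Fintype.piFinset fun i => residueClass p P (c i)) ≤ J := by
        intro c
        obtain ⟨i₀, hi₀⟩ := exists_energy_pi_le
          (fun x : Fin k → Fin P => ∑ i, powerVec k (x i)) (fun z : Fin P => powerVec k z)
          (distinctTuples p k P) (residueClass p P) c
        exact hi₀.trans (energy_distinct_residueClass_le hk hk0 hP _)
      refine (Nat.mul_le_mul_left _ (sum_le_card_nsmul _ _ _ fun c _ => h2 c)).trans (le_of_eq ?_)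
      simp [card_univ, two_mul, pow_add, ZMod.card]
      ring
    have h := energy_le_card_mul_sum (C := Equiv.Perm ι) σ Good
      (fun τ => univ.filter fun x : ι → Fin P =>
        Function.Injective fun i => ((x (τ (Sum.inl i)) : ℕ) : ZMod p)) (by
          intro x hx
          obtain ⟨τ, hτ⟩ := (mem_filter.1 hx).2
          exact ⟨τ, mem_filter.2 ⟨mem_univ _, hτ⟩⟩)
    refine h.trans ?_
    have h3 : ∀ τ : Equiv.Perm ι, energy σ (univ.filter fun x : ι → Fin P =>
        Function.Injective fun i => ((x (τ (Sum.inl i)) : ℕ) : ZMod p)) ≤ p ^ (2 * s) * J := by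
      intro τ
      refine le_trans ?_ h1
      refine energy_le_of_injOn
        (fun x => (fun i => x (τ (Sum.inl i)), fun i => x (τ (Sum.inr i)))) ?_ ?_ ?_
      · intro x _ y _ hxy
        simp only [Prod.mk.injEq] at hxy
        funext i
        obtain ⟨i, rfl⟩ := τ.surjective i
        rcases i with i | i
        · exact congrFun hxy.1 i
        · exact congrFun hxy.2 i
      · intro x hx
        simpa [distinctTuples] using hx
      · intro x _ y _ hxy
        have : ∀ z : ι → Fin P, F (fun i => z (τ (Sum.inl i)), fun i => z (τ (Sum.inr i))) =
            σ z := by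
          intro z
          simp only [F, σ]
          rw [← Equiv.sum_comp τ, Fintype.sum_sum_type]
        rw [this, this, hxy]
    refine (Nat.mul_le_mul_left _ (sum_le_card_nsmul _ _ _ fun c _ => h3 c)).trans (le_of_eq ?_)
    rw [card_univ, Fintype.card_perm, smul_eq_mul]
    have : Fintype.card ι = k + s := by simp [ι]
    rw [this]
    ring
  · have h := energy_le_card_mul_sum (C := (ι → Fin k) × (Fin k → ZMod p)) σ Bad
      (fun q => Fintype.piFinset fun i => residueClass p P (q.2 (q.1 i))) (by
        intro x hx
        obtain ⟨q, hq⟩ := (mem_filter.1 hx).2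
        refine ⟨q, ?_⟩
        simpa [residueClass] using hq)
    refine h.trans ?_
    have : Nonempty ι := ⟨Sum.inr ⟨0, hs⟩⟩
    have h2 : ∀ q : (ι → Fin k) × (Fin k → ZMod p), energy σ
        (Fintype.piFinset fun i => residueClass p P (q.2 (q.1 i))) ≤
          (P / p + 1) ^ (2 * k) * meanValue (Fin s) k (P / p + 1) := by
      intro q
      obtain ⟨i₀, hi₀⟩ := exists_energy_pi_le (fun _ : Unit => (0 : Fin k → ℤ))
        (fun z : Fin P => powerVec k z) univ (residueClass p P) (fun i => q.2 (q.1 i))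
      have h3 := energy_residueClass_le (ι := ι) k P (q.2 (q.1 i₀))
      have h4 := meanValue_sum_le (Fin k) (Fin s) k (P / p + 1)
      rw [Fintype.card_fin] at h4
      refine le_trans ?_ (hi₀.trans (le_trans ?_ (h3.trans h4)))
      · refine energy_le_of_injOn (fun x => ((), x)) (fun x _ y _ h => by simpa using h)
          (by simp) ?_
        intro x _ y _ hxy
        simpa using hxy
      · refine energy_le_of_injOn (fun x => x.2) (fun x _ y _ h => by ext; simp_all) (by simp) ?_
        intro x _ y _ hxy
        simpa using hxy
    refine (Nat.mul_le_mul_left _ (sum_le_card_nsmul _ _ _ fun c _ => h2 c)).trans (le_of_eq ?_)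
    rw [card_univ, smul_eq_mul]
    have : Fintype.card ((ι → Fin k) × (Fin k → ZMod p)) = k ^ (k + s) * p ^ k := by
      simp [ι, ZMod.card]
    rw [this]
    ring

theorem exists_prime_near_root {k P : ℕ} (hk : 2 ≤ k) (hP : k ^ k < P) :
    ∃ p : ℕ, p.Prime ∧ k < p ∧ P ≤ p ^ k ∧ (P : ℝ) ^ (1 / k : ℝ) ≤ p ∧
      (p : ℝ) ≤ 4 * (P : ℝ) ^ (1 / k : ℝ) := by
  classical
  have hk0 : k ≠ 0 := by omega
  have hkr : (k : ℝ) ≠ 0 := by exact_mod_cast hk0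
  have hex : ∃ m : ℕ, P ≤ m ^ k := ⟨P, Nat.le_self_pow hk0 P⟩
  obtain ⟨m, hm, hmin⟩ : ∃ m : ℕ, P ≤ m ^ k ∧ ∀ l < m, l ^ k < P :=
    ⟨Nat.find hex, Nat.find_spec hex, fun l hl => not_le.1 (Nat.find_min hex hl)⟩
  have hkm : k < m := by
    by_contra h
    have := Nat.pow_le_pow_left (not_lt.1 h) k
    omega
  obtain ⟨p, hp, hmp, hp2⟩ := Nat.exists_prime_lt_and_le_two_mul m (by omega)
  have hpk : P ≤ p ^ k := hm.trans (Nat.pow_le_pow_left hmp.le k)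
  have hroot : ∀ x : ℕ, (x : ℝ) = ((x : ℝ) ^ k) ^ (1 / k : ℝ) := by
    intro x
    rw [← Real.rpow_natCast, ← Real.rpow_mul (by positivity), mul_one_div_cancel hkr,
      Real.rpow_one]
  refine ⟨p, hp, by omega, hpk, ?_, ?_⟩
  · rw [hroot p]
    exact Real.rpow_le_rpow (by positivity) (by exact_mod_cast hpk) (by positivity)
  · have h1 : ((m - 1 : ℕ) : ℝ) ≤ (P : ℝ) ^ (1 / k : ℝ) := by
      rw [hroot (m - 1)]
      exact Real.rpow_le_rpow (by positivity) (by exact_mod_cast (hmin (m - 1) (by omega)).le)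
        (by positivity)
    have h2 : (p : ℝ) ≤ 4 * ((m - 1 : ℕ) : ℝ) := by
      have : p ≤ 4 * (m - 1) := by omega
      exact_mod_cast this
    linarith

/-- The constant lost in one step of the mean value iteration. -/
noncomputable def stepConst (k s : ℕ) : ℝ :=
  2 * 5 ^ (2 * s) * ((((k + s).factorial : ℝ)) ^ 2 * k ^ k * 4 ^ (k ^ 2) +
    (k : ℝ) ^ (2 * (k + s)) * 5 ^ (2 * k))

theorem meanValue_step {k s : ℕ} (hk : 2 ≤ k) (hs : k ^ 2 ≤ s) {D δ : ℝ} (hD : 0 ≤ D)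
    (hδ0 : 0 ≤ δ) (hδ : δ ≤ (k * (k + 1) / 2 : ℝ))
    (h : ∀ P : ℕ, 1 ≤ P → (meanValue (Fin s) k P : ℝ) ≤
      D * (P : ℝ) ^ (2 * s - k * (k + 1) / 2 + δ : ℝ))
    {P : ℕ} (hP : k ^ k < P) :
    (meanValue (Fin (k + s)) k P : ℝ) ≤ D * stepConst k s *
      (P : ℝ) ^ (2 * (k + s : ℕ) - k * (k + 1) / 2 + δ * (1 - 1 / k) : ℝ) := by
  obtain ⟨p, hp, hkp, hPp, hp1, hp2⟩ := exists_prime_near_root hk hP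
  have : Fact p.Prime := ⟨hp⟩
  have hk0 : 0 < k := by omega
  have hkr : (0 : ℝ) < k := by exact_mod_cast hk0
  have hk1 : (1 : ℝ) ≤ k := by exact_mod_cast hk0
  have hs0 : 0 < s := lt_of_lt_of_le (by positivity) hs
  have hsr : (k : ℝ) ^ 2 ≤ s := by exact_mod_cast hs
  have hP0 : 0 < P := lt_of_le_of_lt (Nat.zero_le _) hP
  have hPr : (0 : ℝ) < P := by exact_mod_cast hP0
  have hP1 : (1 : ℝ) ≤ P := by exact_mod_cast hP0
  have hpr : (0 : ℝ) < p := by exact_mod_cast hp.pos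
  have hrec := meanValue_recursion hkp hk0 hs0 hPp
  set Q := P / p + 1 with hQ
  set e : ℝ := 2 * s - k * (k + 1) / 2 + δ with he
  have he0 : δ ≤ e := by rw [he]; nlinarith
  have he2 : e ≤ (2 * s : ℕ) := by rw [he]; push_cast; linarith
  have hXP : (P : ℝ) ^ (1 / k : ℝ) ≤ P := by
    conv_rhs => rw [← Real.rpow_one (P : ℝ)]
    exact Real.rpow_le_rpow_of_exponent_le hP1 (by rw [div_le_one hkr]; exact hk1)
  have hQr : (Q : ℝ) ≤ 5 * P / p := by
    have h1 : ((P / p : ℕ) : ℝ) ≤ P / p := Nat.cast_div_le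
    rw [hQ]
    push_cast
    rw [le_div_iff₀ hpr, add_mul]
    have := (le_div_iff₀ hpr).1 h1
    linarith
  have hQe : (Q : ℝ) ^ e ≤ 5 ^ (2 * s) * ((P : ℝ) ^ e * (p : ℝ) ^ (-e)) := by
    calc (Q : ℝ) ^ e ≤ (5 * P / p) ^ e :=
          Real.rpow_le_rpow (by positivity) hQr (hδ0.trans he0)
      _ = 5 ^ e * ((P : ℝ) ^ e * (p : ℝ) ^ (-e)) := by
          rw [mul_div_assoc, Real.mul_rpow (by norm_num) (by positivity),
            Real.div_rpow hPr.le hpr.le, Real.rpow_neg hpr.le, div_eq_mul_inv]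
      _ ≤ _ := by
          gcongr
          rw [← Real.rpow_natCast]
          exact Real.rpow_le_rpow_of_exponent_le (by norm_num) he2
  have hmain : (P : ℝ) ^ k * (p : ℝ) ^ (2 * s + k * (k - 1) / 2) *
      ((P : ℝ) ^ e * (p : ℝ) ^ (-e)) ≤
      4 ^ (k ^ 2) * (P : ℝ) ^ (e + 2 * k - δ / k) := by
    have hexp : ((2 * s + k * (k - 1) / 2 : ℕ) : ℝ) + -e = k ^ 2 - δ := by
      have h2 : (((k * (k - 1) / 2 : ℕ)) : ℝ) = k * (k - 1) / 2 := by
        rw [Nat.cast_div (even_iff_two_dvd.1 (Nat.even_mul_pred_self k)) (by norm_num)]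
        push_cast [Nat.cast_sub hk0]
        ring
      push_cast
      rw [h2, he]
      ring
    have hnn : (0 : ℝ) ≤ k ^ 2 - δ := by nlinarith
    calc _ = (P : ℝ) ^ (k + e) * (p : ℝ) ^ ((k : ℝ) ^ 2 - δ) := by
          rw [← hexp, Real.rpow_add hPr (k : ℝ) e, Real.rpow_add hpr, Real.rpow_natCast,
            Real.rpow_natCast]
          ring
      _ ≤ (P : ℝ) ^ (k + e) * (4 * (P : ℝ) ^ (1 / k : ℝ)) ^ ((k : ℝ) ^ 2 - δ) := by gcongr
      _ = (P : ℝ) ^ (k + e) * (4 ^ ((k : ℝ) ^ 2 - δ) * (P : ℝ) ^ (k - δ / k)) := by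
          rw [Real.mul_rpow (by norm_num) (by positivity), ← Real.rpow_mul hPr.le]
          congr 3
          field_simp
      _ ≤ (P : ℝ) ^ (k + e) * (4 ^ (k ^ 2) * (P : ℝ) ^ (k - δ / k)) := by
          have h4 : (4 : ℝ) ^ ((k : ℝ) ^ 2 - δ) ≤ 4 ^ (k ^ 2) := by
            rw [← Real.rpow_natCast 4 (k ^ 2)]
            refine Real.rpow_le_rpow_of_exponent_le (by norm_num) ?_
            push_cast
            linarith
          gcongr
      _ = _ := by
          rw [show e + 2 * k - δ / k = (k + e) + (k - δ / k) by ring,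
            Real.rpow_add hPr (k + e)]
          ring
  have hbad : (p : ℝ) ^ (2 * k) * (Q : ℝ) ^ (2 * k) * ((P : ℝ) ^ e * (p : ℝ) ^ (-e)) ≤
      5 ^ (2 * k) * (P : ℝ) ^ (e + 2 * k - δ / k) := by
    have h1 : (p : ℝ) * Q ≤ 5 * P := by
      rw [mul_comm]
      exact (le_div_iff₀ hpr).1 hQr
    have h2 : (p : ℝ) ^ (-e) ≤ (P : ℝ) ^ (-(δ / k)) := by
      calc (p : ℝ) ^ (-e) ≤ ((P : ℝ) ^ (1 / k : ℝ)) ^ (-e) := by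
            exact Real.rpow_le_rpow_of_nonpos (by positivity) hp1 (by linarith)
        _ = (P : ℝ) ^ (1 / k * -e : ℝ) := by rw [← Real.rpow_mul hPr.le]
        _ ≤ _ := by
            refine Real.rpow_le_rpow_of_exponent_le hP1 ?_
            rw [one_div_mul_eq_div, neg_div]
            have := div_le_div_of_nonneg_right he0 hkr.le
            linarith
    calc _ = ((p : ℝ) * Q) ^ (2 * k) * ((P : ℝ) ^ e * (p : ℝ) ^ (-e)) := by rw [mul_pow]
      _ ≤ (5 * P) ^ (2 * k) * ((P : ℝ) ^ e * (P : ℝ) ^ (-(δ / k))) := by gcongr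
      _ = _ := by
          rw [show e + 2 * k - δ / k = e + ((2 * k : ℕ) : ℝ) + -(δ / k) by push_cast; ring,
            Real.rpow_add hPr (e + ((2 * k : ℕ) : ℝ)), Real.rpow_add hPr e, Real.rpow_natCast,
            mul_pow]
          ring
  have hfin : e + 2 * k - δ / k = 2 * (k + s : ℕ) - k * (k + 1) / 2 + δ * (1 - 1 / k) := by
    rw [he]; push_cast; ring
  rw [← hfin]
  set R := (P : ℝ) ^ (e + 2 * k - δ / k)
  have hJ : (meanValue (Fin s) k Q : ℝ) ≤ D * (5 ^ (2 * s) * ((P : ℝ) ^ e * (p : ℝ) ^ (-e))) :=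
    (h Q (Nat.le_add_left 1 _)).trans (mul_le_mul_of_nonneg_left hQe hD)
  calc (meanValue (Fin (k + s)) k P : ℝ) ≤
        2 * ((((k + s).factorial : ℝ) ^ 2 * p ^ (2 * s) *
          (P ^ k * (k ^ k * p ^ (k * (k - 1) / 2))) +
        ((k : ℝ) ^ (k + s) * p ^ k) ^ 2 * Q ^ (2 * k)) * meanValue (Fin s) k Q) := by
        exact_mod_cast hrec
    _ ≤ 2 * ((((k + s).factorial : ℝ) ^ 2 * p ^ (2 * s) *
          (P ^ k * (k ^ k * p ^ (k * (k - 1) / 2))) +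
        ((k : ℝ) ^ (k + s) * p ^ k) ^ 2 * Q ^ (2 * k)) *
          (D * (5 ^ (2 * s) * ((P : ℝ) ^ e * (p : ℝ) ^ (-e))))) := by gcongr
    _ = 2 * D * 5 ^ (2 * s) * (((k + s).factorial : ℝ) ^ 2 * k ^ k *
          ((P : ℝ) ^ k * (p : ℝ) ^ (2 * s + k * (k - 1) / 2) * ((P : ℝ) ^ e * (p : ℝ) ^ (-e))) +
          (k : ℝ) ^ (2 * (k + s)) * ((p : ℝ) ^ (2 * k) * (Q : ℝ) ^ (2 * k) *
            ((P : ℝ) ^ e * (p : ℝ) ^ (-e)))) := by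
        rw [pow_add (p : ℝ) (2 * s), mul_pow, ← pow_mul, ← pow_mul, mul_comm (k + s) 2,
          mul_comm k 2]
        ring
    _ ≤ 2 * D * 5 ^ (2 * s) * (((k + s).factorial : ℝ) ^ 2 * k ^ k * (4 ^ (k ^ 2) * R) +
          (k : ℝ) ^ (2 * (k + s)) * (5 ^ (2 * k) * R)) := by gcongr
    _ = D * stepConst k s * R := by unfold stepConst; ring

theorem stepConst_le {k s : ℕ} (hk : 2 ≤ k) (hs : k + s ≤ 9 * k ^ 2) :
    stepConst k s ≤ Real.exp (135 * k ^ 3) := by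
  have hk1 : (1 : ℝ) ≤ k := by exact_mod_cast (by omega : 1 ≤ k)
  have hexp2 : (5 : ℝ) ≤ Real.exp 2 := by
    have : (2.7 : ℝ) ≤ Real.exp 1 := by linarith [Real.exp_one_gt_d9]
    calc (5 : ℝ) ≤ 2.7 * 2.7 := by norm_num
      _ ≤ Real.exp 1 * Real.exp 1 := by gcongr
      _ = _ := by rw [← Real.exp_add]; norm_num
  have hkexp : (k : ℝ) ≤ Real.exp k := by linarith [Real.add_one_le_exp (k : ℝ)]
  have h9 : (9 * k ^ 2 : ℝ) ≤ Real.exp (3 + 2 * k) := by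
    have : (9 : ℝ) ≤ Real.exp 3 := by
      have h27 : (2.7 : ℝ) ≤ Real.exp 1 := by linarith [Real.exp_one_gt_d9]
      calc (9 : ℝ) ≤ 2.7 ^ 3 := by norm_num
        _ ≤ Real.exp 1 ^ 3 := by gcongr
        _ = _ := by rw [← Real.exp_nat_mul]; norm_num
    calc (9 * k ^ 2 : ℝ) ≤ Real.exp 3 * Real.exp k ^ 2 := by gcongr
      _ = _ := by rw [← Real.exp_nat_mul, ← Real.exp_add]; norm_num
  have hfac : ((k + s).factorial : ℝ) ≤ Real.exp (3 + 2 * k) ^ (9 * k ^ 2) := by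
    calc ((k + s).factorial : ℝ) ≤ ((9 * k ^ 2).factorial : ℝ) := by
          exact_mod_cast Nat.factorial_le hs
      _ ≤ ((9 * k ^ 2 : ℕ) : ℝ) ^ (9 * k ^ 2) := by exact_mod_cast Nat.factorial_le_pow _
      _ ≤ _ := by
          push_cast
          gcongr
  have hkpow : (k : ℝ) ^ (2 * (k + s)) ≤ (Real.exp (3 + 2 * k) ^ (9 * k ^ 2)) ^ 2 := by
    calc (k : ℝ) ^ (2 * (k + s)) ≤ (k : ℝ) ^ (2 * (9 * k ^ 2)) := by gcongr
      _ ≤ (9 * k ^ 2 : ℝ) ^ (2 * (9 * k ^ 2)) := by gcongr; nlinarith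
      _ ≤ Real.exp (3 + 2 * k) ^ (2 * (9 * k ^ 2)) := by gcongr
      _ = _ := by rw [← pow_mul, mul_comm (9 * k ^ 2) 2]
  have h5 : (5 : ℝ) ^ (2 * s) ≤ Real.exp 2 ^ (18 * k ^ 2) := by
    calc (5 : ℝ) ^ (2 * s) ≤ 5 ^ (18 * k ^ 2) := pow_le_pow_right₀ (by norm_num) (by omega)
      _ ≤ _ := by gcongr
  set F := Real.exp (3 + 2 * k) ^ (9 * k ^ 2) with hF
  have hF1 : 0 < F := by positivity
  have h4 : (4 : ℝ) ^ (k ^ 2) ≤ Real.exp 2 ^ (k ^ 2) := by gcongr; linarith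
  have h52 : (5 : ℝ) ^ (2 * k) ≤ Real.exp 2 ^ (2 * k) := by gcongr
  have hkk : (k : ℝ) ^ k ≤ Real.exp k ^ k := by gcongr
  have one_le : ∀ n : ℕ, (1 : ℝ) ≤ Real.exp 2 ^ n := fun n => one_le_pow₀ (by linarith)
  have hek : (1 : ℝ) ≤ Real.exp k ^ k := one_le_pow₀ (by linarith)
  unfold stepConst
  calc _ ≤ 2 * Real.exp 2 ^ (18 * k ^ 2) * (F ^ 2 * Real.exp k ^ k * Real.exp 2 ^ (k ^ 2) +
        F ^ 2 * Real.exp 2 ^ (2 * k)) := by gcongr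
    _ ≤ 2 * Real.exp 2 ^ (18 * k ^ 2) *
        (F ^ 2 * Real.exp k ^ k * Real.exp 2 ^ (k ^ 2) * Real.exp 2 ^ (2 * k) +
        F ^ 2 * Real.exp k ^ k * Real.exp 2 ^ (k ^ 2) * Real.exp 2 ^ (2 * k)) := by
        refine mul_le_mul_of_nonneg_left (add_le_add ?_ ?_) (by positivity)
        · exact le_mul_of_one_le_right (by positivity) (one_le _)
        · refine mul_le_mul_of_nonneg_right ?_ (by positivity)
          rw [mul_assoc]
          exact le_mul_of_one_le_right (by positivity)
            (one_le_mul_of_one_le_of_one_le hek (one_le _))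
    _ = 4 * (Real.exp 2 ^ (18 * k ^ 2) * F ^ 2 * Real.exp k ^ k * Real.exp 2 ^ (k ^ 2) *
          Real.exp 2 ^ (2 * k)) := by ring
    _ ≤ Real.exp 2 * (Real.exp 2 ^ (18 * k ^ 2) * F ^ 2 * Real.exp k ^ k * Real.exp 2 ^ (k ^ 2) *
          Real.exp 2 ^ (2 * k)) := by gcongr; linarith
    _ = Real.exp (2 + (36 * k ^ 2 + 18 * k ^ 2 * (3 + 2 * k) + k ^ 2 + 2 * k ^ 2 + 4 * k)) := by
        rw [hF]
        simp only [← Real.exp_nat_mul, ← Real.exp_add]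
        congr 1
        push_cast
        ring
    _ ≤ _ := by
        apply Real.exp_le_exp.2
        have h2 : (k : ℝ) ^ 2 ≤ k ^ 3 := pow_le_pow_right₀ hk1 (by norm_num)
        have h1 : (k : ℝ) ≤ k ^ 3 := le_self_pow₀ hk1 (by norm_num)
        have h0 : (1 : ℝ) ≤ k ^ 3 := one_le_pow₀ hk1
        nlinarith

theorem meanValue_iterate {k : ℕ} (hk : 2 ≤ k) (l : ℕ) (hl : l ≤ 8 * k) {P : ℕ} (hP : 1 ≤ P) :
    (meanValue (Fin (k ^ 2 + l * k)) k P : ℝ) ≤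
      Real.exp (k ^ 4 + l * (135 * k ^ 3)) *
        (P : ℝ) ^ (2 * (k ^ 2 + l * k : ℕ) - k * (k + 1) / 2 +
          k * (k + 1) / 2 * (1 - 1 / k) ^ l : ℝ) := by
  have hkr : (0 : ℝ) < k := by exact_mod_cast (by omega : 0 < k)
  have hk1 : (1 : ℝ) ≤ k := by exact_mod_cast (by omega : 1 ≤ k)
  have h1k : (0 : ℝ) ≤ 1 - 1 / k := by
    rw [sub_nonneg, div_le_one hkr]; exact hk1
  have h1k' : (1 : ℝ) - 1 / k ≤ 1 := by
    have : (0 : ℝ) ≤ 1 / k := by positivity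
    linarith
  have htriv : ∀ s P : ℕ, (meanValue (Fin s) k P : ℝ) ≤ (P : ℝ) ^ (2 * s) := by
    intro s P
    have := meanValue_le_pow (Fin s) k P
    rw [Fintype.card_fin] at this
    exact_mod_cast this
  induction l generalizing P with
  | zero =>
    refine (htriv _ P).trans ?_
    have : (P : ℝ) ^ (2 * (k ^ 2 + 0 * k : ℕ) - k * (k + 1) / 2 +
          k * (k + 1) / 2 * (1 - 1 / k) ^ 0 : ℝ) = (P : ℝ) ^ (2 * (k ^ 2 + 0 * k)) := by
      rw [← Real.rpow_natCast (P : ℝ)]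
      congr 1
      push_cast
      ring
    rw [this]
    refine le_mul_of_one_le_left (by positivity) (Real.one_le_exp (by positivity))
  | succ l ih =>
    have hsk : k ^ 2 + (l + 1) * k = k + (k ^ 2 + l * k) := by ring
    rw [hsk]
    have hPr : (1 : ℝ) ≤ P := by exact_mod_cast hP
    rcases le_or_gt P (k ^ k) with hPk | hPk
    · refine (htriv _ P).trans ?_
      have hpos : (0 : ℝ) ≤ k * (k + 1) / 2 * (1 - 1 / k) ^ (l + 1) := by positivity
      have hkk2 : (k * (k + 1) / 2 : ℝ) ≤ (k ^ 2 : ℕ) := by push_cast; nlinarith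
      have h1 : (P : ℝ) ^ (2 * (k + (k ^ 2 + l * k))) ≤ (P : ℝ) ^ (k ^ 2) *
          (P : ℝ) ^ (2 * (k + (k ^ 2 + l * k) : ℕ) - k * (k + 1) / 2 +
          k * (k + 1) / 2 * (1 - 1 / k) ^ (l + 1) : ℝ) := by
        rw [← Real.rpow_natCast, ← Real.rpow_natCast, ← Real.rpow_add (by linarith)]
        refine Real.rpow_le_rpow_of_exponent_le hPr ?_
        push_cast at hkk2 ⊢
        linarith
      refine h1.trans ?_
      gcongr
      calc (P : ℝ) ^ (k ^ 2) ≤ ((k : ℝ) ^ k) ^ (k ^ 2) := by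
            gcongr
            exact_mod_cast hPk
        _ ≤ (Real.exp k ^ k) ^ (k ^ 2) := by
            gcongr
            linarith [Real.add_one_le_exp (k : ℝ)]
        _ = Real.exp (k ^ 4) := by
            rw [← Real.exp_nat_mul, ← Real.exp_nat_mul]
            congr 1
            push_cast
            ring
        _ ≤ _ := by
            apply Real.exp_le_exp.2
            have : (0 : ℝ) ≤ ((l + 1 : ℕ) : ℝ) * (135 * k ^ 3) := by positivity
            linarith
    · have hn : k + (k ^ 2 + l * k) ≤ 9 * k ^ 2 := by
        have := Nat.mul_le_mul_right k hl
        nlinarith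
      have hδ : k * (k + 1) / 2 * (1 - 1 / k) ^ l ≤ (k * (k + 1) / 2 : ℝ) :=
        mul_le_of_le_one_right (by positivity) (pow_le_one₀ h1k h1k')
      have h2 := meanValue_step hk (s := k ^ 2 + l * k) (by omega) (Real.exp_pos _).le
        (by positivity) hδ (fun P hP => ih (by omega) hP) hPk
      refine h2.trans ?_
      have h3 := stepConst_le hk hn
      rw [show (k * (k + 1) / 2 * (1 - 1 / k) ^ (l + 1) : ℝ) =
        k * (k + 1) / 2 * (1 - 1 / k) ^ l * (1 - 1 / k) by ring]
      gcongr
      refine (mul_le_mul_of_nonneg_left h3 (Real.exp_pos _).le).trans (le_of_eq ?_)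
      rw [← Real.exp_add]
      congr 1
      push_cast
      ring

/-- Vinogradov's mean value theorem with `9 k²` variables on each side. -/
theorem meanValue_le {k : ℕ} (hk : 2 ≤ k) {P : ℕ} (hP : 1 ≤ P) :
    (meanValue (Fin (9 * k ^ 2)) k P : ℝ) ≤ Real.exp (1081 * k ^ 4) *
      (P : ℝ) ^ (18 * k ^ 2 - k * (k + 1) / 2 * (1 - Real.exp (-8)) : ℝ) := by
  have hkr : (0 : ℝ) < k := by exact_mod_cast (by omega : 0 < k)
  have hk1 : (1 : ℝ) ≤ k := by exact_mod_cast (by omega : 1 ≤ k)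
  have hPr : (1 : ℝ) ≤ P := by exact_mod_cast hP
  have h := meanValue_iterate hk (8 * k) le_rfl hP
  rw [show k ^ 2 + 8 * k * k = 9 * k ^ 2 by ring] at h
  refine h.trans ?_
  have h1 : (1 - 1 / k : ℝ) ^ (8 * k) ≤ Real.exp (-8) := by
    have : (1 - 1 / k : ℝ) ≤ Real.exp (-(1 / k)) := by
      linarith [Real.add_one_le_exp (-(1 / k : ℝ))]
    have h0 : (0 : ℝ) ≤ 1 - 1 / k := by
      rw [sub_nonneg, div_le_one hkr]; exact hk1
    calc (1 - 1 / k : ℝ) ^ (8 * k) ≤ Real.exp (-(1 / k)) ^ (8 * k) := by gcongr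
      _ = _ := by
        rw [← Real.exp_nat_mul]
        congr 1
        push_cast
        field_simp
  refine mul_le_mul (Real.exp_le_exp.2 ?_) (Real.rpow_le_rpow_of_exponent_le hPr ?_)
    (by positivity) (by positivity)
  · push_cast
    nlinarith
  · push_cast
    have : k * (k + 1) / 2 * (1 - 1 / k : ℝ) ^ (8 * k) ≤ k * (k + 1) / 2 * Real.exp (-8) := by
      gcongr
    linarith

/-! ### Bilinear sums -/

section DoubleHolder

open ComplexConjugate

variable {k : ℕ} (θ : Fin k → ℝ)

/-- The bilinear character attached to the frequencies `θ`. -/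
noncomputable def phase (u v : Fin k → ℤ) : ℂ :=
  Complex.exp (((∑ j, θ j * u j * v j : ℝ) : ℂ) * Complex.I)

theorem phase_add (u v w : Fin k → ℤ) : phase θ u (v + w) = phase θ u v * phase θ u w := by
  unfold phase
  rw [← Complex.exp_add, ← add_mul, ← Complex.ofReal_add, ← sum_add_distrib]
  congr 4
  funext j
  simp
  ring

theorem phase_zero (u : Fin k → ℤ) : phase θ u 0 = 1 := by simp [phase]

theorem phase_comm (u v : Fin k → ℤ) : phase θ u v = phase θ v u := by
  unfold phase
  congr 4
  funext j
  ring

theorem phase_neg (u v : Fin k → ℤ) : phase θ u (-v) = conj (phase θ u v) := by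
  unfold phase
  rw [← Complex.exp_conj]
  congr 1
  simp

theorem phase_sum {ι : Type*} (u : Fin k → ℤ) (s : Finset ι) (f : ι → Fin k → ℤ) :
    phase θ u (∑ i ∈ s, f i) = ∏ i ∈ s, phase θ u (f i) := by
  classical
  induction s using Finset.induction_on with
  | empty => simp [phase_zero]
  | insert a s ha ih => rw [sum_insert ha, prod_insert ha, phase_add, ih]

theorem phase_eq_prod (u v : Fin k → ℤ) :
    phase θ u v = ∏ j, Complex.exp (((θ j * u j * v j : ℝ) : ℂ) * Complex.I) := by
  unfold phase
  rw [← Complex.exp_sum, Complex.ofReal_sum, sum_mul]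

/-- The difference of the power sum vectors of two tuples. -/
def powerDiff {s M : ℕ} (k : ℕ) (q : (Fin s → Fin M) × (Fin s → Fin M)) : Fin k → ℤ :=
  ∑ i, powerVec k (q.1 i) - ∑ i, powerVec k (q.2 i)

theorem norm_sum_phase_pow (s M : ℕ) (u : Fin k → ℤ) :
    ((‖∑ y : Fin M, phase θ u (powerVec k y)‖ ^ (2 * s) : ℝ) : ℂ) =
      ∑ q : (Fin s → Fin M) × (Fin s → Fin M), phase θ u (powerDiff k q) := by
  have h1 : (∑ y : Fin M, phase θ u (powerVec k y)) ^ s =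
      ∑ y : Fin s → Fin M, phase θ u (∑ i, powerVec k (y i)) := by
    simp only [phase_sum]
    have := Finset.prod_univ_sum (fun _ : Fin s => (univ : Finset (Fin M)))
      (fun _ y => phase θ u (powerVec k y))
    simpa using this
  rw [pow_mul, Complex.ofReal_pow, Complex.ofReal_pow, ← Complex.mul_conj', mul_pow, ← map_pow, h1,
    map_sum, sum_mul_sum, ← sum_product']
  refine sum_congr rfl fun q _ => ?_
  rw [powerDiff, sub_eq_add_neg, phase_add, phase_neg]

/-- The box containing all `powerDiff k q`. -/
noncomputable def powerBox (k s M : ℕ) : Finset (Fin k → ℤ) :=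
  Fintype.piFinset fun j => Icc (-(s * M ^ (j + 1 : ℕ) : ℤ)) (s * M ^ (j + 1 : ℕ))

theorem powerDiff_mem_powerBox {s M : ℕ} (q : (Fin s → Fin M) × (Fin s → Fin M)) :
    powerDiff k q ∈ powerBox k s M := by
  refine Fintype.mem_piFinset.2 fun j => ?_
  have h : ∀ y : Fin s → Fin M, (0 : ℤ) ≤ ∑ i, ((y i : ℕ) : ℤ) ^ (j + 1 : ℕ) ∧
      ∑ i, ((y i : ℕ) : ℤ) ^ (j + 1 : ℕ) ≤ s * M ^ (j + 1 : ℕ) := by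
    intro y
    refine ⟨by positivity, ?_⟩
    refine (sum_le_card_nsmul _ _ ((M : ℤ) ^ (j + 1 : ℕ)) fun i _ => ?_).trans (by simp)
    have : ((y i : ℕ) : ℤ) ≤ M := by exact_mod_cast (y i).2.le
    gcongr
  have h1 := h q.1
  have h2 := h q.2
  simp only [powerDiff, powerVec, Pi.sub_apply, Finset.sum_apply, mem_Icc]
  constructor <;> linarith

theorem sum_powerDiff_le (s M : ℕ) (f : (Fin k → ℤ) → ℝ) (hf : ∀ v, 0 ≤ f v) :
    ∑ q : (Fin s → Fin M) × (Fin s → Fin M), f (powerDiff k q) ≤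
      meanValue (Fin s) k M * ∑ v ∈ powerBox k s M, f v := by
  classical
  rw [← sum_fiberwise_of_maps_to (g := powerDiff k) (t := powerBox k s M)
    (fun q _ => powerDiff_mem_powerBox q), mul_sum]
  refine sum_le_sum fun v _ => ?_
  rw [sum_congr rfl (g := fun _ => f v) (fun q hq => by rw [(mem_filter.1 hq).2]), sum_const,
    nsmul_eq_mul]
  refine mul_le_mul_of_nonneg_right ?_ (hf v)
  have := card_sub_eq_le_energy (fun x : Fin s → Fin M => ∑ i, powerVec k (x i)) univ v
  rw [univ_product_univ] at this
  exact_mod_cast this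

/-- Average size of a linear exponential sum over a symmetric interval. -/
noncomputable def linearMean (θ : ℝ) (U : ℕ) : ℝ :=
  ∑ u ∈ Icc (-(U : ℤ)) U, ‖∑ v ∈ Icc (-(U : ℤ)) U,
    Complex.exp (((θ * u * v : ℝ) : ℂ) * Complex.I)‖

theorem pow_sum_le_card_pow_mul {ι : Type*} (s : Finset ι) (f : ι → ℝ) (hf : ∀ i, 0 ≤ f i)
    {n : ℕ} (hn : 0 < n) : (∑ i ∈ s, f i) ^ n ≤ (s.card : ℝ) ^ (n - 1) * ∑ i ∈ s, f i ^ n := by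
  obtain ⟨m, rfl⟩ : ∃ m, n = m + 1 := ⟨n - 1, by omega⟩
  rcases s.eq_empty_or_nonempty with rfl | hs
  · simp
  have := pow_sum_div_card_le_sum_pow (s := s) (f := f) (fun i _ => hf i) m
  have hc : (0 : ℝ) < (s.card : ℝ) ^ m := by
    have := hs.card_pos
    positivity
  rw [div_le_iff₀ hc] at this
  simpa [mul_comm] using this

theorem norm_bilinear_sum_pow_le {s : ℕ} (hs : 0 < s) (M : ℕ) :
    ‖∑ x : Fin M, ∑ y : Fin M, phase θ (powerVec k x) (powerVec k y)‖ ^ (4 * s ^ 2) ≤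
      (M : ℝ) ^ (8 * s ^ 2 - 4 * s) * (meanValue (Fin s) k M : ℝ) ^ 2 *
        ∏ j : Fin k, linearMean (θ j) (s * M ^ (j + 1 : ℕ)) := by
  set J : ℝ := ((meanValue (Fin s) k M : ℕ) : ℝ)
  let G : (Fin k → ℤ) → ℝ := fun v => ‖∑ x : Fin M, phase θ v (powerVec k x)‖
  have hbox : ∑ v ∈ powerBox k s M, G v ^ (2 * s) ≤
      J * ∏ j : Fin k, linearMean (θ j) (s * M ^ (j + 1 : ℕ)) := by
    have h1 : ((∑ v ∈ powerBox k s M, G v ^ (2 * s) : ℝ) : ℂ) =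
        ∑ q : (Fin s → Fin M) × (Fin s → Fin M), ∑ v ∈ powerBox k s M,
          phase θ (powerDiff k q) v := by
      rw [Complex.ofReal_sum, sum_comm]
      refine sum_congr rfl fun v _ => ?_
      rw [norm_sum_phase_pow]
      exact sum_congr rfl fun q _ => phase_comm θ _ _
    have h2 : ∑ v ∈ powerBox k s M, G v ^ (2 * s) ≤
        ∑ q : (Fin s → Fin M) × (Fin s → Fin M),
          ‖∑ v ∈ powerBox k s M, phase θ (powerDiff k q) v‖ := by
      refine le_trans (le_of_eq ?_) (norm_sum_le _ _)
      rw [← h1, Complex.norm_real, Real.norm_of_nonneg]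
      exact sum_nonneg fun v _ => by positivity
    refine h2.trans ((sum_powerDiff_le s M
      (fun u => ‖∑ v ∈ powerBox k s M, phase θ u v‖) (fun _ => norm_nonneg _)).trans (le_of_eq ?_))
    congr 1
    unfold linearMean
    rw [prod_univ_sum]
    refine sum_congr (by simp [powerBox]) fun u _ => ?_
    rw [← norm_prod, prod_univ_sum]
    congr 1
    refine sum_congr (by simp [powerBox]) fun v _ => ?_
    exact phase_eq_prod θ u v
  have hx : ∑ x : Fin M, G (powerVec k x) ^ (2 * s) ≤
      ∑ q : (Fin s → Fin M) × (Fin s → Fin M), G (powerDiff k q) := by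
    have h1 : ((∑ x : Fin M, G (powerVec k x) ^ (2 * s) : ℝ) : ℂ) =
        ∑ q : (Fin s → Fin M) × (Fin s → Fin M), ∑ x : Fin M,
          phase θ (powerDiff k q) (powerVec k x) := by
      rw [Complex.ofReal_sum, sum_comm]
      refine sum_congr rfl fun v _ => ?_
      rw [norm_sum_phase_pow]
      exact sum_congr rfl fun q _ => phase_comm θ _ _
    refine le_trans (le_of_eq ?_) (norm_sum_le _ _)
    rw [← h1, Complex.norm_real, Real.norm_of_nonneg]
    exact sum_nonneg fun v _ => by positivity
  have hG : ∀ v, 0 ≤ G v := fun v => norm_nonneg _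
  calc ‖∑ x : Fin M, ∑ y : Fin M, phase θ (powerVec k x) (powerVec k y)‖ ^ (4 * s ^ 2)
      ≤ (∑ x : Fin M, G (powerVec k x)) ^ (4 * s ^ 2) := by
        gcongr
        exact norm_sum_le _ _
    _ = ((∑ x : Fin M, G (powerVec k x)) ^ (2 * s)) ^ (2 * s) := by
        rw [← pow_mul]
        congr 1
        ring
    _ ≤ ((M : ℝ) ^ (2 * s - 1) * ∑ x : Fin M, G (powerVec k x) ^ (2 * s)) ^ (2 * s) := by
        gcongr
        have := pow_sum_le_card_pow_mul univ (fun x : Fin M => G (powerVec k x))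
          (fun _ => hG _) (n := 2 * s) (by omega)
        simpa using this
    _ ≤ ((M : ℝ) ^ (2 * s - 1) *
          ∑ q : (Fin s → Fin M) × (Fin s → Fin M), G (powerDiff k q)) ^ (2 * s) := by gcongr
    _ = ((M : ℝ) ^ (2 * s - 1)) ^ (2 * s) *
          (∑ q : (Fin s → Fin M) × (Fin s → Fin M), G (powerDiff k q)) ^ (2 * s) := by
        rw [mul_pow]
    _ ≤ ((M : ℝ) ^ (2 * s - 1)) ^ (2 * s) * (((M : ℝ) ^ (2 * s)) ^ (2 * s - 1) *
          ∑ q : (Fin s → Fin M) × (Fin s → Fin M), G (powerDiff k q) ^ (2 * s)) := by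
        gcongr
        have := pow_sum_le_card_pow_mul univ
          (fun q : (Fin s → Fin M) × (Fin s → Fin M) => G (powerDiff k q))
          (fun _ => hG _) (n := 2 * s) (by omega)
        refine this.trans (le_of_eq ?_)
        simp [card_univ, two_mul, pow_add]
    _ ≤ ((M : ℝ) ^ (2 * s - 1)) ^ (2 * s) * (((M : ℝ) ^ (2 * s)) ^ (2 * s - 1) *
          (J * (J * ∏ j : Fin k, linearMean (θ j) (s * M ^ (j + 1 : ℕ))))) := by
        gcongr
        refine (sum_powerDiff_le s M (fun v => G v ^ (2 * s)) fun v => by positivity).trans ?_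
        gcongr
    _ = _ := by
        rw [← pow_mul, ← pow_mul, ← mul_assoc, ← pow_add]
        have : (2 * s - 1) * (2 * s) + 2 * s * (2 * s - 1) = 8 * s ^ 2 - 4 * s := by
          obtain ⟨m, hm⟩ : ∃ m, 2 * s = m + 1 := ⟨2 * s - 1, by omega⟩
          have h4 : 8 * s ^ 2 = 2 * (2 * s) ^ 2 := by ring
          have h5 : 4 * s = 2 * (2 * s) := by ring
          rw [h4, h5, hm, Nat.add_sub_cancel]
          have : 2 * (m + 1) ^ 2 = (m * (m + 1) + (m + 1) * m) + 2 * (m + 1) := by ring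
          omega
        rw [this]
        ring

end DoubleHolder

/-! ### Linear exponential sums -/

theorem sum_Icc_neg_eq_sum_range (U : ℕ) (f : ℤ → ℂ) :
    ∑ v ∈ Icc (-(U : ℤ)) U, f v = ∑ i ∈ range (2 * U + 1), f (i - U) := by
  symm
  refine sum_nbij (fun i : ℕ => (i : ℤ) - U) ?_ ?_ ?_ fun _ _ => rfl
  · intro i hi
    have := mem_range.1 hi
    rw [mem_Icc]
    omega
  · intro i _ j _ h
    simp only at h
    omega
  · intro v hv
    have := mem_Icc.1 (mem_coe.1 hv)
    exact ⟨(v + U).toNat, mem_coe.2 (mem_range.2 (by omega)), by simp only; omega⟩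

theorem norm_linear_sum_le (α : ℝ) (U : ℕ) :
    ‖∑ v ∈ Icc (-(U : ℤ)) U, Complex.exp (((α * v : ℝ) : ℂ) * Complex.I)‖ ≤ 2 * U + 1 := by
  refine (norm_sum_le _ _).trans ?_
  simp only [Complex.norm_exp_ofReal_mul_I, sum_const, Int.card_Icc, nsmul_eq_mul, mul_one]
  have : ((U : ℤ) + 1 - -U).toNat = 2 * U + 1 := by omega
  rw [this]
  push_cast
  rfl

theorem norm_linear_sum_le_div {α β : ℝ} {m : ℤ} (hm : α = β + m * (2 * Real.pi))
    (hβ : |β| ≤ Real.pi) (hβ0 : β ≠ 0) (U : ℕ) :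
    ‖∑ v ∈ Icc (-(U : ℤ)) U, Complex.exp (((α * v : ℝ) : ℂ) * Complex.I)‖ ≤ Real.pi / |β| := by
  set z : ℂ := Complex.exp (β * Complex.I) with hz
  have hzα : Complex.exp (α * Complex.I) = z := by
    rw [hz, hm]
    push_cast
    rw [add_mul, show (m * (2 * Real.pi) : ℂ) * Complex.I = m * (2 * Real.pi * Complex.I) by ring,
      Complex.exp_add, Complex.exp_int_mul_two_pi_mul_I, mul_one]
  have hnz : ‖z‖ = 1 := Complex.norm_exp_ofReal_mul_I _
  have hsin : 2 / Real.pi * |β| ≤ ‖1 - z‖ := by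
    have h1 : ‖z - 1‖ = ‖2 * Real.sin (β / 2)‖ := by
      rw [hz, mul_comm]
      exact Complex.norm_exp_I_mul_ofReal_sub_one β
    rw [norm_sub_rev, h1, norm_mul, Real.norm_eq_abs, Real.norm_eq_abs, abs_two]
    have h2 := Real.mul_abs_le_abs_sin (x := β / 2) (by
      rw [abs_div, abs_two]; linarith)
    rw [abs_div, abs_two] at h2
    have : 2 / Real.pi * |β| = 2 * (2 / Real.pi * (|β| / 2)) := by ring
    rw [this]
    linarith
  have hpos : 0 < 2 / Real.pi * |β| := by
    have := Real.pi_pos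
    have := abs_pos.2 hβ0
    positivity
  have hsum : ‖∑ v ∈ Icc (-(U : ℤ)) U, Complex.exp (((α * v : ℝ) : ℂ) * Complex.I)‖ =
      ‖∑ i ∈ range (2 * U + 1), z ^ i‖ := by
    rw [sum_Icc_neg_eq_sum_range]
    have : ∀ i ∈ range (2 * U + 1), Complex.exp (((α * ((i - U : ℤ) : ℝ) : ℝ) : ℂ) * Complex.I) =
        Complex.exp (((-(α * U) : ℝ) : ℂ) * Complex.I) * z ^ i := by
      intro i _
      rw [← hzα, ← Complex.exp_nat_mul, ← Complex.exp_add]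
      congr 1
      push_cast
      ring
    rw [sum_congr rfl this, ← mul_sum, norm_mul, Complex.norm_exp_ofReal_mul_I, one_mul]
  rw [hsum]
  have hgeom : ‖1 - z‖ * ‖∑ i ∈ range (2 * U + 1), z ^ i‖ ≤ 2 := by
    rw [← norm_mul, mul_neg_geom_sum]
    refine (norm_sub_le _ _).trans ?_
    rw [norm_pow, hnz]
    norm_num
  have hb : 0 < |β| := abs_pos.2 hβ0
  rw [le_div_iff₀ hb]
  have h3 : 2 / Real.pi * |β| * ‖∑ i ∈ range (2 * U + 1), z ^ i‖ ≤ 2 :=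
    (mul_le_mul_of_nonneg_right hsin (norm_nonneg _)).trans hgeom
  have hpi := Real.pi_pos
  have h4 : |β| * ‖∑ i ∈ range (2 * U + 1), z ^ i‖ * 2 ≤ 2 * Real.pi := by
    calc _ = (2 / Real.pi * |β| * ‖∑ i ∈ range (2 * U + 1), z ^ i‖) * Real.pi := by
          field_simp
      _ ≤ _ := by gcongr
  linarith

theorem card_int_near_le {θ c r : ℝ} (hθ : 0 < θ) (hr : 0 ≤ r) (S : Finset ℤ)
    (hS : ∀ u ∈ S, |θ * u - c| ≤ r) : (S.card : ℝ) ≤ 2 * r / θ + 1 := by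
  have hsub : S ⊆ Icc ⌈(c - r) / θ⌉ ⌊(c + r) / θ⌋ := by
    intro u hu
    have := abs_le.1 (hS u hu)
    rw [mem_Icc, Int.ceil_le, Int.le_floor, div_le_iff₀ hθ, le_div_iff₀ hθ]
    constructor <;> linarith
  have h1 : (S.card : ℝ) ≤ ((⌊(c + r) / θ⌋ + 1 - ⌈(c - r) / θ⌉).toNat : ℝ) := by
    have := card_le_card hsub
    rw [Int.card_Icc] at this
    exact_mod_cast this
  have h0 : 0 ≤ 2 * r / θ + 1 := by positivity
  rcases le_total 0 (⌊(c + r) / θ⌋ + 1 - ⌈(c - r) / θ⌉) with h | h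
  · refine h1.trans ?_
    have h2 : ((⌊(c + r) / θ⌋ + 1 - ⌈(c - r) / θ⌉).toNat : ℝ) =
        (⌊(c + r) / θ⌋ + 1 - ⌈(c - r) / θ⌉ : ℝ) := by
      have : (((⌊(c + r) / θ⌋ + 1 - ⌈(c - r) / θ⌉).toNat : ℤ) : ℝ) =
        ((⌊(c + r) / θ⌋ + 1 - ⌈(c - r) / θ⌉ : ℤ) : ℝ) := by rw [Int.toNat_of_nonneg h]
      push_cast at this
      exact_mod_cast this
    rw [h2]
    have h3 := Int.floor_le ((c + r) / θ)
    have h4 := Int.le_ceil ((c - r) / θ)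
    have : 2 * r / θ = (c + r) / θ - (c - r) / θ := by ring
    rw [this]
    linarith
  · rw [Int.toNat_of_nonpos h] at h1
    simp only [Nat.cast_zero] at h1
    linarith

theorem linearMean_le_of_cut {θ Δ : ℝ} {U : ℕ} (hθ : 0 < θ) (hΔ : 0 < Δ) :
    linearMean θ U ≤ (2 * U + 1) * ((θ * U / Real.pi + 2) * (Real.pi * Δ / θ + 1) + 2 / Δ) := by
  classical
  have hpi := Real.pi_pos
  let m : ℤ → ℤ := fun u => round (θ * u / (2 * Real.pi))
  let β : ℤ → ℝ := fun u => θ * u - m u * (2 * Real.pi)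
  have hβ : ∀ u, |β u| ≤ Real.pi := by
    intro u
    have h := abs_sub_round (θ * u / (2 * Real.pi))
    have : β u = (θ * u / (2 * Real.pi) - m u) * (2 * Real.pi) := by
      simp only [β]
      field_simp
    rw [this, abs_mul, abs_of_pos (by positivity : 0 < 2 * Real.pi)]
    calc _ ≤ 1 / 2 * (2 * Real.pi) := by gcongr
      _ = _ := by ring
  let I := Icc (-(U : ℤ)) U
  let B := I.filter fun u => |β u| ≤ Real.pi * Δ / 2
  have hIcard : (I.card : ℝ) = 2 * U + 1 := by
    have : I.card = 2 * U + 1 := by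
      simp only [I, Int.card_Icc]
      omega
    rw [this]
    push_cast
    rfl
  have hfib : ∀ n ∈ B.image m, ((B.filter fun u => m u = n).card : ℝ) ≤ Real.pi * Δ / θ + 1 := by
    intro n _
    have := card_int_near_le (c := n * (2 * Real.pi)) hθ (by positivity : 0 ≤ Real.pi * Δ / 2)
      (B.filter fun u => m u = n) (by
        intro u hu
        obtain ⟨hu1, rfl⟩ := mem_filter.1 hu
        exact (mem_filter.1 hu1).2)
    refine this.trans (le_of_eq ?_)
    ring
  have himg : ((B.image m).card : ℝ) ≤ θ * U / Real.pi + 2 := by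
    have := card_int_near_le (θ := 1) (c := 0) one_pos
      (by positivity : 0 ≤ θ * U / (2 * Real.pi) + 1 / 2) (B.image m) (by
        intro n hn
        obtain ⟨u, hu, rfl⟩ := mem_image.1 hn
        have hu1 := mem_Icc.1 (mem_filter.1 hu).1
        have habs : |(u : ℝ)| ≤ U := by
          rw [abs_le]
          exact ⟨by exact_mod_cast hu1.1, by exact_mod_cast hu1.2⟩
        have h := abs_sub_round (θ * u / (2 * Real.pi))
        have h2 : |θ * u / (2 * Real.pi)| ≤ θ * U / (2 * Real.pi) := by
          rw [abs_div, abs_mul, abs_of_pos hθ, abs_of_pos (by positivity : 0 < 2 * Real.pi)]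
          gcongr
        rw [one_mul, sub_zero]
        have h3 := abs_sub_abs_le_abs_sub ((m u : ℝ)) (θ * u / (2 * Real.pi))
        rw [abs_sub_comm] at h3
        linarith)
    refine this.trans (le_of_eq ?_)
    field_simp
    ring
  have hB : (B.card : ℝ) ≤ (θ * U / Real.pi + 2) * (Real.pi * Δ / θ + 1) := by
    rw [card_eq_sum_card_image m B]
    push_cast
    refine (sum_le_card_nsmul _ _ _ hfib).trans ?_
    rw [nsmul_eq_mul]
    gcongr
  have hterm : ∀ u ∈ I, ‖∑ v ∈ I, Complex.exp (((θ * u * v : ℝ) : ℂ) * Complex.I)‖ ≤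
      (if |β u| ≤ Real.pi * Δ / 2 then (2 * U + 1 : ℝ) else 0) + 2 / Δ := by
    intro u _
    split_ifs with h
    · have := norm_linear_sum_le (θ * u) U
      have h2 : 0 < 2 / Δ := by positivity
      linarith
    · rw [not_le] at h
      have hb : 0 < |β u| := lt_trans (by positivity) h
      have := norm_linear_sum_le_div (α := θ * u) (β := β u) (m := m u)
        (by simp only [β]; ring) (hβ u) (abs_pos.1 hb) U
      rw [zero_add]
      refine this.trans ?_
      rw [div_le_div_iff₀ hb hΔ]
      nlinarith
  calc linearMean θ U ≤ ∑ u ∈ I,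
        ((if |β u| ≤ Real.pi * Δ / 2 then (2 * U + 1 : ℝ) else 0) + 2 / Δ) := sum_le_sum hterm
    _ = (2 * U + 1) * B.card + (2 * U + 1) * (2 / Δ) := by
        rw [sum_add_distrib, ← sum_filter, sum_const, sum_const, nsmul_eq_mul, nsmul_eq_mul, hIcard]
        ring
    _ ≤ _ := by
        rw [mul_add]
        gcongr

theorem linearMean_le {θ : ℝ} {U : ℕ} (hθ : 0 < θ) (hU : 0 < U) :
    linearMean θ U ≤ (2 * U + 1) ^ 2 * (3 / √U + θ + 4 / (θ * U * √U)) := by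
  have hUr : (0 : ℝ) < U := by exact_mod_cast hU
  have hU1 : (1 : ℝ) ≤ U := by exact_mod_cast hU
  set r := √(U : ℝ) with hr
  have hr0 : 0 < r := Real.sqrt_pos.2 hUr
  have hrU : r * r = U := Real.mul_self_sqrt hUr.le
  have hr1 : 1 ≤ r := Real.one_le_sqrt.2 hU1
  have hpi := Real.pi_pos
  refine (linearMean_le_of_cut hθ (inv_pos.2 hr0)).trans ?_
  rw [sq, mul_assoc]
  refine mul_le_mul_of_nonneg_left ?_ (by positivity)
  have hpi4 : Real.pi ≤ 4 := Real.pi_le_four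
  have hpi3 : 3 < Real.pi := Real.pi_gt_three
  have e1 : (θ * U / Real.pi + 2) * (Real.pi * r⁻¹ / θ + 1) + 2 / r⁻¹ =
      3 * r + θ * (U / Real.pi) + 2 * Real.pi / (θ * r) + 2 := by
    rw [← hrU]
    field_simp
    ring
  have e2 : (2 * U + 1) * (3 / r + θ + 4 / (θ * U * r)) =
      6 * r + 3 / r + θ * (2 * U + 1) + 8 / (θ * r) + 4 / (θ * U * r) := by
    have : (2 * (U : ℝ) + 1) * (3 / r + θ + 4 / (θ * U * r)) =
      6 * (U / r) + 3 / r + θ * (2 * U + 1) + 8 / (θ * r) + 4 / (θ * U * r) := by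
      field_simp
      ring
    rw [this, ← hrU]
    congr 4
    field_simp
  rw [e1, e2]
  have h1 : (U : ℝ) / Real.pi ≤ 2 * U + 1 := by
    rw [div_le_iff₀ hpi]; nlinarith
  have h2 : 2 * Real.pi / (θ * r) ≤ 8 / (θ * r) := by gcongr; linarith
  have h3 : 0 ≤ 4 / (θ * U * r) := by positivity
  have h4 : 0 ≤ 3 / r := by positivity
  have h5 : θ * (U / Real.pi) ≤ θ * (2 * U + 1) := by gcongr
  linarith

theorem linearMean_le_sq (θ : ℝ) (U : ℕ) : linearMean θ U ≤ (2 * U + 1) ^ 2 := by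
  refine (sum_le_card_nsmul _ _ _ fun (u : ℤ) _ => norm_linear_sum_le (θ * u) U).trans
    (le_of_eq ?_)
  have : ((U : ℤ) + 1 - -U).toNat = 2 * U + 1 := by omega
  rw [Int.card_Icc, this, nsmul_eq_mul]
  push_cast
  ring

theorem linearMean_nonneg (θ : ℝ) (U : ℕ) : 0 ≤ linearMean θ U :=
  sum_nonneg fun _ _ => norm_nonneg _

theorem linearMean_abs (θ : ℝ) (U : ℕ) : linearMean |θ| U = linearMean θ U := by
  rcases abs_choice θ with h | h
  · rw [h]
  · rw [h]
    unfold linearMean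
    refine sum_congr rfl fun u _ => ?_
    rw [← Complex.norm_conj, map_sum]
    congr 1
    refine sum_congr rfl fun v _ => ?_
    rw [← Complex.exp_conj]
    congr 1
    simp

theorem linear_gain_le {L lam θ n : ℝ} {M s i : ℕ} (hL : 500 ≤ L) (hlam : 1 / 2 ≤ lam)
    (hn0 : Real.exp L ≤ n) (hn : n ≤ 2 * Real.exp L) (hM : Real.exp (0.4 * L) ≤ 2 * M)
    (hi1 : 1.1 * lam ≤ i) (hi2 : i ≤ 2.2 * lam) (his : i ≤ s)
    (hθ : θ = Real.exp (lam * L) / (i * n ^ i)) :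
    3 / √((s * M ^ i : ℕ) : ℝ) + θ +
      4 / (θ * (s * M ^ i : ℕ) * √((s * M ^ i : ℕ) : ℝ)) ≤ Real.exp (-(0.05 * (lam * L))) := by
  have hi0 : (0 : ℝ) < i := by linarith
  have hi0' : 1 ≤ i := by exact_mod_cast hi0
  have hi1' : (1 : ℝ) ≤ i := by exact_mod_cast hi0'
  have hsr : (i : ℝ) ≤ s := by exact_mod_cast his
  have hs0 : (0 : ℝ) < s := by linarith
  have hlog2 : (2 : ℝ) ≤ Real.exp 0.7 := by
    have h := Real.log_two_lt_d9
    rw [← Real.log_le_iff_le_exp (by norm_num)]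
    linarith
  have hexpL := Real.exp_pos L
  have hnpos : 0 < n := by linarith
  have hMlow : Real.exp (0.4 * L - 0.7) ≤ M := by
    rw [Real.exp_sub, div_le_iff₀ (Real.exp_pos _)]
    nlinarith [(Nat.cast_nonneg M : (0 : ℝ) ≤ M)]
  have hMi : Real.exp (i * (0.4 * L - 0.7)) ≤ (M : ℝ) ^ i := by
    rw [Real.exp_nat_mul]
    gcongr
  have hU : s * Real.exp (i * (0.4 * L - 0.7)) ≤ ((s * M ^ i : ℕ) : ℝ) := by
    push_cast
    gcongr
  have hU1 : Real.exp (i * (0.4 * L - 0.7)) ≤ ((s * M ^ i : ℕ) : ℝ) := by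
    refine le_trans (le_mul_of_one_le_left (Real.exp_pos _).le ?_) hU
    linarith
  set U : ℝ := ((s * M ^ i : ℕ) : ℝ) with hUdef
  have hsqrt : Real.exp (i * (0.2 * L - 0.35)) ≤ √U := by
    apply Real.le_sqrt_of_sq_le
    refine le_trans (le_of_eq ?_) hU1
    rw [← Real.exp_nat_mul]
    congr 1
    push_cast
    ring
  have hsq0 : 0 < √U := lt_of_lt_of_le (Real.exp_pos _) hsqrt
  have hni : n ^ i ≤ Real.exp (i * (L + 0.7)) := by
    rw [Real.exp_nat_mul]
    gcongr
    rw [Real.exp_add]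
    nlinarith
  have hni0 : Real.exp (i * L) ≤ n ^ i := by
    rw [Real.exp_nat_mul]
    gcongr
  have hlamL : 0 < lam * L := by nlinarith
  have hLi : 1.1 * lam * L ≤ i * L := by gcongr
  have hLi2 : i * L ≤ 2.2 * lam * L := by gcongr
  have h1 : 3 / √U ≤ 3 * Real.exp (-(0.1 * (lam * L)) + 4 * lam) := by
    rw [div_eq_mul_inv]
    gcongr
    rw [show -(0.1 * (lam * L)) + 4 * lam = -(0.1 * (lam * L) - 4 * lam) by ring, Real.exp_neg]
    gcongr
    refine le_trans (Real.exp_le_exp.2 ?_) hsqrt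
    nlinarith
  have h2 : θ ≤ Real.exp (-(0.1 * (lam * L)) + 4 * lam) := by
    rw [hθ, div_le_iff₀ (by positivity)]
    calc Real.exp (lam * L) ≤
          Real.exp (-(0.1 * (lam * L)) + 4 * lam) * (1 * Real.exp (i * L)) := by
          rw [one_mul, ← Real.exp_add]
          apply Real.exp_le_exp.2
          nlinarith
      _ ≤ _ := by gcongr
  have hθ0 : 0 < θ := by rw [hθ]; positivity
  have h3 : 4 / (θ * U * √U) ≤ 4 * Real.exp (-(0.1 * (lam * L)) + 4 * lam) := by
    rw [div_eq_mul_inv]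
    gcongr
    rw [show -(0.1 * (lam * L)) + 4 * lam = -(0.1 * (lam * L) - 4 * lam) by ring, Real.exp_neg]
    gcongr
    have hθ1 : Real.exp (lam * L - i * (L + 0.7)) / i ≤ θ := by
      rw [hθ, Real.exp_sub, div_div, mul_comm _ (i : ℝ)]
      gcongr
    calc Real.exp (0.1 * (lam * L) - 4 * lam) ≤
          Real.exp (lam * L - i * (L + 0.7) + i * (0.4 * L - 0.7) + i * (0.2 * L - 0.35)) := by
          apply Real.exp_le_exp.2
          nlinarith
      _ = Real.exp (lam * L - i * (L + 0.7)) / i * (i * Real.exp (i * (0.4 * L - 0.7))) *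
          Real.exp (i * (0.2 * L - 0.35)) := by
          rw [Real.exp_add, Real.exp_add]
          field_simp
      _ ≤ Real.exp (lam * L - i * (L + 0.7)) / i * (s * Real.exp (i * (0.4 * L - 0.7))) *
          Real.exp (i * (0.2 * L - 0.35)) := by gcongr
      _ ≤ _ := by gcongr
  have h8 : (8 : ℝ) ≤ Real.exp (5 * lam) := by
    calc (8 : ℝ) ≤ Real.exp 0.7 ^ 3 := by
          calc (8 : ℝ) = 2 ^ 3 := by norm_num
            _ ≤ _ := by gcongr
      _ = Real.exp (2.1) := by rw [← Real.exp_nat_mul]; norm_num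
      _ ≤ _ := Real.exp_le_exp.2 (by linarith)
  calc _ ≤ 8 * Real.exp (-(0.1 * (lam * L)) + 4 * lam) := by linarith
    _ ≤ Real.exp (5 * lam) * Real.exp (-(0.1 * (lam * L)) + 4 * lam) := by gcongr
    _ ≤ _ := by
      rw [← Real.exp_add]
      apply Real.exp_le_exp.2
      nlinarith

theorem half_le_card_Icc_ceil_floor {a : ℝ} (ha : 1 / 2 ≤ a) :
    a / 2 ≤ ((Icc ⌈a⌉₊ ⌊2 * a⌋₊).card : ℝ) := by
  have h1 : (⌈a⌉₊ : ℝ) < a + 1 := Nat.ceil_lt_add_one (by linarith)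
  have h2 : 2 * a < ⌊2 * a⌋₊ + 1 := Nat.lt_floor_add_one _
  rw [Nat.card_Icc]
  rcases le_or_gt a 1 with h | h
  · have h3 : ⌈a⌉₊ ≤ 1 := Nat.ceil_le.2 (by simpa using h)
    have h4 : 1 ≤ ⌊2 * a⌋₊ := Nat.le_floor (by push_cast; linarith)
    have : (1 : ℝ) ≤ ((⌊2 * a⌋₊ + 1 - ⌈a⌉₊ : ℕ) : ℝ) := by
      exact_mod_cast (by omega : 1 ≤ ⌊2 * a⌋₊ + 1 - ⌈a⌉₊)
    linarith
  · have h5 : ⌈a⌉₊ < ⌊2 * a⌋₊ + 1 := by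
      have : (⌈a⌉₊ : ℝ) < ⌊2 * a⌋₊ + 1 := by linarith
      exact_mod_cast this
    have h6 : (1 : ℝ) ≤ ((⌊2 * a⌋₊ + 1 - ⌈a⌉₊ : ℕ) : ℝ) := by
      exact_mod_cast (by omega : 1 ≤ ⌊2 * a⌋₊ + 1 - ⌈a⌉₊)
    have h7 : ((⌊2 * a⌋₊ + 1 - ⌈a⌉₊ : ℕ) : ℝ) = ⌊2 * a⌋₊ + 1 - ⌈a⌉₊ := by
      rw [Nat.cast_sub h5.le]
      push_cast
      ring
    rcases le_total a 2 with h8 | h8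
    · linarith
    · rw [h7]
      linarith

theorem prod_linearMean_le {L lam n : ℝ} {M k s : ℕ} (hL : 500 ≤ L) (hlam : 1 / 2 ≤ lam)
    (hn0 : Real.exp L ≤ n) (hn : n ≤ 2 * Real.exp L) (hM : Real.exp (0.4 * L) ≤ 2 * M)
    (hk : 5 * lam ≤ k) (hks : k ≤ s) (θ : Fin k → ℝ)
    (hθ : ∀ j : Fin k, |θ j| = Real.exp (lam * L) / ((j + 1 : ℕ) * n ^ (j + 1 : ℕ))) :
    ∏ j : Fin k, linearMean (θ j) (s * M ^ (j + 1 : ℕ)) ≤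
      (3 * s : ℝ) ^ (2 * k) * (M : ℝ) ^ (k * (k + 1)) * Real.exp (-(0.0275 * (lam ^ 2 * L))) := by
  classical
  let I := Icc ⌈1.1 * lam⌉₊ ⌊2 * (1.1 * lam)⌋₊
  let w : ℕ → ℝ := fun i => if i ∈ I then Real.exp (-(0.05 * (lam * L))) else 1
  have hM1 : 1 ≤ M := by
    have h1 := Real.exp_pos (0.4 * L)
    have : (0 : ℝ) < M := by linarith
    exact_mod_cast this
  have hk0 : (0 : ℝ) < k := by linarith
  have hk1 : 1 ≤ k := by exact_mod_cast hk0
  have hnpos : 0 < n := lt_of_lt_of_le (Real.exp_pos _) hn0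
  have hterm : ∀ j : Fin k, linearMean (θ j) (s * M ^ (j + 1 : ℕ)) ≤
      (3 * s * M ^ (j + 1 : ℕ) : ℝ) ^ 2 * w (j + 1) := by
    intro j
    have hUpos : 0 < s * M ^ (j + 1 : ℕ) := by
      have : 0 < s := by omega
      positivity
    have hU : (2 * ((s * M ^ (j + 1 : ℕ) : ℕ) : ℝ) + 1) ^ 2 ≤
        (3 * s * M ^ (j + 1 : ℕ) : ℝ) ^ 2 := by
      have : (1 : ℝ) ≤ ((s * M ^ (j + 1 : ℕ) : ℕ) : ℝ) := by exact_mod_cast hUpos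
      push_cast at this ⊢
      gcongr
      linarith
    by_cases hj : (j + 1 : ℕ) ∈ I
    · simp only [w, hj, if_true]
      have hj1 := (mem_Icc.1 hj).1
      have hj2 := (mem_Icc.1 hj).2
      have hpos : 0 < |θ j| := by rw [hθ]; positivity
      have hg := linear_gain_le (s := s) hL hlam hn0 hn hM (Nat.ceil_le.1 hj1)
        (by
          have := (Nat.le_floor_iff (by linarith)).1 hj2
          linarith) (by omega) (hθ j)
      rw [← linearMean_abs]
      refine (linearMean_le hpos hUpos).trans ?_
      gcongr
    · simp only [w, hj, if_false, mul_one]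
      exact (linearMean_le_sq _ _).trans hU
  have hprod1 : ∏ j : Fin k, (3 * s * M ^ (j + 1 : ℕ) : ℝ) ^ 2 =
      (3 * s : ℝ) ^ (2 * k) * (M : ℝ) ^ (k * (k + 1)) := by
    rw [prod_pow, prod_mul_distrib, prod_const, card_univ, Fintype.card_fin, mul_pow, ← pow_mul,
      mul_comm k 2, prod_pow_eq_pow_sum, ← pow_mul]
    congr 2
    rw [Fin.sum_univ_eq_sum_range (fun i => i + 1), sum_mul]
    clear * -
    induction k with
    | zero => simp
    | succ k ih => rw [sum_range_succ, ih]; ring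
  have hI : ∀ i ∈ I, 1 ≤ i ∧ i ≤ k := by
    intro i hi
    have h1 := Nat.ceil_le.1 (mem_Icc.1 hi).1
    have h2 := (Nat.le_floor_iff (by linarith)).1 (mem_Icc.1 hi).2
    have h3 : (0 : ℝ) < i := by linarith
    have h4 : (i : ℝ) ≤ k := by linarith
    exact ⟨by exact_mod_cast h3, by exact_mod_cast h4⟩
  have hprod2 : ∏ j : Fin k, w (j + 1) ≤ Real.exp (-(0.0275 * (lam ^ 2 * L))) := by
    have h1 : ∏ j : Fin k, w (j + 1) = ∏ i ∈ I, Real.exp (-(0.05 * (lam * L))) := by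
      rw [Fin.prod_univ_eq_prod_range (fun i => w (i + 1)) k]
      simp only [w]
      rw [← prod_filter]
      refine prod_nbij (· + 1) (fun i hi => (mem_filter.1 hi).2) (fun _ _ _ _ h => by simpa using h)
        (fun i hi => ?_) fun _ _ => rfl
      obtain ⟨h2, h3⟩ := hI i hi
      refine ⟨i - 1, ?_, Nat.sub_add_cancel h2⟩
      simp only [coe_filter, mem_range, Set.mem_ofPred_eq, Nat.sub_add_cancel h2]
      exact ⟨by omega, hi⟩
    rw [h1, prod_const, ← Real.exp_nat_mul]
    apply Real.exp_le_exp.2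
    have hc := half_le_card_Icc_ceil_floor (a := 1.1 * lam) (by linarith)
    have hlamL : 0 < lam * L := by nlinarith
    have : 1.1 * lam / 2 * (0.05 * (lam * L)) ≤ (I.card : ℝ) * (0.05 * (lam * L)) := by
      gcongr
    nlinarith
  calc _ ≤ ∏ j : Fin k, (3 * s * M ^ (j + 1 : ℕ) : ℝ) ^ 2 * w (j + 1) :=
        prod_le_prod (fun _ _ => linearMean_nonneg _ _) fun j _ => hterm j
    _ = (3 * s : ℝ) ^ (2 * k) * (M : ℝ) ^ (k * (k + 1)) * ∏ j : Fin k, w (j + 1) := by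
        rw [prod_mul_distrib, hprod1]
    _ ≤ _ := by gcongr

/-! ### Estimates for bilinear and exponential sums -/

theorem exp_neg_eight_le : Real.exp (-8) ≤ 0.000336 := by
  have h := Real.exp_one_gt_d9
  have h1 : (2.718 : ℝ) ^ 8 ≤ Real.exp 1 ^ 8 := by gcongr; linarith
  rw [← Real.exp_nat_mul] at h1
  norm_num at h1
  rw [Real.exp_neg]
  have : ((0.000336 : ℝ)⁻¹)⁻¹ = 0.000336 := inv_inv _
  rw [← this]
  gcongr
  refine le_trans ?_ h1
  norm_num

theorem norm_bilinear_sum_le {L lam n : ℝ} {M k : ℕ} (hL : 500 ≤ L) (hlam : 1 / 2 ≤ lam)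
    (hn0 : Real.exp L ≤ n) (hn : n ≤ 2 * Real.exp L) (hM : Real.exp (0.4 * L) ≤ 2 * M)
    (hM' : M ≤ Real.exp (0.4 * L)) (hk : 5 * lam ≤ k) (hk' : k ≤ 5 * lam + 1) (θ : Fin k → ℝ)
    (hθ : ∀ j : Fin k, |θ j| = Real.exp (lam * L) / ((j + 1 : ℕ) * n ^ (j + 1 : ℕ))) :
    ‖∑ x : Fin M, ∑ y : Fin M, phase θ (powerVec k x) (powerVec k y)‖ ≤
      M ^ 2 * Real.exp (7 - 0.00000001 * (L / lam ^ 2)) := by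
  have hk2 : 2 ≤ k := by
    have : (2 : ℝ) < k := by linarith
    exact_mod_cast this.le
  have hMpos : (0 : ℝ) < M := by
    have h1 := Real.exp_pos (0.4 * L)
    linarith
  have hM1 : 1 ≤ M := by exact_mod_cast hMpos
  have hk1 : 1 ≤ k := by omega
  have hk1r : (1 : ℝ) ≤ k := by exact_mod_cast hk1
  set s := 9 * k ^ 2 with hs
  have hs0 : 0 < s := by positivity
  have hks : k ≤ s := by nlinarith
  have h1 := norm_bilinear_sum_pow_le θ hs0 M
  have h2 := prod_linearMean_le hL hlam hn0 hn hM hk hks θ hθ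
  have h3 := meanValue_le hk2 hM1
  set T := ‖∑ x : Fin M, ∑ y : Fin M, phase θ (powerVec k x) (powerVec k y)‖
  set m := Real.log M with hm
  have hMm : (M : ℝ) = Real.exp m := (Real.exp_log hMpos).symm
  have hm0 : 0 ≤ m := Real.log_nonneg (by exact_mod_cast hM1)
  have hmL : m ≤ 0.4 * L := by
    rw [hm, Real.log_le_iff_le_exp hMpos]
    exact hM'
  have hMpow : ∀ q : ℕ, (M : ℝ) ^ q = Real.exp (q * m) := fun q => by
    rw [hMm, ← Real.exp_nat_mul]
  have h3' : (meanValue (Fin s) k M : ℝ) ≤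
      Real.exp (1081 * k ^ 4 + m * (18 * k ^ 2 - k * (k + 1) / 2 * (1 - Real.exp (-8)))) := by
    refine h3.trans (le_of_eq ?_)
    rw [Real.exp_add, Real.rpow_def_of_pos hMpos]
  have hs3 : (3 * s : ℝ) ^ (2 * k) ≤ Real.exp (54 * k ^ 4) := by
    have : (3 * s : ℝ) ≤ Real.exp (27 * k ^ 2) := by
      refine le_trans ?_ (Real.add_one_le_exp _)
      rw [hs]
      push_cast
      linarith
    calc (3 * s : ℝ) ^ (2 * k) ≤ Real.exp (27 * k ^ 2) ^ (2 * k) := by gcongr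
      _ = Real.exp (54 * k ^ 3) := by
        rw [← Real.exp_nat_mul]
        congr 1
        push_cast
        ring
      _ ≤ _ := by
        gcongr
        norm_num
  have hcast : ((8 * s ^ 2 - 4 * s : ℕ) : ℝ) = 8 * s ^ 2 - 4 * s := by
    rw [Nat.cast_sub (by nlinarith)]
    push_cast
    ring
  have h4 : T ^ (4 * s ^ 2) ≤
      (M ^ 2 * Real.exp (7 - 0.00000001 * (L / lam ^ 2))) ^ (4 * s ^ 2) := by
    calc T ^ (4 * s ^ 2) ≤ _ := h1
      _ ≤ (M : ℝ) ^ (8 * s ^ 2 - 4 * s) *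
          Real.exp (1081 * k ^ 4 + m * (18 * k ^ 2 - k * (k + 1) / 2 * (1 - Real.exp (-8)))) ^ 2 *
          (Real.exp (54 * k ^ 4) * (M : ℝ) ^ (k * (k + 1)) *
            Real.exp (-(0.0275 * (lam ^ 2 * L)))) := by
          gcongr
          · exact prod_nonneg fun _ _ => linearMean_nonneg _ _
          · exact h2.trans (by gcongr)
      _ = Real.exp (8 * s ^ 2 * m + (2216 * k ^ 4 + k * (k + 1) * Real.exp (-8) * m -
            0.0275 * (lam ^ 2 * L))) := by
          rw [hMpow, hMpow, ← Real.exp_nat_mul, ← Real.exp_add, ← Real.exp_add, ← Real.exp_add,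
            ← Real.exp_add, hcast]
          congr 1
          rw [hs]
          push_cast
          ring
      _ ≤ Real.exp ((4 * s ^ 2 : ℕ) * (2 * m + (7 - 0.00000001 * (L / lam ^ 2)))) := by
          apply Real.exp_le_exp.2
          have hk7 : (k : ℝ) ≤ 7 * lam := by linarith
          have hlam2 : 0 < lam ^ 2 := by positivity
          have e1 : k * (k + 1) * Real.exp (-8) * m ≤
              (7 * lam) * (9 * lam) * 0.000336 * (0.4 * L) := by
            gcongr
            · linarith
            · exact exp_neg_eight_le
          have e2 : (k : ℝ) ^ 4 * (L / lam ^ 2) ≤ (7 * lam) ^ 4 * (L / lam ^ 2) := by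
            gcongr
          have e3 : (7 * lam) ^ 4 * (L / lam ^ 2) = 2401 * (lam ^ 2 * L) := by
            field_simp
            ring
          have e4 : 0 < lam ^ 2 * L := by positivity
          have e5 : (0 : ℝ) ≤ (k : ℝ) ^ 4 := by positivity
          have e6 : ((4 * s ^ 2 : ℕ) : ℝ) = 324 * k ^ 4 := by
            rw [hs]; push_cast; ring
          have e7 : (8 * s ^ 2 : ℝ) = 648 * k ^ 4 := by
            rw [hs]; push_cast; ring
          rw [e6, e7]
          nlinarith
      _ = _ := by
          rw [Real.exp_nat_mul, hMpow, ← Real.exp_add]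
          push_cast
          rfl
  exact le_of_pow_le_pow_left₀ (by positivity) (by positivity) h4

theorem norm_sum_Ioc_sub_sum_shift_le {a : ℕ → ℂ} (ha : ∀ n, ‖a n‖ ≤ 1) {N N' : ℕ} (h : N ≤ N')
    (d : ℕ) : ‖∑ n ∈ Ioc N N', a n - ∑ n ∈ Ioc N N', a (n + d)‖ ≤ 2 * d := by
  induction d with
  | zero => simp
  | succ d ih =>
    have key : ∑ n ∈ Ioc N N', a (n + d) - ∑ n ∈ Ioc N N', a (n + (d + 1)) =
        a (N + 1 + d) - a (N' + 1 + d) := by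
      clear ih
      induction N', h using Nat.le_induction with
      | base => simp
      | succ m hm ih =>
        rw [sum_Ioc_succ_top (by omega), sum_Ioc_succ_top (by omega), add_sub_add_comm, ih]
        rw [show m + 1 + (d + 1) = m + 1 + 1 + d by ring]
        ring
    have h1 : ‖a (N + 1 + d) - a (N' + 1 + d)‖ ≤ 2 :=
      (norm_sub_le _ _).trans (by linarith [ha (N + 1 + d), ha (N' + 1 + d)])
    calc _ = ‖(∑ n ∈ Ioc N N', a n - ∑ n ∈ Ioc N N', a (n + d)) +
          (∑ n ∈ Ioc N N', a (n + d) - ∑ n ∈ Ioc N N', a (n + (d + 1)))‖ := by congr 1; ring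
      _ ≤ 2 * d + 2 := by
          rw [key]
          exact (norm_add_le _ _).trans (add_le_add ih h1)
      _ = _ := by push_cast; ring

/-- The unimodular factor `n ^ (-i t)`. -/
noncomputable def twist (t n : ℝ) : ℂ := Complex.exp ((-(t * Real.log n) : ℝ) * Complex.I)

theorem norm_twist (t n : ℝ) : ‖twist t n‖ = 1 := Complex.norm_exp_ofReal_mul_I _

theorem norm_exp_mul_I_sub_le (a b : ℝ) :
    ‖Complex.exp (a * Complex.I) - Complex.exp (b * Complex.I)‖ ≤ |a - b| := by
  have h : Complex.exp (a * Complex.I) - Complex.exp (b * Complex.I) =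
      Complex.exp (b * Complex.I) * (Complex.exp (Complex.I * (a - b : ℝ)) - 1) := by
    rw [mul_sub, ← Complex.exp_add]
    push_cast
    ring_nf
  rw [h, norm_mul, Complex.norm_exp_ofReal_mul_I, one_mul]
  exact Real.norm_exp_I_mul_ofReal_sub_one_le

/-- The coefficients of the Taylor polynomial of `u ↦ -t log (1 + u / n)`. -/
noncomputable def taylorCoeff (k : ℕ) (t n : ℝ) : Fin k → ℝ :=
  fun j => (-1) ^ (j + 1 : ℕ) * t / ((j + 1 : ℕ) * n ^ (j + 1 : ℕ))

theorem norm_twist_add_sub_le {t n : ℝ} (ht : 0 ≤ t) (hn : 0 < n) (k x y : ℕ)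
    (hxy : (x * y : ℝ) / n ≤ 1 / 2) :
    ‖twist t (n + (x * y : ℕ)) -
      twist t n * phase (taylorCoeff k t n) (powerVec k x) (powerVec k y)‖ ≤
      2 * (t * ((x * y : ℝ) / n) ^ (k + 1)) := by
  set z : ℝ := (x * y : ℝ) / n with hz
  have hz0 : 0 ≤ z := by positivity
  have h1 := Real.abs_log_sub_add_sum_range_le (x := -z)
      (by rw [abs_neg, abs_of_nonneg hz0]; linarith) k
  rw [abs_neg, abs_of_nonneg hz0, sub_neg_eq_add] at h1
  have hlog : Real.log (n + (x * y : ℕ)) = Real.log n + Real.log (1 + z) := by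
    rw [← Real.log_mul hn.ne' (by positivity)]
    congr 1
    rw [hz]
    push_cast
    field_simp
  unfold twist phase
  rw [← Complex.exp_add, ← add_mul, ← Complex.ofReal_add]
  refine (norm_exp_mul_I_sub_le _ _).trans ?_
  have hsum : ∑ j : Fin k, taylorCoeff k t n j * ((powerVec k x j : ℤ) : ℝ) *
      ((powerVec k y j : ℤ) : ℝ) =
      t * ∑ i ∈ range k, (-z) ^ (i + 1) / (i + 1) := by
    rw [← Fin.sum_univ_eq_sum_range (fun i => (-z) ^ (i + 1) / ((i : ℝ) + 1)), mul_sum]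
    refine sum_congr rfl fun j _ => ?_
    unfold taylorCoeff powerVec
    rw [hz, neg_pow (_ / n), div_pow, mul_pow (x : ℝ)]
    push_cast
    field_simp
  rw [hlog, hsum]
  rw [show -(t * (Real.log n + Real.log (1 + z))) -
    (-(t * Real.log n) + t * ∑ i ∈ range k, (-z) ^ (i + 1) / (i + 1)) =
    -(t * ((∑ i ∈ range k, (-z) ^ (i + 1) / (i + 1)) + Real.log (1 + z))) by ring, abs_neg, abs_mul,
    abs_of_nonneg ht]
  have h2 : z ^ (k + 1) / (1 - z) ≤ 2 * z ^ (k + 1) := by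
    rw [div_le_iff₀ (by linarith)]
    nlinarith [pow_nonneg hz0 (k + 1)]
  nlinarith [mul_le_mul_of_nonneg_left (h1.trans h2) ht]

theorem norm_sum_twist_le_of_large {L lam : ℝ} {N N' : ℕ} (hL : 500 ≤ L) (hlam : 1 / 2 ≤ lam)
    (hNL : (N : ℝ) = Real.exp L) (h : N ≤ N') (h' : N' ≤ 2 * N) :
    ‖∑ n ∈ Ioc N N', twist (Real.exp (lam * L)) n‖ ≤
      2000 * N * Real.exp (-(0.00000001 * (L / lam ^ 2))) := by
  set t := Real.exp (lam * L) with ht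
  set k := ⌈5 * lam⌉₊ with hk
  set M := ⌊Real.exp (0.4 * L)⌋₊ with hM
  have hk1 : 5 * lam ≤ k := Nat.le_ceil _
  have hk2 : (k : ℝ) ≤ 5 * lam + 1 := (Nat.ceil_lt_add_one (by linarith)).le
  have hM' : (M : ℝ) ≤ Real.exp (0.4 * L) := Nat.floor_le (Real.exp_pos _).le
  have hM1 : 1 ≤ M := Nat.le_floor (by
    rw [Nat.cast_one]
    exact Real.one_le_exp (by linarith))
  have hM1r : (1 : ℝ) ≤ M := by exact_mod_cast hM1
  have hM2 : Real.exp (0.4 * L) ≤ 2 * M := by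
    have := Nat.lt_floor_add_one (Real.exp (0.4 * L))
    rw [← hM] at this
    linarith
  have hMsq : (M : ℝ) ^ 2 ≤ N * Real.exp (-(0.2 * L)) := by
    calc (M : ℝ) ^ 2 ≤ Real.exp (0.4 * L) ^ 2 := by gcongr
      _ = _ := by
        rw [← Real.exp_nat_mul, hNL, ← Real.exp_add]
        congr 1
        push_cast
        ring
  have hNpos : (0 : ℝ) < N := by rw [hNL]; exact Real.exp_pos _
  have hhalf : Real.exp (-(0.2 * L)) ≤ 1 / 2 := by
    rw [Real.exp_neg, one_div]
    gcongr
    linarith [Real.add_one_le_exp (0.2 * L)]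
  set S := ∑ n ∈ Ioc N N', twist t n with hS
  set W := ∑ x : Fin M, ∑ y : Fin M, ∑ n ∈ Ioc N N', twist t ((n + (x : ℕ) * (y : ℕ) : ℕ) : ℝ)
    with hW
  have hshift : ‖(M : ℂ) ^ 2 * S - W‖ ≤ 2 * M ^ 4 := by
    have : (M : ℂ) ^ 2 * S - W = ∑ x : Fin M, ∑ y : Fin M, (S - ∑ n ∈ Ioc N N',
        twist t ((n + (x : ℕ) * (y : ℕ) : ℕ) : ℝ)) := by
      simp only [sum_sub_distrib, sum_const, card_univ, Fintype.card_fin, nsmul_eq_mul]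
      rw [hW]
      ring
    rw [this]
    calc _ ≤ ∑ x : Fin M, ∑ y : Fin M, (2 * M ^ 2 : ℝ) := by
          refine (norm_sum_le _ _).trans (sum_le_sum fun x _ => ?_)
          refine (norm_sum_le _ _).trans (sum_le_sum fun y _ => ?_)
          refine (norm_sum_Ioc_sub_sum_shift_le (a := fun n => twist t (n : ℝ))
            (fun n => (norm_twist _ _).le) h _).trans ?_
          have h1 : (x : ℕ) * (y : ℕ) ≤ M ^ 2 := by
            rw [sq]
            exact Nat.mul_le_mul x.2.le y.2.le
          have h2 : (((x : ℕ) * (y : ℕ) : ℕ) : ℝ) ≤ (M : ℝ) ^ 2 := by exact_mod_cast h1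
          linarith
      _ = _ := by
          simp only [sum_const, card_univ, Fintype.card_fin, nsmul_eq_mul]
          ring
  have hn_term : ∀ n ∈ Ioc N N', ‖∑ x : Fin M, ∑ y : Fin M,
      twist t ((n + (x : ℕ) * (y : ℕ) : ℕ) : ℝ)‖ ≤
      M ^ 2 * Real.exp (7 - 0.00000001 * (L / lam ^ 2)) + M ^ 2 * (2 * Real.exp (-(0.2 * L))) := by
    intro n hn
    have hn1 : (N : ℝ) ≤ n := by exact_mod_cast (mem_Ioc.1 hn).1.le
    have hn2 : (n : ℝ) ≤ 2 * N := by exact_mod_cast (mem_Ioc.1 hn).2.trans h'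
    have hnpos : (0 : ℝ) < n := by linarith
    have hB := norm_bilinear_sum_le (n := n) hL hlam (hNL ▸ hn1) (hNL ▸ hn2) hM2 hM' hk1 hk2
      (taylorCoeff k t n) (fun j => by
        unfold taylorCoeff
        rw [abs_div, abs_mul, abs_pow, abs_neg, abs_one, one_pow, one_mul,
          abs_of_pos (Real.exp_pos _),
          abs_of_pos (by positivity)])
    have hE : ‖∑ x : Fin M, ∑ y : Fin M, (twist t ((n + (x : ℕ) * (y : ℕ) : ℕ) : ℝ) -
        twist t n * phase (taylorCoeff k t n) (powerVec k x) (powerVec k y))‖ ≤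
        M ^ 2 * (2 * Real.exp (-(0.2 * L))) := by
      calc _ ≤ ∑ x : Fin M, ∑ y : Fin M, (2 * Real.exp (-(0.2 * L)) : ℝ) := by
            refine (norm_sum_le _ _).trans (sum_le_sum fun x _ => ?_)
            refine (norm_sum_le _ _).trans (sum_le_sum fun y _ => ?_)
            have hz : ((x : ℕ) * (y : ℕ) : ℝ) / n ≤ Real.exp (-(0.2 * L)) := by
              rw [div_le_iff₀ hnpos]
              have h1 : ((x : ℕ) * (y : ℕ) : ℝ) ≤ M ^ 2 := by
                rw [sq]
                gcongr
                · exact x.2.le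
                · exact y.2.le
              calc _ ≤ _ := h1
                _ ≤ _ := hMsq
                _ ≤ _ := by rw [mul_comm]; gcongr
            have h2 := norm_twist_add_sub_le (Real.exp_pos (lam * L)).le hnpos k x y
              (hz.trans hhalf)
            rw [← ht] at h2
            push_cast at h2 ⊢
            refine h2.trans ?_
            gcongr
            calc t * (((x : ℕ) * (y : ℕ) : ℝ) / n) ^ (k + 1) ≤
                t * Real.exp (-(0.2 * L)) ^ (k + 1) := by gcongr
              _ = Real.exp (lam * L - (k + 1) * (0.2 * L)) := by
                rw [← Real.exp_nat_mul, ht, ← Real.exp_add]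
                congr 1
                push_cast
                ring
              _ ≤ _ := Real.exp_le_exp.2 (by nlinarith)
        _ = _ := by
            simp only [sum_const, card_univ, Fintype.card_fin, nsmul_eq_mul]
            ring
    simp only [sum_sub_distrib, ← mul_sum] at hE
    have h3 := norm_le_norm_add_norm_sub' (∑ x : Fin M, ∑ y : Fin M,
      twist t ((n + (x : ℕ) * (y : ℕ) : ℕ) : ℝ)) (twist t n * ∑ x : Fin M, ∑ y : Fin M,
        phase (taylorCoeff k t n) (powerVec k x) (powerVec k y))
    rw [norm_mul, norm_twist, one_mul] at h3
    linarith
  have hWle : ‖W‖ ≤ N * (M ^ 2 * Real.exp (7 - 0.00000001 * (L / lam ^ 2)) +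
      M ^ 2 * (2 * Real.exp (-(0.2 * L)))) := by
    have : W = ∑ n ∈ Ioc N N', ∑ x : Fin M, ∑ y : Fin M,
        twist t ((n + (x : ℕ) * (y : ℕ) : ℕ) : ℝ) := by
      exact (sum_comm.trans (sum_congr rfl fun x _ => sum_comm)).symm
    rw [this]
    refine (norm_sum_le _ _).trans ((sum_le_sum hn_term).trans ?_)
    rw [sum_const, Nat.card_Ioc, nsmul_eq_mul]
    gcongr
    omega
  have hSle : (M : ℝ) ^ 2 * ‖S‖ ≤
      M ^ 2 * (2000 * N * Real.exp (-(0.00000001 * (L / lam ^ 2)))) := by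
    have h1 := norm_le_norm_add_norm_sub' ((M : ℂ) ^ 2 * S) W
    rw [norm_mul, norm_pow, Complex.norm_natCast] at h1
    have h2 : Real.exp (-(0.2 * L)) ≤ Real.exp (-(0.00000001 * (L / lam ^ 2))) := by
      apply Real.exp_le_exp.2
      have : L / lam ^ 2 ≤ 4 * L := by
        rw [div_le_iff₀ (by positivity)]
        have h0 : (1 / 2) ^ 2 ≤ lam ^ 2 := by gcongr
        nlinarith
      linarith
    have h3 : Real.exp (7 - 0.00000001 * (L / lam ^ 2)) ≤
        1996 * Real.exp (-(0.00000001 * (L / lam ^ 2))) := by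
      rw [sub_eq_add_neg, Real.exp_add]
      gcongr
      have := Real.exp_one_lt_d9
      calc Real.exp 7 = Real.exp 1 ^ 7 := by rw [← Real.exp_nat_mul]; norm_num
        _ ≤ 2.7182818286 ^ 7 := by gcongr
        _ ≤ _ := by norm_num
    set E := Real.exp (-(0.00000001 * (L / lam ^ 2)))
    have h4 : 2 * (M : ℝ) ^ 4 ≤ M ^ 2 * (2 * (N * E)) := by
      have : (M : ℝ) ^ 2 ≤ N * E := hMsq.trans (by gcongr)
      calc 2 * (M : ℝ) ^ 4 = M ^ 2 * (2 * M ^ 2) := by ring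
        _ ≤ _ := by gcongr
    have h5 : ‖W‖ ≤ N * (M ^ 2 * (1996 * E) + M ^ 2 * (2 * E)) := hWle.trans (by gcongr)
    linarith
  exact le_of_mul_le_mul_left hSle (by positivity)

/-- Vinogradov's estimate for the exponential sums occurring in the zeta function. -/
theorem norm_sum_twist_le {t : ℝ} {N N' : ℕ} (ht : 1 ≤ t) (hN : 1 ≤ N) (hNt : (N : ℝ) ≤ t ^ 2)
    (h : N ≤ N') (h' : N' ≤ 2 * N) :
    ‖∑ n ∈ Ioc N N', twist t n‖ ≤
      2000 * N * Real.exp (-(0.00000001 * (Real.log N ^ 3 / Real.log t ^ 2))) := by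
  have hNpos : (0 : ℝ) < N := by exact_mod_cast hN
  have hL0 : 0 ≤ Real.log N := Real.log_nonneg (by exact_mod_cast hN)
  have hLt : Real.log N ≤ 2 * Real.log t := by
    have := Real.log_le_log hNpos hNt
    rwa [Real.log_pow] at this
  rcases le_or_gt 500 (Real.log N) with hL | hL
  · have hlam : 1 / 2 ≤ Real.log t / Real.log N := by
      rw [div_le_div_iff₀ (by norm_num) (by linarith)]
      linarith
    have h1 := norm_sum_twist_le_of_large (N := N) hL hlam (Real.exp_log hNpos).symm h h'
    have hL1 : Real.log N ≠ 0 := by linarith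
    rw [div_mul_cancel₀ _ hL1, Real.exp_log (by linarith)] at h1
    have h2 : Real.log N / (Real.log t / Real.log N) ^ 2 = Real.log N ^ 3 / Real.log t ^ 2 := by
      have : Real.log t ≠ 0 := by linarith
      field_simp
    rwa [h2] at h1
  · have h1 : ‖∑ n ∈ Ioc N N', twist t n‖ ≤ N := by
      refine (norm_sum_le _ _).trans ?_
      simp only [norm_twist, sum_const, Nat.card_Ioc, nsmul_eq_mul, mul_one]
      exact_mod_cast (by omega : N' - N ≤ N)
    have h2 : Real.log N ^ 3 / Real.log t ^ 2 ≤ 4 * 500 := by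
      apply div_le_of_le_mul₀ (by positivity) (by norm_num)
      have : Real.log N ^ 2 ≤ (2 * Real.log t) ^ 2 := by gcongr
      nlinarith [sq_nonneg (Real.log t)]
    have h3 : 1 / 2000 ≤ Real.exp (-(0.00000001 * (Real.log N ^ 3 / Real.log t ^ 2))) := by
      refine le_trans ?_ (Real.add_one_le_exp _)
      linarith
    nlinarith

/-! ### Bounds for the zeta function near the line `re s = 1` -/

/-- `s - 1` times the error in replacing `(n + 2) ^ (-s)` by an integral over `[n + 1, n + 2]`. -/
noncomputable def zetaDefect (n : ℕ) (s : ℂ) : ℂ :=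
  (s - 1) * ((n + 2 : ℝ) : ℂ) ^ (-s) + ((n + 2 : ℝ) : ℂ) ^ (1 - s) - ((n + 1 : ℝ) : ℂ) ^ (1 - s)

theorem norm_cpow_sub_cpow_le {a b x : ℝ} {s : ℂ} (ha : 0 < a) (hax : a ≤ x) (hxb : x ≤ b)
    (hs : s ≠ 0) :
    ‖(b : ℂ) ^ (-s) - (x : ℂ) ^ (-s)‖ ≤ ‖s‖ * ∫ u in a..b, u ^ (-s.re - 1) := by
  have hx : 0 < x := ha.trans_le hax
  have h0 : (0 : ℝ) ∉ Set.uIcc x b := by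
    rw [Set.uIcc_of_le hxb]
    exact fun h => (hx.trans_le h.1).false
  have h1 := integral_cpow (a := x) (b := b) (r := -s - 1)
    (Or.inr ⟨fun h => hs (by linear_combination -h), h0⟩)
  rw [show -s - 1 + 1 = -s by ring, eq_div_iff (neg_ne_zero.2 hs)] at h1
  have hint : ∀ {c : ℝ}, 0 < c → ∀ {d : ℝ}, c ≤ d →
      IntervalIntegrable (fun u : ℝ => u ^ (-s.re - 1)) MeasureTheory.volume c d := by
    intro c hc d hcd
    apply ContinuousOn.intervalIntegrable
    rw [Set.uIcc_of_le hcd]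
    exact fun u hu => (Real.continuousAt_rpow_const _ _
      (Or.inl (hc.trans_le hu.1).ne')).continuousWithinAt
  rw [← h1, norm_mul, norm_neg, mul_comm]
  gcongr
  refine (intervalIntegral.norm_integral_le_integral_norm hxb).trans ?_
  have h2 : ∫ u in x..b, ‖(u : ℂ) ^ (-s - 1)‖ = ∫ u in x..b, u ^ (-s.re - 1) := by
    apply intervalIntegral.integral_congr
    intro u hu
    rw [Set.uIcc_of_le hxb] at hu
    simp [Complex.norm_cpow_eq_rpow_re_of_pos (hx.trans_le hu.1)]
  rw [h2, ← intervalIntegral.integral_add_adjacent_intervals (hint ha hax) (hint hx hxb)]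
  have : 0 ≤ ∫ u in a..x, u ^ (-s.re - 1) :=
    intervalIntegral.integral_nonneg hax fun u hu => Real.rpow_nonneg (ha.le.trans hu.1) _
  linarith

theorem norm_zetaDefect_le (n : ℕ) {s : ℂ} (hs : s ≠ 0) :
    ‖zetaDefect n s‖ ≤ ‖s - 1‖ * ‖s‖ * ∫ u in (n + 1 : ℝ)..(n + 2), u ^ (-s.re - 1) := by
  rcases eq_or_ne s 1 with rfl | hs1
  · simp [zetaDefect]
  set a : ℝ := n + 1 with ha
  have ha0 : 0 < a := by positivity
  have hb : (n + 2 : ℝ) = a + 1 := by rw [ha]; ring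
  have h0 : (0 : ℝ) ∉ Set.uIcc a (a + 1) := by
    rw [Set.uIcc_of_le (by linarith)]
    exact fun h => (ha0.trans_le h.1).false
  have h1 := integral_cpow (a := a) (b := a + 1) (r := -s)
    (Or.inr ⟨fun h => hs1 (by linear_combination -h), h0⟩)
  rw [show -s + 1 = 1 - s by ring, eq_div_iff (sub_ne_zero.2 hs1.symm)] at h1
  have hcont : IntervalIntegrable (fun x : ℝ => (x : ℂ) ^ (-s)) MeasureTheory.volume a (a + 1) :=
    intervalIntegral.intervalIntegrable_cpow (Or.inr h0)
  have h2 : zetaDefect n s =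
      (s - 1) * ∫ x in a..(a + 1), (((a + 1 : ℝ) : ℂ) ^ (-s) - (x : ℂ) ^ (-s)) := by
    rw [intervalIntegral.integral_sub (by simp) hcont]
    unfold zetaDefect
    rw [hb, ← ha, intervalIntegral.integral_const]
    simp only [add_sub_cancel_left, one_smul]
    linear_combination -h1
  rw [h2, norm_mul, mul_assoc, hb]
  gcongr
  have h3 := intervalIntegral.norm_integral_le_of_norm_le_const (a := a) (b := a + 1)
    (f := fun x : ℝ => ((a + 1 : ℝ) : ℂ) ^ (-s) - (x : ℂ) ^ (-s)) (fun x hx => by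
      rw [Set.uIoc_of_le (by linarith)] at hx
      exact norm_cpow_sub_cpow_le ha0 hx.1.le hx.2 hs)
  simpa using h3

theorem integral_rpow_neg_succ_le (n : ℕ) {σ δ : ℝ} (hδ : 0 ≤ δ) (h : δ ≤ σ) :
    ∫ u in (n + 1 : ℝ)..(n + 2), u ^ (-σ - 1) ≤ ((n + 1 : ℕ) : ℝ) ^ (-δ - 1) := by
  have h1 := intervalIntegral.norm_integral_le_of_norm_le_const (a := (n + 1 : ℝ)) (b := n + 2)
    (f := fun u : ℝ => u ^ (-σ - 1)) (C := ((n + 1 : ℕ) : ℝ) ^ (-δ - 1)) (fun u hu => by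
      rw [Set.uIoc_of_le (by linarith)] at hu
      have hn : (0 : ℝ) ≤ n := n.cast_nonneg
      have hu1 : 1 ≤ u := by linarith [hu.1]
      rw [Real.norm_of_nonneg (by positivity)]
      calc u ^ (-σ - 1) ≤ u ^ (-δ - 1) := Real.rpow_le_rpow_of_exponent_le hu1 (by linarith)
        _ ≤ _ := Real.rpow_le_rpow_of_nonpos (by positivity) (by push_cast; exact hu.1.le)
          (by linarith))
  refine (Real.le_norm_self _).trans (h1.trans (le_of_eq ?_))
  rw [show (n + 2 : ℝ) - (n + 1) = 1 by ring]
  simp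

theorem summable_nat_succ_rpow {δ : ℝ} (hδ : 0 < δ) :
    Summable fun n : ℕ => ((n + 1 : ℕ) : ℝ) ^ (-δ - 1) :=
  (summable_nat_add_iff 1).2 (Real.summable_nat_rpow.2 (by linarith))

theorem summable_zetaDefect {s : ℂ} (hs : 0 < s.re) : Summable fun n => zetaDefect n s := by
  have hs0 : s ≠ 0 := fun h => by simp [h] at hs
  refine Summable.of_norm_bounded ((summable_nat_succ_rpow hs).mul_left (‖s - 1‖ * ‖s‖))
    fun n => (norm_zetaDefect_le n hs0).trans ?_
  gcongr
  exact integral_rpow_neg_succ_le n hs.le le_rfl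

theorem differentiable_zetaDefect (n : ℕ) : Differentiable ℂ (zetaDefect n) := by
  have h1 : ((n + 2 : ℝ) : ℂ) ≠ 0 := Complex.ofReal_ne_zero.2 (by positivity)
  have h2 : ((n + 1 : ℝ) : ℂ) ≠ 0 := Complex.ofReal_ne_zero.2 (by positivity)
  intro s
  unfold zetaDefect
  have d1 : DifferentiableAt ℂ (fun s : ℂ => ((n + 2 : ℝ) : ℂ) ^ (-s)) s :=
    (differentiableAt_id.neg).const_cpow (Or.inl h1)
  have d2 : DifferentiableAt ℂ (fun s : ℂ => ((n + 2 : ℝ) : ℂ) ^ (1 - s)) s :=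
    (differentiableAt_id.const_sub 1).const_cpow (Or.inl h1)
  have d3 : DifferentiableAt ℂ (fun s : ℂ => ((n + 1 : ℝ) : ℂ) ^ (1 - s)) s :=
    (differentiableAt_id.const_sub 1).const_cpow (Or.inl h2)
  exact (((differentiableAt_id.sub_const 1).mul d1).add d2).sub d3

theorem differentiableOn_tsum_zetaDefect :
    DifferentiableOn ℂ (fun s => ∑' n, zetaDefect n s) {s | 0 < s.re} := by
  intro s hs
  apply DifferentiableAt.differentiableWithinAt
  have hopen : IsOpen ({z : ℂ | s.re / 2 < z.re} ∩ Metric.ball 0 (‖s‖ + 1)) :=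
    (isOpen_lt continuous_const Complex.continuous_re).inter Metric.isOpen_ball
  have hs' : 0 < s.re := hs
  refine (Complex.differentiableOn_tsum_of_summable_norm
    (u := fun n => (‖s‖ + 2) * (‖s‖ + 1) * ((n + 1 : ℕ) : ℝ) ^ (-(s.re / 2) - 1))
    ((summable_nat_succ_rpow (half_pos hs')).mul_left _)
    (fun n => (differentiable_zetaDefect n).differentiableOn) hopen ?_).differentiableAt
    (hopen.mem_nhds ⟨half_lt_self hs', by simp⟩)
  rintro n z ⟨hz1, hz2⟩
  have hz1 : s.re / 2 < z.re := hz1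
  rw [mem_ball_zero_iff] at hz2
  have hz0 : z ≠ 0 := fun h => by
    rw [h, Complex.zero_re] at hz1
    linarith
  refine (norm_zetaDefect_le n hz0).trans ?_
  have h3 : ‖z - 1‖ ≤ ‖s‖ + 2 := (norm_sub_le _ _).trans (by rw [norm_one]; linarith)
  gcongr
  · exact intervalIntegral.integral_nonneg (by linarith) fun u hu =>
      Real.rpow_nonneg (le_trans (by positivity) hu.1) _
  · exact integral_rpow_neg_succ_le n (half_pos hs').le hz1.le

theorem sum_range_zetaDefect (N : ℕ) (s : ℂ) : ∑ n ∈ range N, zetaDefect n s =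
    (s - 1) * ∑ n ∈ range (N + 1), ((n + 1 : ℝ) : ℂ) ^ (-s) + ((N + 1 : ℝ) : ℂ) ^ (1 - s) - s := by
  induction N with
  | zero => simp
  | succ N ih =>
    rw [sum_range_succ, ih, sum_range_succ _ (N + 1)]
    unfold zetaDefect
    push_cast
    rw [show (N + 1 + 1 : ℂ) = N + 2 by ring]
    ring

theorem riemannZeta₁_eq_of_one_lt_re {s : ℂ} (hs : 1 < s.re) :
    riemannZeta₁ s = s + ∑' n, zetaDefect n s := by
  have hs1 : s ≠ 1 := fun h => by simp [h] at hs
  have h1 : Filter.Tendsto (fun N => ∑ n ∈ range N, zetaDefect n s) Filter.atTop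
      (nhds (∑' n, zetaDefect n s)) :=
    (summable_zetaDefect (by linarith)).hasSum.tendsto_sum_nat
  have h2 : Summable fun n : ℕ => ((n + 1 : ℝ) : ℂ) ^ (-s) := by
    have := (summable_nat_add_iff 1).2 (Complex.summable_one_div_nat_cpow.2 hs)
    refine this.congr fun n => ?_
    rw [Complex.cpow_neg, one_div]
    push_cast
    rfl
  have h3 : riemannZeta s = ∑' n : ℕ, ((n + 1 : ℝ) : ℂ) ^ (-s) := by
    rw [zeta_eq_tsum_one_div_nat_add_one_cpow hs]
    refine tsum_congr fun n => ?_
    rw [Complex.cpow_neg, one_div]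
    push_cast
    rfl
  have h4 : Filter.Tendsto (fun N : ℕ => ((N + 1 : ℝ) : ℂ) ^ (1 - s)) Filter.atTop (nhds 0) := by
    rw [tendsto_zero_iff_norm_tendsto_zero]
    have h5 := (tendsto_rpow_neg_atTop (y := s.re - 1) (by linarith)).comp
      (Filter.tendsto_atTop_add_const_right _ 1 tendsto_natCast_atTop_atTop)
    refine h5.congr fun N => ?_
    rw [Complex.norm_cpow_eq_rpow_re_of_pos (by positivity)]
    simp
  have h5 := (((h2.hasSum.tendsto_sum_nat.comp (Filter.tendsto_add_atTop_nat 1)).const_mul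
    (s - 1)).add h4).sub_const s
  have h6 := tendsto_nhds_unique h1 (h5.congr fun N => (sum_range_zetaDefect N s).symm)
  rw [h6, ← h3, riemannZeta_eq_inv_sub_mul hs1, mul_inv_cancel_left₀ (sub_ne_zero.2 hs1)]
  ring

theorem riemannZeta₁_eq {s : ℂ} (hs : 0 < s.re) :
    riemannZeta₁ s = s + ∑' n, zetaDefect n s := by
  have hopen : IsOpen {s : ℂ | 0 < s.re} := isOpen_lt continuous_const Complex.continuous_re
  have h1 : AnalyticOnNhd ℂ riemannZeta₁ {s | 0 < s.re} :=
    differentiable_riemannZeta₁.differentiableOn.analyticOnNhd hopen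
  have h2 : AnalyticOnNhd ℂ (fun s => s + ∑' n, zetaDefect n s) {s | 0 < s.re} :=
    (differentiableOn_id.add differentiableOn_tsum_zetaDefect).analyticOnNhd hopen
  refine h1.eqOn_of_preconnected_of_eventuallyEq h2
    (convex_halfSpace_re_gt 0).isPreconnected (z₀ := 2) (by simp) ?_ hs
  filter_upwards [(isOpen_lt continuous_const Complex.continuous_re).mem_nhds
    (by simp : (2 : ℂ) ∈ {s : ℂ | 1 < s.re})] with z hz
  exact riemannZeta₁_eq_of_one_lt_re hz

/-- Approximation of the zeta function by a partial sum, to the right of the imaginary axis. -/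
theorem norm_riemannZeta_sub_sum_le {s : ℂ} (hs : 0 < s.re) (hs1 : s ≠ 1) {N : ℕ} (hN : 1 ≤ N) :
    ‖riemannZeta s - (∑ n ∈ Icc 1 N, (n : ℂ) ^ (-s) + (N : ℂ) ^ (1 - s) / (s - 1))‖ ≤
      ‖s‖ * ((N : ℝ) ^ (-s.re) / s.re) := by
  obtain ⟨K, rfl⟩ : ∃ K, N = K + 1 := ⟨N - 1, by omega⟩
  have hs0 : s ≠ 0 := fun h => by simp [h] at hs
  have hsub := sub_ne_zero.2 hs1
  have h1 : riemannZeta s - (∑ n ∈ Icc 1 (K + 1), (n : ℂ) ^ (-s) +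
      ((K + 1 : ℕ) : ℂ) ^ (1 - s) / (s - 1)) = (s - 1)⁻¹ * ∑' n, zetaDefect (n + K) s := by
    have h2 := (summable_zetaDefect hs).sum_add_tsum_nat_add K
    rw [sum_range_zetaDefect] at h2
    have h3 : ∑ n ∈ Icc 1 (K + 1), (n : ℂ) ^ (-s) =
        ∑ n ∈ range (K + 1), ((n + 1 : ℝ) : ℂ) ^ (-s) := by
      rw [show Icc 1 (K + 1) = Ico (0 + 1) (K + 1 + 1) by ext; simp,
        ← sum_Ico_add' (fun n : ℕ => (n : ℂ) ^ (-s)) 0 (K + 1) 1, range_eq_Ico]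
      exact sum_congr rfl fun n _ => by push_cast; rfl
    rw [riemannZeta_eq_inv_sub_mul hs1, riemannZeta₁_eq hs, ← h2, h3]
    push_cast
    field_simp
    ring
  have htel : HasSum (fun n : ℕ => ∫ u in ((n + K : ℕ) + 1 : ℝ)..((n + K : ℕ) + 2), u ^ (-s.re - 1))
      (((K + 1 : ℕ) : ℝ) ^ (-s.re) / s.re) := by
    have hterm : ∀ n : ℕ, ∫ u in ((n + K : ℕ) + 1 : ℝ)..((n + K : ℕ) + 2), u ^ (-s.re - 1) =
        ((n + (K + 1) : ℝ)) ^ (-s.re) / s.re - (((n + 1 : ℕ) + (K + 1) : ℝ)) ^ (-s.re) / s.re := by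
      intro n
      rw [integral_rpow]
      · push_cast
        rw [show -s.re - 1 + 1 = -s.re by ring, div_neg, ← neg_div, neg_sub, sub_div]
        ring_nf
      · right
        refine ⟨by linarith, ?_⟩
        rw [Set.uIcc_of_le (by linarith)]
        intro h
        have : (0 : ℝ) < (n + K : ℕ) + 1 := by positivity
        linarith [h.1]
    rw [hasSum_iff_tendsto_nat_of_nonneg]
    · simp_rw [hterm]
      have h5 := (tendsto_rpow_neg_atTop hs).comp
          (Filter.tendsto_atTop_add_const_right _ (K + 1 : ℝ)
        tendsto_natCast_atTop_atTop)
      have h6 := (h5.div_const s.re).const_sub (((K + 1 : ℕ) : ℝ) ^ (-s.re) / s.re)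
      rw [zero_div, sub_zero] at h6
      refine h6.congr fun n => ?_
      rw [sum_range_sub' (fun n : ℕ => ((n + (K + 1) : ℝ)) ^ (-s.re) / s.re)]
      simp
    · intro n
      exact intervalIntegral.integral_nonneg (by linarith) fun u hu =>
        Real.rpow_nonneg (le_trans (by positivity) hu.1) _
  rw [h1, norm_mul, norm_inv]
  have h7 := tsum_of_norm_bounded (htel.mul_left (‖s - 1‖ * ‖s‖))
    (fun n => norm_zetaDefect_le (n + K) hs0)
  have h8 : 0 < ‖s - 1‖ := norm_pos_iff.2 hsub
  rw [inv_mul_le_iff₀ h8]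
  refine h7.trans (le_of_eq ?_)
  ring

theorem norm_sum_mul_le_of_antitone {w : ℕ → ℝ} (hw : Antitone w) (hw0 : ∀ n, 0 ≤ w n)
    {a : ℕ → ℂ} {B : ℝ} {K : ℕ} (hB : ∀ k ≤ K, ‖∑ i ∈ range k, a i‖ ≤ B) :
    ‖∑ i ∈ range K, (w i : ℂ) * a i‖ ≤ w 0 * B := by
  have h : ∀ k ≤ K, ‖∑ i ∈ range k, (w i : ℂ) * a i - w k * ∑ i ∈ range k, a i‖ ≤
      (w 0 - w k) * B := by
    intro k
    induction k with
    | zero => simp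
    | succ k ih =>
      intro hk
      have h1 : ∑ i ∈ range (k + 1), (w i : ℂ) * a i - w (k + 1) * ∑ i ∈ range (k + 1), a i =
          (∑ i ∈ range k, (w i : ℂ) * a i - w k * ∑ i ∈ range k, a i) +
          ((w k - w (k + 1) : ℝ) : ℂ) * ∑ i ∈ range (k + 1), a i := by
        rw [sum_range_succ, sum_range_succ]
        push_cast
        ring
      have h2 : 0 ≤ w k - w (k + 1) := sub_nonneg.2 (hw k.le_succ)
      rw [h1]
      refine (norm_add_le _ _).trans ?_
      rw [norm_mul, Complex.norm_real, Real.norm_of_nonneg h2]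
      nlinarith [ih (by omega), mul_le_mul_of_nonneg_left (hB (k + 1) hk) h2]
  have h1 := norm_le_norm_add_norm_sub' (∑ i ∈ range K, (w i : ℂ) * a i) (w K * ∑ i ∈ range K, a i)
  rw [norm_mul, Complex.norm_real, Real.norm_of_nonneg (hw0 K)] at h1
  nlinarith [h K le_rfl, mul_le_mul_of_nonneg_left (hB K le_rfl) (hw0 K)]

theorem natCast_cpow_neg_eq_twist {n : ℕ} (hn : n ≠ 0) (σ t : ℝ) :
    (n : ℂ) ^ (-(σ + t * Complex.I)) = ((n : ℝ) ^ (-σ) : ℝ) * twist t n := by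
  have hn0 : (n : ℂ) ≠ 0 := Nat.cast_ne_zero.2 hn
  have hn1 : (0 : ℝ) < n := by positivity
  unfold twist
  rw [Complex.cpow_def_of_ne_zero hn0, Real.rpow_def_of_pos hn1, Complex.ofReal_exp,
    ← Complex.exp_add, ← Complex.natCast_log]
  push_cast
  ring_nf

theorem norm_block_sum_le {σ t : ℝ} {N : ℕ} (hσ : 0 ≤ σ) (ht : 1 ≤ t) (hN : 1 ≤ N)
    (hNt : (N : ℝ) ≤ t ^ 2) :
    ‖∑ n ∈ Ioc N (2 * N), (n : ℂ) ^ (-(σ + t * Complex.I))‖ ≤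
      2000 * Real.exp ((1 - σ) * Real.log N - 0.00000001 * (Real.log N ^ 3 / Real.log t ^ 2)) := by
  have hNpos : (0 : ℝ) < N := by exact_mod_cast hN
  have hrw : ∀ K : ℕ, ∀ f : ℕ → ℂ, ∑ n ∈ Ioc N (N + K), f n = ∑ i ∈ range K, f (N + 1 + i) := by
    intro K f
    rw [show Ioc N (N + K) = Ico (N + 1) (N + 1 + K) by ext; simp; omega, sum_Ico_eq_sum_range,
      Nat.add_sub_cancel_left]
  have h1 := norm_sum_mul_le_of_antitone (w := fun i => ((N + 1 + i : ℕ) : ℝ) ^ (-σ))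
    (fun i j hij => Real.rpow_le_rpow_of_nonpos (by positivity) (by gcongr) (by linarith))
    (fun i => by positivity) (a := fun i => twist t (N + 1 + i : ℕ)) (K := N)
    (B := 2000 * N * Real.exp (-(0.00000001 * (Real.log N ^ 3 / Real.log t ^ 2)))) (fun k hk => by
      rw [← hrw k (fun n => twist t n)]
      exact norm_sum_twist_le ht hN hNt (by omega) (by omega))
  have h2 : ∑ n ∈ Ioc N (2 * N), (n : ℂ) ^ (-(σ + t * Complex.I)) =
      ∑ i ∈ range N, ((((N + 1 + i : ℕ) : ℝ) ^ (-σ) : ℝ) : ℂ) * twist t (N + 1 + i : ℕ) := by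
    rw [two_mul, hrw]
    exact sum_congr rfl fun i _ => natCast_cpow_neg_eq_twist (by omega) σ t
  rw [h2]
  refine h1.trans ?_
  have h3 : ((N + 1 + 0 : ℕ) : ℝ) ^ (-σ) ≤ (N : ℝ) ^ (-σ) :=
    Real.rpow_le_rpow_of_nonpos hNpos (by push_cast; linarith) (by linarith)
  calc _ ≤ (N : ℝ) ^ (-σ) *
        (2000 * N * Real.exp (-(0.00000001 * (Real.log N ^ 3 / Real.log t ^ 2)))) := by gcongr
    _ = _ := by
      nth_rewrite 2 [← Real.exp_log hNpos]
      rw [Real.rpow_def_of_pos hNpos, sub_eq_add_neg, sub_mul, one_mul, Real.exp_add, Real.exp_sub,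
        mul_neg, Real.exp_neg (Real.log N * σ), mul_comm σ]
      field_simp

theorem sq_mul_le_add_cube {q u : ℝ} (hq : 0 ≤ q) (hu : 0 ≤ u) : q ^ 2 * u ≤ q ^ 3 + u ^ 3 := by
  rcases le_total u q with h | h
  · nlinarith [pow_nonneg hu 3, mul_le_mul_of_nonneg_left h (sq_nonneg q)]
  · nlinarith [pow_nonneg hq 3, mul_le_mul_of_nonneg_right (pow_le_pow_left₀ hq h 2) hu]

theorem sum_Icc_one_two_pow (m : ℕ) (f : ℕ → ℂ) :
    ∑ n ∈ Icc 1 (2 ^ m), f n = f 1 + ∑ j ∈ range m, ∑ n ∈ Ioc (2 ^ j) (2 * 2 ^ j), f n := by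
  induction m with
  | zero => simp
  | succ m ih =>
    rw [sum_range_succ, ← add_assoc, ← ih, ← sum_union]
    · congr 1
      ext n
      have := Nat.one_le_two_pow (n := m)
      simp only [mem_Icc, mem_union, mem_Ioc, pow_succ]
      omega
    · rw [disjoint_left]
      intro n h1 h2
      simp only [mem_Icc, mem_Ioc] at h1 h2
      omega

/-- A logarithmic bound for the zeta function in the Vinogradov–Korobov range. -/
theorem norm_riemannZeta_le_log_cube {σ t q : ℝ} (ht : 0 < t) (hT : 100000 ≤ Real.log t)
    (hq0 : 0 ≤ q)
    (hq : q ^ 3 * Real.log t = Real.log (Real.log t)) (hσ : 1 - 0.00000001 * q ^ 2 ≤ σ)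
    (hσ2 : σ ≤ 2) :
    ‖riemannZeta (σ + t * Complex.I)‖ ≤ Real.log t ^ 3 := by
  set T := Real.log t with hTdef
  have hTpos : 0 < T := by linarith
  have ht3 : 3 ≤ t := by
    have := Real.log_le_sub_one_of_pos ht
    linarith
  have hq1 : q ≤ 1 := by
    by_contra! h
    have h1 : 1 < q ^ 3 := one_lt_pow₀ h (by norm_num)
    have h2 := Real.log_le_sub_one_of_pos hTpos
    nlinarith
  have hσ1 : 1 / 2 ≤ σ := by nlinarith
  set s : ℂ := σ + t * Complex.I with hs
  have hsre : s.re = σ := by simp [hs]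
  have hsim : s.im = t := by simp [hs]
  have hs1 : s ≠ 1 := fun h => by
    rw [h, Complex.one_im] at hsim
    linarith
  have hsn : ‖s‖ ≤ 2 * t := by
    refine (Complex.norm_le_abs_re_add_abs_im s).trans ?_
    rw [hsre, hsim, abs_of_nonneg (by linarith), abs_of_nonneg (by linarith)]
    linarith
  have hs1n : t ≤ ‖s - 1‖ := by
    have := Complex.abs_im_le_norm (s - 1)
    rw [Complex.sub_im, Complex.one_im, sub_zero, hsim, abs_of_nonneg (by linarith)] at this
    exact this
  have hlogt : Real.log (t ^ 2) = 2 * T := by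
    rw [Real.log_pow, hTdef]
    norm_num
  set m := ⌊Real.log (t ^ 2) / Real.log 2⌋₊ + 1 with hm
  have hlog2 := Real.log_two_gt_d9
  have hlog2pos : 0 < Real.log 2 := by linarith
  have hm1 : (m : ℝ) ≤ 4 * T := by
    have : (⌊Real.log (t ^ 2) / Real.log 2⌋₊ : ℝ) ≤ Real.log (t ^ 2) / Real.log 2 :=
      Nat.floor_le (by rw [hlogt]; positivity)
    have h2 : Real.log (t ^ 2) / Real.log 2 ≤ 3 * T := by
      rw [hlogt, div_le_iff₀ hlog2pos]
      nlinarith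
    rw [hm]
    push_cast
    linarith
  have hpow : ∀ j : ℕ, ((2 ^ j : ℕ) : ℝ) = Real.exp (j * Real.log 2) := by
    intro j
    push_cast
    rw [Real.exp_nat_mul, Real.exp_log (by norm_num)]
  have htexp : t ^ 2 = Real.exp (Real.log (t ^ 2)) := (Real.exp_log (by positivity)).symm
  have hm2 : ∀ j < m, ((2 ^ j : ℕ) : ℝ) ≤ t ^ 2 := by
    intro j hj
    rw [hpow, htexp]
    apply Real.exp_le_exp.2
    have h1 : j ≤ ⌊Real.log (t ^ 2) / Real.log 2⌋₊ := by omega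
    have h2 := (Nat.le_floor_iff (by rw [hlogt]; positivity)).1 h1
    rwa [le_div_iff₀ hlog2pos] at h2
  have hm3 : t ^ 2 ≤ ((2 ^ m : ℕ) : ℝ) := by
    rw [hpow, htexp]
    apply Real.exp_le_exp.2
    have := Nat.lt_floor_add_one (Real.log (t ^ 2) / Real.log 2)
    rw [div_lt_iff₀ hlog2pos] at this
    rw [hm]
    push_cast
    exact this.le
  have hm4 : ((2 ^ m : ℕ) : ℝ) ≤ 2 * t ^ 2 := by
    have := hm2 (m - 1) (by omega)
    have h2 : 2 ^ m = 2 * 2 ^ (m - 1) := by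
      rw [← pow_succ', Nat.sub_add_cancel (by omega)]
    rw [h2]
    push_cast at this ⊢
    linarith
  have hN1 : (1 : ℝ) ≤ ((2 ^ m : ℕ) : ℝ) := by exact_mod_cast Nat.one_le_two_pow
  have hblock : ∀ j ∈ range m,
      ‖∑ n ∈ Ioc ((2 : ℕ) ^ j) (2 * 2 ^ j), (n : ℂ) ^ (-s)‖ ≤ 2000 * T := by
    intro j hj
    refine (norm_block_sum_le (by linarith) (by linarith) Nat.one_le_two_pow
      (hm2 j (mem_range.1 hj))).trans ?_
    gcongr
    rw [← Real.le_log_iff_exp_le hTpos, ← hTdef]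
    set l := Real.log ((2 ^ j : ℕ) : ℝ) with hl
    have hl0 : 0 ≤ l := Real.log_natCast_nonneg _
    have h1 := sq_mul_le_add_cube hq0 (div_nonneg hl0 hTpos.le)
    have h2 : q ^ 2 * l ≤ Real.log T + l ^ 3 / T ^ 2 := by
      rw [← hq]
      calc q ^ 2 * l = (q ^ 2 * (l / T)) * T := by field_simp
        _ ≤ (q ^ 3 + (l / T) ^ 3) * T := by gcongr
        _ = _ := by field_simp
    have h3 : (1 - σ) * l ≤ 0.00000001 * q ^ 2 * l := by
      gcongr
      linarith
    have h4 : 0 ≤ Real.log T := Real.log_nonneg (by linarith)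
    linarith
  have hsum : ‖∑ n ∈ Icc 1 ((2 : ℕ) ^ m), (n : ℂ) ^ (-s)‖ ≤ 1 + 8000 * T ^ 2 := by
    rw [sum_Icc_one_two_pow]
    refine (norm_add_le _ _).trans ?_
    have h1 := (norm_sum_le _ _).trans (sum_le_sum hblock)
    rw [sum_const, card_range, nsmul_eq_mul] at h1
    have h2 : ‖((1 : ℕ) : ℂ) ^ (-s)‖ = 1 := by simp
    rw [h2]
    nlinarith
  have hmain : ‖((2 ^ m : ℕ) : ℂ) ^ (1 - s) / (s - 1)‖ ≤ 2 := by
    rw [norm_div, div_le_iff₀ (by linarith), Complex.norm_natCast_cpow_of_pos (by positivity)]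
    rw [Complex.sub_re, Complex.one_re, hsre]
    calc ((2 ^ m : ℕ) : ℝ) ^ (1 - σ) ≤ ((2 ^ m : ℕ) : ℝ) ^ (1 / 2 : ℝ) :=
          Real.rpow_le_rpow_of_exponent_le hN1 (by linarith)
      _ ≤ (2 * t ^ 2) ^ (1 / 2 : ℝ) := by gcongr
      _ ≤ 2 * t := by
          rw [← Real.sqrt_eq_rpow]
          apply Real.sqrt_le_iff.2
          constructor <;> nlinarith
      _ ≤ _ := by gcongr
  have herr : ‖s‖ * (((2 ^ m : ℕ) : ℝ) ^ (-s.re) / s.re) ≤ 4 := by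
    rw [hsre]
    have h1 : ((2 ^ m : ℕ) : ℝ) ^ (-σ) ≤ t⁻¹ := by
      calc ((2 ^ m : ℕ) : ℝ) ^ (-σ) ≤ ((2 ^ m : ℕ) : ℝ) ^ (-(1 / 2) : ℝ) :=
            Real.rpow_le_rpow_of_exponent_le hN1 (by linarith)
        _ ≤ (t ^ 2) ^ (-(1 / 2) : ℝ) :=
            Real.rpow_le_rpow_of_nonpos (by positivity) hm3 (by norm_num)
        _ = _ := by
            rw [Real.rpow_neg (by positivity), ← Real.sqrt_eq_rpow, Real.sqrt_sq (by linarith)]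
    calc _ ≤ 2 * t * (t⁻¹ / (1 / 2)) := by gcongr
      _ = 4 := by field_simp; norm_num
  have happ := norm_riemannZeta_sub_sum_le (by linarith : 0 < s.re) hs1
    (Nat.one_le_two_pow (n := m))
  have h1 := norm_le_norm_add_norm_sub' (riemannZeta s) (∑ n ∈ Icc 1 ((2 : ℕ) ^ m), (n : ℂ) ^ (-s) +
    ((2 ^ m : ℕ) : ℂ) ^ (1 - s) / (s - 1))
  have h2 := norm_add_le (∑ n ∈ Icc 1 ((2 : ℕ) ^ m), (n : ℂ) ^ (-s))
    (((2 ^ m : ℕ) : ℂ) ^ (1 - s) / (s - 1))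
  have h3 : 10000 * T ^ 2 ≤ T ^ 3 := by nlinarith [sq_nonneg T]
  nlinarith

/-! ### The zero-free region -/

theorem norm_LSeries_le {f : ℕ → ℂ} {g : ℕ → ℝ} (hfg : ∀ n, ‖f n‖ ≤ g n) {s : ℂ}
    (hsum : LSeriesSummable (fun n => (g n : ℂ)) s.re) :
    ‖LSeries f s‖ ≤ ‖LSeries (fun n => (g n : ℂ)) s.re‖ := by
  have hg : ∀ n, 0 ≤ g n := fun n => (norm_nonneg _).trans (hfg n)
  have h1 : ∀ n, LSeries.term (fun n => (g n : ℂ)) s.re n =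
      ((‖LSeries.term (fun n => (g n : ℂ)) s.re n‖ : ℝ) : ℂ) := by
    intro n
    rw [LSeries.norm_term_eq, LSeries.term_def]
    split_ifs with hn
    · simp
    · rw [Complex.norm_real, Real.norm_of_nonneg (hg n), Complex.ofReal_re,
        Complex.ofReal_div, Complex.ofReal_cpow n.cast_nonneg]
      simp
  have h2 : LSeries (fun n => (g n : ℂ)) s.re =
      ((∑' n, ‖LSeries.term (fun n => (g n : ℂ)) s.re n‖ : ℝ) : ℂ) := by
    rw [Complex.ofReal_tsum]
    exact tsum_congr h1
  rw [h2, Complex.norm_real, Real.norm_of_nonneg (tsum_nonneg fun _ => norm_nonneg _)]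
  refine tsum_of_norm_bounded hsum.norm.hasSum fun n => ?_
  rw [LSeries.norm_term_eq, LSeries.norm_term_eq]
  split_ifs
  · rfl
  · rw [Complex.norm_real, Real.norm_of_nonneg (hg n), Complex.ofReal_re]
    gcongr
    exact hfg n

theorem norm_riemannZeta_ofReal_sub_le {σ : ℝ} (hσ : 1 < σ) :
    ‖riemannZeta σ - ((1 + 1 / (σ - 1) : ℝ) : ℂ)‖ ≤ 1 := by
  have h := norm_riemannZeta_sub_sum_le (s := σ) (by rw [Complex.ofReal_re]; linarith)
    (by exact_mod_cast hσ.ne') le_rfl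
  simp only [Icc_self, sum_singleton, Nat.cast_one, Complex.one_cpow, Real.one_rpow,
    Complex.ofReal_re, Complex.norm_real, Real.norm_eq_abs] at h
  rw [abs_of_pos (by linarith), mul_one_div_cancel (by linarith)] at h
  push_cast
  exact h

theorem norm_riemannZeta_ofReal_le {σ : ℝ} (hσ : 1 < σ) (hσ2 : σ ≤ 2) :
    ‖riemannZeta σ‖ ≤ 3 / (σ - 1) := by
  have h := norm_le_norm_add_norm_sub' (riemannZeta σ) ((1 + 1 / (σ - 1) : ℝ) : ℂ)
  have h0 : 0 < σ - 1 := by linarith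
  rw [Complex.norm_real, Real.norm_of_nonneg (by positivity)] at h
  have h1 := norm_riemannZeta_ofReal_sub_le hσ
  have h2 : 1 ≤ 1 / (σ - 1) := by
    rw [le_div_iff₀ h0]
    linarith
  have h3 : 3 / (σ - 1) = 3 * (1 / (σ - 1)) := by ring
  rw [h3]
  linarith

theorem le_norm_riemannZeta_ofReal {σ : ℝ} (hσ : 1 < σ) : 1 / (σ - 1) ≤ ‖riemannZeta σ‖ := by
  have h := norm_le_norm_add_norm_sub (riemannZeta σ) ((1 + 1 / (σ - 1) : ℝ) : ℂ)
  have h0 : 0 < σ - 1 := by linarith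
  rw [Complex.norm_real, Real.norm_of_nonneg (by positivity)] at h
  have h1 := norm_riemannZeta_ofReal_sub_le hσ
  linarith

theorem norm_inv_riemannZeta_le {s : ℂ} (hs : 1 < s.re) :
    ‖(riemannZeta s)⁻¹‖ ≤ ‖riemannZeta s.re‖ := by
  have h1 := ArithmeticFunction.LSeries_zeta_mul_Lseries_moebius hs
  rw [ArithmeticFunction.LSeries_zeta_eq_riemannZeta hs] at h1
  rw [inv_eq_of_mul_eq_one_right h1]
  have hre : 1 < (s.re : ℂ).re := hs
  rw [← ArithmeticFunction.LSeries_zeta_eq_riemannZeta hre]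
  have h2 := norm_LSeries_le (f := fun n => ((ArithmeticFunction.moebius n : ℤ) : ℂ))
    (g := fun n => ((ArithmeticFunction.zeta n : ℕ) : ℝ)) (s := s) (fun n => by
      rcases eq_or_ne n 0 with rfl | hn
      · simp
      · rw [ArithmeticFunction.zeta_apply_ne hn, Complex.norm_intCast]
        exact_mod_cast ArithmeticFunction.abs_moebius_le_one)
    (by
      simp only [Complex.ofReal_natCast]
      exact ArithmeticFunction.LSeriesSummable_zeta_iff.2 hre)
  simpa only [Complex.ofReal_natCast] using h2

theorem inv_le_norm_riemannZeta {s : ℂ} (hs : 1 < s.re) (hs2 : s.re ≤ 2) :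
    (s.re - 1) / 3 ≤ ‖riemannZeta s‖ := by
  have h1 := (norm_inv_riemannZeta_le hs).trans (norm_riemannZeta_ofReal_le hs hs2)
  have h2 : 0 < ‖riemannZeta s‖ := norm_pos_iff.2 (riemannZeta_ne_zero_of_one_lt_re hs)
  rw [norm_inv, inv_le_comm₀ h2 (by
    have : 0 < s.re - 1 := by linarith
    positivity), inv_div] at h1
  exact h1

/-- The logarithmic derivative of the zeta function to the right of the line `re s = 1`. -/
theorem exists_norm_deriv_riemannZeta_le : ∃ A : ℝ, 1 ≤ A ∧ ∀ s : ℂ, 1 < s.re → s.re ≤ 2 →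
    ‖deriv riemannZeta s‖ ≤ A / (s.re - 1) * ‖riemannZeta s‖ := by
  obtain ⟨C₀, hC₀⟩ := (isCompact_Icc (a := (1 : ℝ)) (b := 2)).exists_bound_of_continuousOn
    (f := fun x : ℝ => riemannZeta₁ x)
    (differentiable_riemannZeta₁.continuous.comp Complex.continuous_ofReal).continuousOn
  have hd : Continuous (deriv riemannZeta₁) :=
    (differentiable_riemannZeta₁.contDiff (n := 1)).continuous_deriv le_rfl
  obtain ⟨C₁, hC₁⟩ := (isCompact_Icc (a := (1 : ℝ)) (b := 2)).exists_bound_of_continuousOn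
    (f := fun x : ℝ => deriv riemannZeta₁ x) (hd.comp Complex.continuous_ofReal).continuousOn
  refine ⟨max 1 (C₀ + C₁), le_max_left _ _, fun s hs hs2 => ?_⟩
  have hre : 1 < (s.re : ℂ).re := hs
  have h1 := norm_LSeries_le (f := fun n => (ArithmeticFunction.vonMangoldt n : ℂ))
    (g := fun n => ArithmeticFunction.vonMangoldt n) (s := s) (fun n => by
      rw [Complex.norm_real, Real.norm_of_nonneg ArithmeticFunction.vonMangoldt_nonneg])
    (ArithmeticFunction.LSeriesSummable_vonMangoldt hre)
  rw [ArithmeticFunction.LSeries_vonMangoldt_eq_deriv_riemannZeta_div hs,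
    ArithmeticFunction.LSeries_vonMangoldt_eq_deriv_riemannZeta_div hre, norm_div, norm_div,
    norm_neg, norm_neg, div_le_iff₀ (norm_pos_iff.2 (riemannZeta_ne_zero_of_one_lt_re hs))] at h1
  refine h1.trans (mul_le_mul_of_nonneg_right ?_ (norm_nonneg _))
  set σ := s.re
  have h0 : 0 < σ - 1 := by linarith
  have hσ1 : (σ : ℂ) ≠ 1 := by exact_mod_cast hs.ne'
  have hσsub : (σ : ℂ) - 1 ≠ 0 := sub_ne_zero.2 hσ1
  have hder : deriv riemannZeta σ =
      -((σ - 1 : ℂ) ^ 2)⁻¹ * riemannZeta₁ σ + (σ - 1 : ℂ)⁻¹ * deriv riemannZeta₁ σ := by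
    have heq : riemannZeta =ᶠ[nhds (σ : ℂ)] fun z => (z - 1)⁻¹ * riemannZeta₁ z := by
      filter_upwards [isOpen_ne.mem_nhds hσ1] with z hz
      exact riemannZeta_eq_inv_sub_mul hz
    rw [heq.deriv_eq]
    have e1 : HasDerivAt (fun z : ℂ => (z - 1)⁻¹) (-1 / ((σ : ℂ) - 1) ^ 2) σ :=
      ((hasDerivAt_id (σ : ℂ)).sub_const 1).inv hσsub
    rw [(e1.fun_mul (differentiable_riemannZeta₁ σ).hasDerivAt).deriv]
    field_simp
  have hn : ‖(σ : ℂ) - 1‖ = σ - 1 := by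
    rw [← Complex.ofReal_one, ← Complex.ofReal_sub, Complex.norm_real, Real.norm_of_nonneg h0.le]
  have hbound : ‖deriv riemannZeta σ‖ ≤ max 1 (C₀ + C₁) / (σ - 1) ^ 2 := by
    rw [hder]
    refine (norm_add_le _ _).trans ?_
    rw [norm_mul, norm_mul, norm_neg, norm_inv, norm_inv, norm_pow, hn]
    have b0 := hC₀ σ ⟨hs.le, hs2⟩
    have b1 := hC₁ σ ⟨hs.le, hs2⟩
    have hC1 : 0 ≤ C₁ := (norm_nonneg _).trans b1
    have h2 : (σ - 1)⁻¹ ≤ ((σ - 1) ^ 2)⁻¹ := by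
      apply inv_anti₀ (by positivity)
      nlinarith
    calc _ ≤ ((σ - 1) ^ 2)⁻¹ * C₀ + ((σ - 1) ^ 2)⁻¹ * C₁ := by gcongr
      _ = (C₀ + C₁) / (σ - 1) ^ 2 := by ring
      _ ≤ _ := by gcongr; exact le_max_right _ _
  have hz := le_norm_riemannZeta_ofReal hs
  have hzpos : 0 < 1 / (σ - 1) := by positivity
  calc _ ≤ max 1 (C₀ + C₁) / (σ - 1) ^ 2 / (1 / (σ - 1)) := by gcongr
    _ = _ := by field_simp

/-- Values of the zeta function at nearby points to the right of `re s = 1` are comparable. -/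
theorem norm_riemannZeta_le_of_near {A : ℝ} (hA : 1 ≤ A) (hlog : ∀ s : ℂ, 1 < s.re → s.re ≤ 2 →
    ‖deriv riemannZeta s‖ ≤ A / (s.re - 1) * ‖riemannZeta s‖) {x D : ℝ} (hx : 0 < x) {s₁ s₂ : ℂ}
    (h₁ : 1 + x ≤ s₁.re) (h₁' : s₁.re ≤ 2) (h₂ : 1 + x ≤ s₂.re) (h₂' : s₂.re ≤ 2)
    (hD : ‖s₂ - s₁‖ ≤ D * x) :
    ‖riemannZeta s₂‖ ≤ Real.exp (A * D) * ‖riemannZeta s₁‖ := by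
  let p : ℝ → ℂ := fun τ => s₁ + τ * (s₂ - s₁)
  have hp : ∀ τ ∈ Set.Icc (0 : ℝ) 1, 1 + x ≤ (p τ).re ∧ (p τ).re ≤ 2 := by
    intro τ hτ
    have : (p τ).re = (1 - τ) * s₁.re + τ * s₂.re := by
      simp [p]
      ring
    rw [this]
    obtain ⟨a, b⟩ := hτ
    constructor <;> nlinarith
  have hder : ∀ τ ∈ Set.Icc (0 : ℝ) 1, HasDerivAt (fun τ => riemannZeta (p τ))
      (deriv riemannZeta (p τ) * (s₂ - s₁)) τ := by
    intro τ hτ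
    have hne : p τ ≠ 1 := fun h => by
      have := (hp τ hτ).1
      rw [h, Complex.one_re] at this
      linarith
    have e1 : HasDerivAt p (s₂ - s₁) τ := by
      have := ((Complex.ofRealCLM.hasDerivAt (x := τ)).mul_const (s₂ - s₁)).const_add s₁
      simpa [p] using this
    exact (differentiableAt_riemannZeta hne).hasDerivAt.comp τ e1
  have h := norm_le_gronwallBound_of_norm_deriv_right_le (f := fun τ => riemannZeta (p τ))
    (f' := fun τ => deriv riemannZeta (p τ) * (s₂ - s₁)) (δ := ‖riemannZeta s₁‖) (K := A * D)
    (ε := 0) (a := 0) (b := 1) (fun τ hτ => (hder τ hτ).continuousAt.continuousWithinAt)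
    (fun τ hτ => (hder τ (Set.Ico_subset_Icc_self hτ)).hasDerivWithinAt) (by simp [p])
    (fun τ hτ => by
      obtain ⟨b1, b2⟩ := hp τ (Set.Ico_subset_Icc_self hτ)
      rw [norm_mul, add_zero]
      have hD0 : 0 ≤ D := by
        by_contra! hneg
        nlinarith [norm_nonneg (s₂ - s₁)]
      calc _ ≤ (A / x * ‖riemannZeta (p τ)‖) * (D * x) := by
            gcongr
            refine (hlog _ (by linarith) b2).trans ?_
            gcongr
            linarith
        _ = _ := by field_simp) 1 (by simp)
  rw [gronwallBound_ε0] at h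
  simpa [p, mul_comm] using h

/-- A reflection principle: a bound for the zeta function in a half disc to the left of a point
gives a comparison of its values at points symmetric about it. -/
theorem norm_riemannZeta_reflect_le {r B x₀ u x : ℝ} (hr : 0 < r) (hr2 : r ≤ 1 / 2) (hB : 0 ≤ B)
    (hx₀ : 0 < x₀) (hx₀r : x₀ ≤ r) (hu : 1 ≤ u) (hinv : 3 / x₀ ≤ Real.exp B)
    (hbd : ∀ s : ℂ, 1 - r ≤ s.re → s.re ≤ 2 → |s.im - u| ≤ 1 → ‖riemannZeta s‖ ≤ Real.exp B)
    (hx : 0 ≤ x) (hxr : x < r) :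
    ‖riemannZeta ((1 + x₀ - x : ℝ) + u * Complex.I)‖ ≤
      Real.exp (4 * B * x / r) * ‖riemannZeta ((1 + x₀ + x : ℝ) + u * Complex.I)‖ := by
  rcases hx.eq_or_lt with rfl | hx
  · simp
  let s₀ : ℂ := (1 + x₀ : ℝ) + u * Complex.I
  have hs₀re : s₀.re = 1 + x₀ := by simp [s₀]
  have hs₀im : s₀.im = u := by simp [s₀]
  let c₀ : ℂ := (starRingEnd ℂ) s₀
  have hc₀re : c₀.re = 1 + x₀ := by simp [c₀, hs₀re]
  have hc₀im : c₀.im = -u := by simp [c₀, hs₀im]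
  have hconj : ∀ w : ℂ, ‖riemannZeta (c₀ - w)‖ =
      ‖riemannZeta (s₀ - (starRingEnd ℂ) w)‖ := by
    intro w
    have : c₀ - w = (starRingEnd ℂ) (s₀ - (starRingEnd ℂ) w) := by simp [c₀]
    rw [this, riemannZeta_conj, Complex.norm_conj]
  let U : Set ℂ := Metric.ball 0 r ∩ {w | 0 < w.re}
  have hUo : IsOpen U := Metric.isOpen_ball.inter (isOpen_lt continuous_const Complex.continuous_re)
  have hcl : ∀ w ∈ closure U, ‖w‖ ≤ r ∧ 0 ≤ w.re := by
    intro w hw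
    have : closure U ⊆ Metric.closedBall 0 r ∩ {w | 0 ≤ w.re} := by
      apply closure_minimal
      · rintro w ⟨h1, h2⟩
        rw [Set.mem_ofPred_eq] at h2
        exact ⟨Metric.ball_subset_closedBall h1, Set.mem_ofPred_eq ▸ h2.le⟩
      · exact Metric.isClosed_closedBall.inter (isClosed_le continuous_const Complex.continuous_re)
    obtain ⟨h1, h2⟩ := this hw
    exact ⟨by simpa using h1, h2⟩
  let E : ℂ → ℂ := fun w => Complex.exp (-(2 * B) * (2 * (w / r) - (w / r) ^ 2))
  let g : ℂ → ℂ := fun w => riemannZeta (c₀ - w) / riemannZeta (s₀ + w) * E w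
  have hEnorm : ∀ w : ℂ, ‖E w‖ =
      Real.exp (-(2 * B) * (2 * (w.re / r) - ((w.re / r) ^ 2 - (w.im / r) ^ 2))) := by
    intro w
    have hre : (-(2 * (B : ℂ)) * (2 * (w / r) - (w / r) ^ 2)).re =
        -(2 * B) * (2 * (w.re / r) - ((w.re / r) ^ 2 - (w.im / r) ^ 2)) := by
      have h1 : (w / r).re = w.re / r := Complex.div_ofReal_re w r
      have h2 : (w / r).im = w.im / r := Complex.div_ofReal_im w r
      set z := w / r
      simp [pow_two, ← h1, ← h2]
    rw [Complex.norm_exp, hre]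
  have hne0 : ∀ w ∈ closure U, riemannZeta (s₀ + w) ≠ 0 := fun w hw =>
    riemannZeta_ne_zero_of_one_lt_re (by
      rw [Complex.add_re, hs₀re]
      linarith [(hcl w hw).2])
  have hdiff : DifferentiableOn ℂ g (closure U) := by
    intro w hw
    obtain ⟨h1, h2⟩ := hcl w hw
    have him := (Complex.abs_im_le_norm w).trans h1
    rw [abs_le] at him
    have d1 : DifferentiableAt ℂ riemannZeta (c₀ - w) := differentiableAt_riemannZeta fun h => by
      have := congrArg Complex.im h
      simp only [Complex.sub_im, hc₀im, Complex.one_im] at this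
      linarith
    have d2 : DifferentiableAt ℂ riemannZeta (s₀ + w) := differentiableAt_riemannZeta fun h => by
      have := congrArg Complex.im h
      simp only [Complex.add_im, hs₀im, Complex.one_im] at this
      linarith
    have e1 : DifferentiableAt ℂ (fun w => riemannZeta (c₀ - w)) w :=
      DifferentiableAt.fun_comp' w d1 (by fun_prop)
    have e2 : DifferentiableAt ℂ (fun w => riemannZeta (s₀ + w)) w :=
      DifferentiableAt.fun_comp' w d2 (by fun_prop)
    have e3 : DifferentiableAt ℂ E w := by fun_prop
    exact ((e1.fun_div e2 (hne0 w hw)).fun_mul e3).differentiableWithinAt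
  have hfr : ∀ w ∈ frontier U, ‖g w‖ ≤ 1 := by
    intro w hw
    rw [hUo.frontier_eq] at hw
    obtain ⟨h1, h2⟩ := hcl w hw.1
    have him := (Complex.abs_im_le_norm w).trans h1
    have hre := (Complex.abs_re_le_norm w).trans h1
    have hpos : 0 < ‖riemannZeta (s₀ + w)‖ := norm_pos_iff.2 (hne0 w hw.1)
    rw [norm_mul, norm_div, hEnorm]
    rcases h2.eq_or_lt with h3 | h3
    · have hw0 : (starRingEnd ℂ) w = -w := by
        apply Complex.ext <;> simp [← h3]
      rw [hconj, hw0, sub_neg_eq_add, div_self hpos.ne', one_mul, ← h3]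
      apply Real.exp_le_one_iff.2
      have : 0 ≤ B * (w.im / r) ^ 2 := by positivity
      rw [zero_div]
      linarith
    · have hn : ‖w‖ = r := by
        refine le_antisymm h1 (not_lt.1 fun h4 => hw.2 ⟨by simpa using h4, h3⟩)
      have hb1 : ‖riemannZeta (c₀ - w)‖ ≤ Real.exp B := by
        rw [hconj]
        rw [abs_le] at him hre
        apply hbd
        · simp only [Complex.sub_re, hs₀re, Complex.conj_re]
          linarith
        · simp only [Complex.sub_re, hs₀re, Complex.conj_re]
          linarith
        · simp only [Complex.sub_im, hs₀im, Complex.conj_im]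
          rw [abs_le]
          constructor <;> linarith
      have hb2 : (‖riemannZeta (s₀ + w)‖)⁻¹ ≤ Real.exp B := by
        rw [abs_le] at hre
        have h5 := inv_le_norm_riemannZeta (s := s₀ + w)
          (by rw [Complex.add_re, hs₀re]; linarith) (by rw [Complex.add_re, hs₀re]; linarith)
        rw [Complex.add_re, hs₀re] at h5
        refine le_trans ?_ hinv
        rw [inv_le_comm₀ hpos (by positivity), inv_div]
        linarith
      have hsq : (w.re / r) ^ 2 + (w.im / r) ^ 2 = 1 := by
        have := Complex.sq_norm w
        rw [Complex.normSq_apply, hn] at this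
        field_simp
        linarith
      have hx1 : w.re / r ≤ 1 := by
        rw [div_le_one hr]
        exact (le_abs_self _).trans hre
      have hx0 : 0 < w.re / r := by positivity
      calc _ ≤ Real.exp B * Real.exp B * Real.exp (-(2 * B)) := by
            rw [div_eq_mul_inv]
            gcongr
            have : 1 ≤ 2 * (w.re / r) - ((w.re / r) ^ 2 - (w.im / r) ^ 2) := by nlinarith
            nlinarith
        _ = 1 := by
            rw [← Real.exp_add, ← Real.exp_add]
            ring_nf
            exact Real.exp_zero
  have hxU : (x : ℂ) ∈ U := by
    refine ⟨?_, by simpa using hx⟩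
    simpa [abs_of_pos hx] using hxr
  have hmain := Complex.norm_le_of_forall_mem_frontier_norm_le
    (Metric.isBounded_ball.subset Set.inter_subset_left) hdiff.diffContOnCl hfr
    (subset_closure hxU)
  have hpos : 0 < ‖riemannZeta (s₀ + x)‖ := norm_pos_iff.2 (hne0 _ (subset_closure hxU))
  rw [norm_mul, norm_div, hEnorm, hconj, Complex.conj_ofReal, Complex.ofReal_re,
    Complex.ofReal_im] at hmain
  have e1 : s₀ - x = (1 + x₀ - x : ℝ) + u * Complex.I := by
    simp only [s₀]
    push_cast
    ring
  have e2 : s₀ + x = (1 + x₀ + x : ℝ) + u * Complex.I := by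
    simp only [s₀]
    push_cast
    ring
  rw [← e1, ← e2]
  have hexp : Real.exp (-(4 * B * x / r)) ≤
      Real.exp (-(2 * B) * (2 * (x / r) - ((x / r) ^ 2 - (0 / r) ^ 2))) := by
    apply Real.exp_le_exp.2
    have : 0 ≤ B * (x / r) ^ 2 := by positivity
    have e3 : 4 * B * x / r = 4 * B * (x / r) := by ring
    rw [e3]
    ring_nf at this ⊢
    linarith
  have h1 : ‖riemannZeta (s₀ - x)‖ / ‖riemannZeta (s₀ + x)‖ * Real.exp (-(4 * B * x / r)) ≤ 1 :=
    (mul_le_mul_of_nonneg_left hexp (by positivity)).trans hmain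
  rw [Real.exp_neg, ← div_eq_mul_inv, div_le_one (Real.exp_pos _), div_le_iff₀ hpos] at h1
  exact h1

/-- The classical inequality behind the nonvanishing of the zeta function, in the form of a
monotonicity statement. -/
theorem norm_riemannZeta_product_antitone {t σ₁ σ₂ : ℝ} (h1 : 1 < σ₁)
    (h12 : σ₁ ≤ σ₂) :
    ‖riemannZeta σ₂‖ ^ 3 * ‖riemannZeta (σ₂ + t * Complex.I)‖ ^ 4 *
        ‖riemannZeta (σ₂ + (2 * t : ℝ) * Complex.I)‖ ≤
      ‖riemannZeta σ₁‖ ^ 3 * ‖riemannZeta (σ₁ + t * Complex.I)‖ ^ 4 *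
        ‖riemannZeta (σ₁ + (2 * t : ℝ) * Complex.I)‖ := by
  let Λ : ℕ → ℂ := fun n => (ArithmeticFunction.vonMangoldt n : ℂ)
  let L : ℝ → ℝ → ℂ := fun u σ => deriv riemannZeta (σ + u * Complex.I) /
    riemannZeta (σ + u * Complex.I)
  have hre : ∀ u σ : ℝ, ((σ : ℂ) + u * Complex.I).re = σ := by intros; simp
  have hder : ∀ (u σ : ℝ), 1 < σ → HasDerivAt (fun σ : ℝ => riemannZeta (σ + u * Complex.I))
      (riemannZeta (σ + u * Complex.I) * L u σ) σ := by
    intro u σ hσ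
    have hne : (σ : ℂ) + u * Complex.I ≠ 1 := fun h => by
      have := congrArg Complex.re h
      rw [hre, Complex.one_re] at this
      linarith
    have e1 : HasDerivAt (fun σ : ℝ => (σ : ℂ) + u * Complex.I) 1 σ :=
      (Complex.ofRealCLM.hasDerivAt (x := σ)).add_const _
    have e2 := (differentiableAt_riemannZeta hne).hasDerivAt.comp σ e1
    have hz : riemannZeta (σ + u * Complex.I) ≠ 0 :=
      riemannZeta_ne_zero_of_one_lt_re (by rwa [hre])
    simp only [L]
    rw [mul_div_cancel₀ _ hz]
    rw [mul_one] at e2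
    exact e2
  have hneg : ∀ σ : ℝ, 1 < σ → (3 * L 0 σ + 4 * L t σ + L (2 * t) σ).re ≤ 0 := by
    intro σ hσ
    have hsum : ∀ u : ℝ, HasSum (LSeries.term Λ (σ + u * Complex.I)) (-L u σ) := by
      intro u
      have h2 : 1 < ((σ : ℂ) + u * Complex.I).re := by rwa [hre]
      have := (ArithmeticFunction.LSeriesSummable_vonMangoldt h2).hasSum
      have h3 := ArithmeticFunction.LSeries_vonMangoldt_eq_deriv_riemannZeta_div h2
      rw [LSeries] at h3
      rw [h3, neg_div] at this
      exact this
    have htot := (((hsum 0).mul_left 3).add ((hsum t).mul_left 4)).add (hsum (2 * t))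
    have h4 := Complex.hasSum_re htot
    have h5 := h4.nonneg fun n => by
      rcases eq_or_ne n 0 with rfl | hn
      · simp
      have hn0 : (n : ℂ) ≠ 0 := by exact_mod_cast hn
      have hnpos : 0 < n := Nat.pos_of_ne_zero hn
      rw [LSeries.term_of_ne_zero hn, LSeries.term_of_ne_zero hn, LSeries.term_of_ne_zero hn,
        Complex.cpow_add _ _ hn0, Complex.cpow_add _ _ hn0, Complex.cpow_add _ _ hn0]
      have hw2 : (n : ℂ) ^ (((2 * t : ℝ) : ℂ) * Complex.I) = ((n : ℂ) ^ (t * Complex.I)) ^ 2 := by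
        rw [← Complex.cpow_nat_mul]
        push_cast
        ring_nf
      rw [hw2, Complex.ofReal_zero, zero_mul, Complex.cpow_zero, mul_one]
      have hnorm : ‖(n : ℂ) ^ (t * Complex.I)‖ = 1 := by
        rw [Complex.norm_natCast_cpow_of_pos hnpos]
        simp
      obtain ⟨w, hw⟩ : ∃ w : ℂ, w = ((n : ℂ) ^ (t * Complex.I))⁻¹ := ⟨_, rfl⟩
      have hwn : ‖w‖ = 1 := by rw [hw, norm_inv, hnorm, inv_one]
      have hσc : Λ n / (n : ℂ) ^ (σ : ℂ) =
          ((ArithmeticFunction.vonMangoldt n / (n : ℝ) ^ σ : ℝ) : ℂ) := by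
        simp only [Λ]
        rw [Complex.ofReal_div, Complex.ofReal_cpow n.cast_nonneg]
        simp
      have hcomb : 3 * (Λ n / (n : ℂ) ^ (σ : ℂ)) +
          4 * (Λ n / ((n : ℂ) ^ (σ : ℂ) * (n : ℂ) ^ (t * Complex.I))) +
          Λ n / ((n : ℂ) ^ (σ : ℂ) * ((n : ℂ) ^ (t * Complex.I)) ^ 2) =
          ((ArithmeticFunction.vonMangoldt n / (n : ℝ) ^ σ : ℝ) : ℂ) * (3 + 4 * w + w ^ 2) := by
        rw [← hσc, hw, ← div_div, ← div_div]
        simp only [div_eq_mul_inv, inv_pow]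
        ring
      rw [hcomb, Complex.re_ofReal_mul]
      apply mul_nonneg (div_nonneg ArithmeticFunction.vonMangoldt_nonneg (by positivity))
      have hsq := Complex.sq_norm w
      rw [hwn, Complex.normSq_apply] at hsq
      simp [pow_two]
      nlinarith [sq_nonneg (1 + w.re)]
    have h6 : 3 * -L 0 σ + 4 * -L t σ + -L (2 * t) σ = -(3 * L 0 σ + 4 * L t σ + L (2 * t) σ) := by
      ring
    rw [h6, Complex.neg_re] at h5
    linarith
  let Φ : ℝ → ℂ := fun σ => riemannZeta (σ + (0 : ℝ) * Complex.I) ^ 3 *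
    riemannZeta (σ + t * Complex.I) ^ 4 * riemannZeta (σ + (2 * t : ℝ) * Complex.I)
  have hΦ : ∀ σ : ℝ, 1 < σ →
      HasDerivAt Φ (Φ σ * (3 * L 0 σ + 4 * L t σ + L (2 * t) σ)) σ := by
    intro σ hσ
    have := (((hder 0 σ hσ).fun_pow 3).fun_mul ((hder t σ hσ).fun_pow 4)).fun_mul
      (hder (2 * t) σ hσ)
    refine this.congr_deriv ?_
    simp only [Φ]
    push_cast
    ring
  have hanti : AntitoneOn (fun σ => ‖Φ σ‖ ^ 2) (Set.Ioi 1) := by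
    have hd : ∀ σ ∈ Set.Ioi (1 : ℝ), HasDerivAt (fun σ => ‖Φ σ‖ ^ 2)
        (2 * inner ℝ (Φ σ) (Φ σ * (3 * L 0 σ + 4 * L t σ + L (2 * t) σ))) σ :=
      fun σ hσ => (hΦ σ hσ).norm_sq
    apply antitoneOn_of_deriv_nonpos (convex_Ioi 1)
    · exact fun σ hσ => (hd σ hσ).continuousAt.continuousWithinAt
    · rw [interior_Ioi]
      exact fun σ hσ => (hd σ hσ).differentiableAt.differentiableWithinAt
    · rw [interior_Ioi]
      intro σ hσ
      rw [(hd σ hσ).deriv]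
      have h7 := hneg σ hσ
      have h8 : inner ℝ (Φ σ) (Φ σ * (3 * L 0 σ + 4 * L t σ + L (2 * t) σ)) =
          ‖Φ σ‖ ^ 2 * (3 * L 0 σ + 4 * L t σ + L (2 * t) σ).re := by
        rw [Complex.inner, Complex.sq_norm]
        set z := 3 * L 0 σ + 4 * L t σ + L (2 * t) σ
        simp [Complex.normSq_apply]
        ring
      rw [h8]
      nlinarith [mul_nonneg (sq_nonneg ‖Φ σ‖) (neg_nonneg.2 h7)]
  have hfin := hanti (Set.mem_Ioi.2 h1) (Set.mem_Ioi.2 (h1.trans_le h12)) h12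
  have hfin2 := (pow_le_pow_iff_left₀ (norm_nonneg _) (norm_nonneg _) two_ne_zero).1 hfin
  simpa [Φ, norm_mul, norm_pow] using hfin2

/-- In a small box around `1 + i t` the zeta function is controlled by one value to the right. -/
theorem norm_riemannZeta_le_box {A : ℝ} (hA : 1 ≤ A) (hlog : ∀ s : ℂ, 1 < s.re → s.re ≤ 2 →
    ‖deriv riemannZeta s‖ ≤ A / (s.re - 1) * ‖riemannZeta s‖) {r B x₀ t : ℝ} (hr : 0 < r)
    (hr2 : r ≤ 1 / 2) (hB : 2 ≤ B) (hx₀ : x₀ * (2 * B) = r) (ht : 2 ≤ t)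
    (hinv : 3 / x₀ ≤ Real.exp B)
    (hbd : ∀ s : ℂ, 1 - r ≤ s.re → s.re ≤ 2 → |s.im - t| ≤ 2 → ‖riemannZeta s‖ ≤ Real.exp B)
    {s : ℂ} (hs1 : |s.re - 1| ≤ x₀) (hs2 : |s.im - t| ≤ x₀) :
    ‖riemannZeta s‖ ≤ Real.exp (4 + 3 * A) * ‖riemannZeta ((1 + x₀ : ℝ) + t * Complex.I)‖ := by
  have hx0 : 0 < x₀ := by
    by_contra! h
    nlinarith
  have hx0r : 4 * x₀ ≤ r := by nlinarith
  rw [abs_le] at hs1 hs2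
  set x := 1 + x₀ - s.re with hx
  have hseq : s = ((1 + x₀ - x : ℝ) : ℂ) + (s.im : ℂ) * Complex.I := by
    apply Complex.ext <;> simp [hx]
  have h1 := norm_riemannZeta_reflect_le (r := r) (B := B) (x₀ := x₀) (u := s.im) (x := x) hr hr2
    (by linarith) hx0 (by linarith) (by linarith) hinv (fun z h1 h2 h3 => hbd z h1 h2 (by
      rw [abs_le] at h3 ⊢
      constructor <;> linarith)) (by linarith) (by linarith)
  rw [← hseq] at h1
  have h2 := norm_riemannZeta_le_of_near hA hlog (D := 3) hx0
    (s₁ := (1 + x₀ : ℝ) + t * Complex.I) (s₂ := (1 + x₀ + x : ℝ) + s.im * Complex.I)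
    (by simp) (by simp; linarith) (by simp; linarith) (by simp; linarith) (by
      refine (Complex.norm_le_abs_re_add_abs_im _).trans ?_
      have e1 : (((1 + x₀ + x : ℝ) : ℂ) + s.im * Complex.I -
        ((1 + x₀ : ℝ) + t * Complex.I)).re = x := by simp
      have e2 : (((1 + x₀ + x : ℝ) : ℂ) + s.im * Complex.I -
        ((1 + x₀ : ℝ) + t * Complex.I)).im = s.im - t := by simp
      rw [e1, e2, abs_of_nonneg (by linarith)]
      have : |s.im - t| ≤ x₀ := abs_le.2 hs2
      linarith)
  have h3 : 4 * B * x / r ≤ 4 := by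
    rw [div_le_iff₀ hr]
    nlinarith
  calc _ ≤ _ := h1
    _ ≤ Real.exp 4 * (Real.exp (A * 3) *
        ‖riemannZeta ((1 + x₀ : ℝ) + t * Complex.I)‖) := by gcongr
    _ = _ := by rw [← mul_assoc, ← Real.exp_add, mul_comm A]

/-- An upper bound for the zeta function to the left of the line `re s = 1` yields a zero-free
region together with a lower bound in it. -/
theorem exists_le_norm_riemannZeta : ∃ κ : ℝ, 0 < κ ∧ κ ≤ 1 ∧ ∀ r B t : ℝ, 0 < r → r ≤ 1 / 2 →
    2 ≤ B → 2 ≤ t → 6 * B / r ≤ Real.exp B →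
    (∀ s : ℂ, 1 - r ≤ s.re → s.re ≤ 2 → t - 2 ≤ s.im → s.im ≤ 2 * t + 2 →
      ‖riemannZeta s‖ ≤ Real.exp B) →
    ∀ σ : ℝ, 1 - κ * (r / B) ≤ σ → σ ≤ 2 →
      κ * (r / B) ≤ ‖riemannZeta (σ + t * Complex.I)‖ := by
  obtain ⟨A, hA, hlog⟩ := exists_norm_deriv_riemannZeta_le
  obtain ⟨C₃, hC₃⟩ : ∃ C₃, C₃ = Real.exp (4 + 3 * A) := ⟨_, rfl⟩
  have hC1 : 1 ≤ C₃ := by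
    rw [hC₃]
    exact Real.one_le_exp (by linarith)
  obtain ⟨c, hc⟩ : ∃ c : ℝ, c = (27 * C₃)⁻¹ ^ (1 / 4 : ℝ) := ⟨_, rfl⟩
  have hcpos : 0 < c := by rw [hc]; positivity
  have hc4 : c ^ 4 * (27 * C₃) = 1 := by
    rw [hc, ← Real.rpow_natCast, ← Real.rpow_mul (by positivity)]
    norm_num
    field_simp
  have hc1 : c ≤ 1 := by
    by_contra! h
    have : 1 < c ^ 4 := one_lt_pow₀ h (by norm_num)
    nlinarith
  obtain ⟨ε, hε⟩ : ∃ ε : ℝ, ε = c / (8 * C₃) := ⟨_, rfl⟩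
  have hεpos : 0 < ε := by rw [hε]; positivity
  have hcε : c = 8 * C₃ * ε := by rw [hε]; field_simp
  have hε1 : ε ≤ 1 / 8 := by nlinarith
  have hε4 : ε ^ 4 ≤ 1 / 2 := by
    calc ε ^ 4 ≤ (1 / 8) ^ 4 := by gcongr
      _ ≤ _ := by norm_num
  refine ⟨ε ^ 4 / 6, by positivity, by linarith, ?_⟩
  intro r B t hr hr2 hB ht hinv hbd σ hσ hσ2
  obtain ⟨x₀, hx₀⟩ : ∃ x₀, x₀ = r / (2 * B) := ⟨_, rfl⟩
  have hx0 : 0 < x₀ := by rw [hx₀]; positivity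
  have hx₀B : x₀ * (2 * B) = r := by rw [hx₀]; field_simp
  have hrB : r / B = 2 * x₀ := by rw [hx₀]; field_simp
  have hx1 : x₀ ≤ 1 / 8 := by nlinarith
  have hinv' : 3 / x₀ ≤ Real.exp B := by
    refine le_trans (le_of_eq ?_) hinv
    rw [← hx₀B]
    field_simp
    norm_num
  rw [hrB] at hσ ⊢
  obtain ⟨η, hη⟩ : ∃ η, η = ε ^ 4 * x₀ := ⟨_, rfl⟩
  have hη0 : 0 < η := by rw [hη]; positivity
  have hηx : η ≤ x₀ / 2 := by rw [hη]; nlinarith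
  have e1 : ε ^ 4 / 6 * (2 * x₀) = η / 3 := by rw [hη]; ring
  rw [e1] at hσ ⊢
  have hre : ∀ u σ : ℝ, ((σ : ℂ) + u * Complex.I).re = σ := by intros; simp
  have him : ∀ u σ : ℝ, ((σ : ℂ) + u * Complex.I).im = u := by intros; simp
  rcases le_total (1 + η) σ with hcase | hcase
  · have := inv_le_norm_riemannZeta (s := σ + t * Complex.I) (by rw [hre]; linarith)
      (by rw [hre]; linarith)
    rw [hre] at this
    linarith
  have hbox : ∀ s : ℂ, |s.re - 1| ≤ x₀ → |s.im - t| ≤ x₀ →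
      ‖riemannZeta s‖ ≤ C₃ * ‖riemannZeta ((1 + x₀ : ℝ) + t * Complex.I)‖ := fun s h1 h2 => by
    rw [hC₃]
    refine norm_riemannZeta_le_box hA hlog hr hr2 hB hx₀B ht hinv' (fun z h3 h4 h5 => ?_) h1 h2
    rw [abs_le] at h5
    exact hbd z h3 h4 (by linarith) (by linarith)
  have hbox2 : ∀ s : ℂ, |s.re - 1| ≤ x₀ → |s.im - 2 * t| ≤ x₀ →
      ‖riemannZeta s‖ ≤ C₃ * ‖riemannZeta ((1 + x₀ : ℝ) + (2 * t : ℝ) * Complex.I)‖ :=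
      fun s h1 h2 => by
    rw [hC₃]
    refine norm_riemannZeta_le_box hA hlog hr hr2 hB hx₀B (by linarith) hinv'
      (fun z h3 h4 h5 => ?_) h1 h2
    rw [abs_le] at h5
    exact hbd z h3 h4 (by linarith) (by linarith)
  set Z := ‖riemannZeta ((1 + x₀ : ℝ) + t * Complex.I)‖ with hZ
  set W := ‖riemannZeta ((1 + x₀ : ℝ) + (2 * t : ℝ) * Complex.I)‖ with hW
  have hZlow : x₀ / 3 ≤ Z := by
    have := inv_le_norm_riemannZeta (s := (1 + x₀ : ℝ) + t * Complex.I) (by rw [hre]; linarith)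
      (by rw [hre]; linarith)
    rw [hre] at this
    linarith
  have hWpos : 0 < W := norm_pos_iff.2 (riemannZeta_ne_zero_of_one_lt_re (by
    rw [hre]
    linarith))
  have hηval : c * ε ^ 3 * Z ≤ ‖riemannZeta ((1 + η : ℝ) + t * Complex.I)‖ := by
    set V := ‖riemannZeta ((1 + η : ℝ) + t * Complex.I)‖ with hV
    have h1 := norm_riemannZeta_product_antitone (t := t) (σ₁ := 1 + η) (σ₂ := 1 + x₀)
      (by linarith) (by linarith)
    have h2 : ‖riemannZeta ((1 + η : ℝ) + (2 * t : ℝ) * Complex.I)‖ ≤ C₃ * W :=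
      hbox2 _ (by rw [hre, add_sub_cancel_left, abs_of_pos hη0]; linarith)
        (by rw [him, sub_self, abs_zero]; exact hx0.le)
    have h3 := norm_riemannZeta_ofReal_le (σ := 1 + η) (by linarith) (by linarith)
    have h4 := le_norm_riemannZeta_ofReal (σ := 1 + x₀) (by linarith)
    rw [add_sub_cancel_left] at h3 h4
    have h5 : (1 / x₀) ^ 3 * Z ^ 4 * W ≤ (3 / η) ^ 3 * V ^ 4 * (C₃ * W) := by
      calc _ ≤ ‖riemannZeta ((1 + x₀ : ℝ) : ℂ)‖ ^ 3 * Z ^ 4 * W := by gcongr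
        _ ≤ _ := h1
        _ ≤ _ := by gcongr
    have h6 : (1 / x₀) ^ 3 * Z ^ 4 ≤ (3 / η) ^ 3 * V ^ 4 * C₃ := by
      rw [← mul_assoc] at h5
      exact le_of_mul_le_mul_right h5 hWpos
    have h7 : (c * ε ^ 3 * Z) ^ 4 ≤ V ^ 4 := by
      have e2 : (3 / η) ^ 3 = 27 / (ε ^ 12 * x₀ ^ 3) := by
        rw [hη]
        field_simp
        norm_num
      rw [e2] at h6
      have e3 : (1 / x₀) ^ 3 * Z ^ 4 = Z ^ 4 / x₀ ^ 3 := by ring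
      have e4 : 27 / (ε ^ 12 * x₀ ^ 3) * V ^ 4 * C₃ = (27 * C₃ * V ^ 4 / ε ^ 12) / x₀ ^ 3 := by
        field_simp
      rw [e3, e4, div_le_div_iff_of_pos_right (by positivity), le_div_iff₀ (by positivity)] at h6
      calc (c * ε ^ 3 * Z) ^ 4 = c ^ 4 * (Z ^ 4 * ε ^ 12) := by ring
        _ ≤ c ^ 4 * (27 * C₃ * V ^ 4) := by gcongr
        _ = c ^ 4 * (27 * C₃) * V ^ 4 := by ring
        _ = V ^ 4 := by rw [hc4, one_mul]
    exact (pow_le_pow_iff_left₀ (by positivity) (norm_nonneg _) (by norm_num)).1 h7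
  have hderiv : ∀ s : ℂ, |s.re - 1| ≤ x₀ / 2 → s.im = t →
      ‖deriv riemannZeta s‖ ≤ 2 * C₃ * Z / x₀ := by
    intro s h1 h2
    rw [abs_le] at h1
    have hball : ∀ z ∈ Metric.closedBall s (x₀ / 2), |z.re - 1| ≤ x₀ ∧ |z.im - t| ≤ x₀ := by
      intro z hz
      rw [mem_closedBall_iff_norm] at hz
      have a1 := abs_le.1 ((Complex.abs_re_le_norm _).trans hz)
      have a2 := abs_le.1 ((Complex.abs_im_le_norm _).trans hz)
      rw [Complex.sub_re] at a1
      rw [Complex.sub_im, h2] at a2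
      constructor <;> rw [abs_le] <;> constructor <;> linarith
    have h3 := Complex.norm_deriv_le_of_forall_mem_sphere_norm_le (c := s) (R := x₀ / 2)
      (C := C₃ * Z) (f := riemannZeta) (by positivity) (by
        apply DifferentiableOn.diffContOnCl
        intro z hz
        have hz2 := hball z (Metric.closure_ball_subset_closedBall hz)
        refine (differentiableAt_riemannZeta fun h => ?_).differentiableWithinAt
        have hz3 := abs_le.1 hz2.2
        rw [h, Complex.one_im] at hz3
        linarith [hz3.1]) (fun z hz => by
        obtain ⟨b1, b2⟩ := hball z (Metric.sphere_subset_closedBall hz)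
        exact hbox z b1 b2)
    refine h3.trans (le_of_eq ?_)
    field_simp
  have hlip : ‖riemannZeta (σ + t * Complex.I) - riemannZeta ((1 + η : ℝ) + t * Complex.I)‖ ≤
      2 * C₃ * Z / x₀ * (2 * η) := by
    let S : Set ℂ := {s | 1 - x₀ / 2 ≤ s.re ∧ s.re ≤ 1 + x₀ / 2} ∩ {s | s.im = t}
    have hS : Convex ℝ S := by
      refine Convex.inter ?_ (convex_hyperplane Complex.imLm.isLinear t)
      exact (convex_halfSpace_ge Complex.reLm.isLinear _).inter
        (convex_halfSpace_le Complex.reLm.isLinear _)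
    have hmem : ∀ y : ℝ, 1 - η ≤ y → y ≤ 1 + η → ((y : ℂ) + t * Complex.I) ∈ S := by
      intro y h1 h2
      refine ⟨?_, him t y⟩
      rw [Set.mem_ofPred_eq, hre]
      constructor <;> linarith
    have h1 := hS.norm_image_sub_le_of_norm_deriv_le (𝕜 := ℂ) (f := riemannZeta)
      (C := 2 * C₃ * Z / x₀) (fun s hs => differentiableAt_riemannZeta fun h => by
        have := hs.2
        rw [Set.mem_ofPred_eq, h, Complex.one_im] at this
        linarith) (fun s hs => hderiv s (by
          obtain ⟨⟨a, b⟩, _⟩ := hs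
          rw [abs_le]
          constructor <;> linarith) hs.2)
      (hmem (1 + η) (by linarith) le_rfl) (hmem σ (by linarith) hcase)
    refine h1.trans ?_
    gcongr
    have e5 : (σ : ℂ) + t * Complex.I - ((1 + η : ℝ) + t * Complex.I) =
        ((σ - (1 + η) : ℝ) : ℂ) := by
      push_cast
      ring
    rw [e5, Complex.norm_real, Real.norm_eq_abs, abs_le]
    constructor <;> linarith
  have hfin := norm_le_norm_add_norm_sub (riemannZeta (σ + t * Complex.I))
    (riemannZeta ((1 + η : ℝ) + t * Complex.I))
  have e6 : 2 * C₃ * Z / x₀ * (2 * η) = 4 * C₃ * ε ^ 4 * Z := by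
    rw [hη]
    field_simp
    ring
  have e7 : c * ε ^ 3 * Z = 8 * C₃ * ε ^ 4 * Z := by
    rw [hcε]
    ring
  have h8 : η / 3 ≤ 4 * C₃ * ε ^ 4 * Z := by
    calc η / 3 = 1 * ε ^ 4 * (x₀ / 3) := by rw [hη]; ring
      _ ≤ 4 * C₃ * ε ^ 4 * Z := by
          gcongr
          linarith
  linarith

theorem riemannZeta₁_ne_zero_of_one_le_re {s : ℂ} (hs : 1 ≤ s.re) : riemannZeta₁ s ≠ 0 := by
  rcases eq_or_ne s 1 with rfl | h1
  · simp [riemannZeta₁_one]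
  · have := riemannZeta_ne_zero_of_one_le_re hs
    rw [riemannZeta_eq_inv_sub_mul h1] at this
    exact right_ne_zero_of_mul this

/-- The reciprocal of the zeta function is bounded near any bounded piece of `1 ≤ re s ≤ 2`. -/
theorem exists_norm_div_riemannZeta₁_le (t₀ : ℝ) : ∃ κ C : ℝ, 0 < κ ∧ ∀ s : ℂ, 1 - κ ≤ s.re →
    s.re ≤ 2 → |s.im| ≤ t₀ → riemannZeta₁ s ≠ 0 ∧ ‖(s - 1) / riemannZeta₁ s‖ ≤ C := by
  let K : Set ℂ := Set.Icc 1 2 ×ℂ Set.Icc (-t₀) t₀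
  have hK : IsCompact K := isCompact_Icc.reProdIm isCompact_Icc
  have hopen : IsOpen {s : ℂ | riemannZeta₁ s ≠ 0} :=
    isOpen_ne_fun differentiable_riemannZeta₁.continuous continuous_const
  obtain ⟨κ, hκ, hsub⟩ := hK.exists_cthickening_subset_open hopen (fun s hs =>
    riemannZeta₁_ne_zero_of_one_le_re hs.1.1)
  obtain ⟨C, hC⟩ := hK.cthickening (r := κ) |>.exists_bound_of_continuousOn
    (f := fun s => (s - 1) / riemannZeta₁ s) (ContinuousOn.div (by fun_prop)
      differentiable_riemannZeta₁.continuous.continuousOn fun s hs => hsub hs)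
  refine ⟨κ, C, hκ, fun s h1 h2 h3 => ?_⟩
  have hmem : s ∈ Metric.cthickening κ K := by
    refine Metric.mem_cthickening_of_dist_le s (max s.re 1 + s.im * Complex.I) κ K ?_ ?_
    · rw [Complex.mem_reProdIm]
      simp only [Complex.add_re, Complex.add_im, Complex.mul_re, Complex.mul_im, Complex.I_re,
        Complex.I_im, Complex.ofReal_re, Complex.ofReal_im]
      refine ⟨⟨?_, ?_⟩, ?_⟩
      · simp
      · simpa using h2
      · simpa [abs_le] using h3
    · rw [dist_eq_norm]
      have e1 : s - (max s.re 1 + s.im * Complex.I) = ((s.re - max s.re 1 : ℝ) : ℂ) := by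
        apply Complex.ext <;> simp
      rw [e1, Complex.norm_real, Real.norm_eq_abs, abs_le]
      rcases max_cases s.re 1 with ⟨h, _⟩ | ⟨h, _⟩ <;> rw [h] <;> constructor <;> linarith
  exact ⟨hsub hmem, hC s hmem⟩

/-- A version of the bound for the zeta function that is uniform up to a given height. -/
theorem norm_riemannZeta_le_cube {T q σ u : ℝ} (hu : 0 < u) (hu5 : 100000 ≤ Real.log u)
    (huT : Real.log u ≤ T) (hq0 : 0 ≤ q) (hq : q ^ 3 * T = Real.log T)
    (hσ : 1 - 0.00000001 * q ^ 2 ≤ σ) (hσ2 : σ ≤ 2) :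
    ‖riemannZeta (σ + u * Complex.I)‖ ≤ T ^ 3 := by
  set l := Real.log u with hl
  have hlpos : 0 < l := by linarith
  have hTpos : 0 < T := by linarith
  have hexp : Real.exp 1 ≤ l := by
    have := Real.exp_one_lt_d9
    linarith
  have hll : 0 ≤ Real.log l := Real.log_nonneg (by linarith)
  obtain ⟨p, hp⟩ : ∃ p : ℝ, p = (Real.log l / l) ^ (1 / 3 : ℝ) := ⟨_, rfl⟩
  have hp0 : 0 ≤ p := by rw [hp]; positivity
  have hp3 : p ^ 3 = Real.log l / l := by
    rw [hp, ← Real.rpow_natCast, ← Real.rpow_mul (by positivity)]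
    norm_num
  have hqp : q ≤ p := by
    have h1 : q ^ 3 ≤ p ^ 3 := by
      rw [hp3]
      have : q ^ 3 = Real.log T / T := by rw [← hq]; field_simp
      rw [this]
      exact Real.log_div_self_antitoneOn hexp (hexp.trans huT) huT
    exact (pow_le_pow_iff_left₀ hq0 hp0 (by norm_num)).1 h1
  have h1 := norm_riemannZeta_le_log_cube (σ := σ) (t := u) (q := p) hu hu5 hp0
    (by rw [hp3, ← hl]; field_simp) (by
      have : q ^ 2 ≤ p ^ 2 := by gcongr
      norm_num at hσ ⊢
      linarith) hσ2
  refine h1.trans ?_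
  rw [← hl]
  gcongr

/-- The Vinogradov–Korobov zero-free region, with a bound for the reciprocal of the zeta
function. -/
theorem exists_norm_div_riemannZeta₁_le_cube : ∃ κ T₀ : ℝ, 0 < κ ∧ 1 ≤ T₀ ∧ ∀ T δ : ℝ, T₀ ≤ T →
    0 < δ → δ ^ 3 * (T ^ 2 * Real.log T) = 1 → ∀ s : ℂ, |s.im| ≤ Real.exp T / 4 →
    1 - κ * δ ≤ s.re → s.re ≤ 2 →
    riemannZeta₁ s ≠ 0 ∧ ‖(s - 1) / riemannZeta₁ s‖ ≤ T ^ 3 := by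
  obtain ⟨κ₁, hκ₁, hκ₁1, hmain⟩ := exists_le_norm_riemannZeta
  obtain ⟨κ₂, C, hκ₂, hlow⟩ := exists_norm_div_riemannZeta₁_le (Real.exp 100000 + 2)
  obtain ⟨κ₃, hκ₃⟩ : ∃ κ₃, κ₃ = κ₁ * (0.00000001 / 3) := ⟨_, rfl⟩
  have hκ₃0 : 0 < κ₃ := by rw [hκ₃]; positivity
  refine ⟨min κ₂ κ₃, max (max 10000000000 C) (1 / κ₃), by positivity,
    le_max_of_le_left (le_max_of_le_left (by norm_num)), ?_⟩
  intro T δ hT hδ hδT s him hre hre2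
  have hT10 : 10000000000 ≤ T := (le_max_left _ _).trans ((le_max_left _ _).trans hT)
  have hTC : C ≤ T := (le_max_right _ _).trans ((le_max_left _ _).trans hT)
  have hTκ : 1 / κ₃ ≤ T := (le_max_right _ _).trans hT
  have hT0 : 1 ≤ T := by linarith
  have hTpos : 0 < T := by linarith
  have hTT : T ≤ T ^ 3 := by
    have : 1 ≤ T ^ 2 := one_le_pow₀ hT0
    nlinarith
  have hlog1 : 1 ≤ Real.log T := by
    rw [Real.le_log_iff_exp_le hTpos]
    have := Real.exp_one_lt_d9
    norm_num at hT10 this ⊢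
    linarith
  have hlogT : Real.log T ≤ T := (Real.log_le_sub_one_of_pos hTpos).trans (by linarith)
  have hδ1 : δ ≤ 1 := by
    by_contra! h
    have h1 : 1 < δ ^ 3 := one_lt_pow₀ h (by norm_num)
    have h2 : 1 ≤ T ^ 2 * Real.log T := one_le_mul_of_one_le_of_one_le (one_le_pow₀ hT0) hlog1
    nlinarith
  rcases le_total |s.im| (Real.exp 100000 + 2) with hcase | hcase
  · obtain ⟨h1, h2⟩ := hlow s (by
      have : min κ₂ κ₃ * δ ≤ κ₂ * 1 := by
        gcongr
        exact min_le_left _ _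
      linarith) hre2 hcase
    exact ⟨h1, h2.trans (hTC.trans hTT)⟩
  have hexp5 : (0 : ℝ) < Real.exp 100000 := Real.exp_pos _
  obtain ⟨q, hq⟩ : ∃ q, q = Real.sqrt (δ * Real.log T) := ⟨_, rfl⟩
  have hq0 : 0 ≤ q := by rw [hq]; positivity
  have hq2 : q ^ 2 = δ * Real.log T := by rw [hq, Real.sq_sqrt (by positivity)]
  have hq3 : q ^ 3 * T = Real.log T := by
    have : (q ^ 3 * T) ^ 2 = Real.log T ^ 2 := by
      calc (q ^ 3 * T) ^ 2 = (q ^ 2) ^ 3 * T ^ 2 := by ring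
        _ = δ ^ 3 * (T ^ 2 * Real.log T) * Real.log T ^ 2 := by rw [hq2]; ring
        _ = _ := by rw [hδT, one_mul]
    exact (pow_left_inj₀ (by positivity) (by positivity) two_ne_zero).1 this
  have hq1 : q ≤ 1 := by
    by_contra! h
    have : 1 < q ^ 3 := one_lt_pow₀ h (by norm_num)
    nlinarith
  have hqT : 1 ≤ q ^ 2 * T := by
    have : q ^ 3 ≤ q ^ 2 := pow_le_pow_of_le_one hq0 hq1 (by norm_num)
    nlinarith
  have hqpos : 0 < q ^ 2 := by rw [hq2]; positivity
  have hq21 : q ^ 2 ≤ 1 := pow_le_one₀ hq0 hq1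
  obtain ⟨r, hr⟩ : ∃ r, r = 0.00000001 * q ^ 2 := ⟨_, rfl⟩
  have hrpos : 0 < r := by rw [hr]; positivity
  have hexpB : Real.exp (3 * Real.log T) = T ^ 3 := by
    rw [mul_comm, Real.exp_mul, Real.exp_log hTpos]
    norm_cast
  have hrB : κ₁ * (r / (3 * Real.log T)) = κ₃ * δ := by
    rw [hr, hκ₃, hq2]
    field_simp
  have hkey := hmain r (3 * Real.log T) |s.im| hrpos
    (by rw [hr]; norm_num; linarith) (by linarith) (by linarith) (by
      rw [hexpB, div_le_iff₀ hrpos, hr]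
      have h1 : 1800000000 * T ≤ T ^ 2 := by nlinarith
      calc 6 * (3 * Real.log T) ≤ 18 * T * 1 := by linarith
        _ ≤ 18 * T * (q ^ 2 * T) := by gcongr
        _ = 1800000000 * T * T * (0.00000001 * q ^ 2) := by norm_num; ring
        _ ≤ T ^ 2 * T * (0.00000001 * q ^ 2) := by gcongr
        _ = _ := by ring)
    (fun z h1 h2 h3 h4 => by
      have hz : z = ((z.re : ℝ) : ℂ) + (z.im : ℝ) * Complex.I := (Complex.re_add_im z).symm
      have hz5 : Real.exp 100000 ≤ z.im := by linarith
      have hzpos : 0 < z.im := by linarith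
      rw [hexpB, hz]
      refine norm_riemannZeta_le_cube hzpos ((Real.le_log_iff_exp_le hzpos).2 hz5)
        ((Real.log_le_iff_le_exp hzpos).2 ?_) hq0 hq3 (by rw [← hr]; exact h1) h2
      linarith) s.re (by
        rw [hrB]
        have : min κ₂ κ₃ * δ ≤ κ₃ * δ := by
          gcongr
          exact min_le_right _ _
        linarith) hre2
  rw [hrB] at hkey
  have hnorm : ‖riemannZeta (s.re + (|s.im| : ℝ) * Complex.I)‖ = ‖riemannZeta s‖ := by
    rcases abs_cases s.im with ⟨h, _⟩ | ⟨h, _⟩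
    · rw [h, Complex.re_add_im]
    · have e1 : (s.re : ℂ) + (|s.im| : ℝ) * Complex.I = (starRingEnd ℂ) s := by
        rw [h]
        apply Complex.ext <;> simp
      rw [e1, riemannZeta_conj, Complex.norm_conj]
  rw [hnorm] at hkey
  have hs1 : s ≠ 1 := fun h => by
    rw [h, Complex.one_im, abs_zero] at hcase
    linarith
  have hpos : 0 < ‖riemannZeta s‖ := lt_of_lt_of_le (by positivity) hkey
  have hζ : riemannZeta s ≠ 0 := norm_pos_iff.1 hpos
  have heq := riemannZeta_eq_inv_sub_mul hs1
  have hζ1 : riemannZeta₁ s ≠ 0 := right_ne_zero_of_mul (heq ▸ hζ)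
  refine ⟨hζ1, ?_⟩
  have hinv : (s - 1) / riemannZeta₁ s = (riemannZeta s)⁻¹ := by
    rw [heq, mul_inv, inv_inv, div_eq_mul_inv]
  rw [hinv, norm_inv]
  apply inv_le_of_inv_le₀ (by positivity)
  refine le_trans ?_ hkey
  have h1 : 1 ≤ κ₃ * T := by
    rw [div_le_iff₀ hκ₃0] at hTκ
    linarith
  have h2 : 1 ≤ δ * T ^ 2 := by
    calc 1 ≤ q ^ 2 * T := hqT
      _ = δ * Real.log T * T := by rw [hq2]
      _ ≤ δ * T * T := by gcongr
      _ = _ := by ring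
  rw [inv_le_iff_one_le_mul₀ (by positivity)]
  calc (1 : ℝ) = 1 * 1 := by ring
    _ ≤ (κ₃ * T) * (δ * T ^ 2) := by gcongr
    _ = _ := by ring

/-! ### Sums of the Möbius function -/

theorem norm_inv_mul_add_one_le {s : ℂ} (hs : 1 / 2 ≤ s.re) :
    ‖(s * (s + 1))⁻¹‖ ≤ 2 * (1 + s.im ^ 2)⁻¹ := by
  have h1 : 0 < 1 + s.im ^ 2 := by positivity
  have h2 : ((1 + s.im ^ 2) / 2) ^ 2 ≤ ‖s * (s + 1)‖ ^ 2 := by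
    rw [norm_mul, mul_pow, Complex.sq_norm, Complex.sq_norm, Complex.normSq_apply,
      Complex.normSq_apply]
    simp only [Complex.add_re, Complex.add_im, Complex.one_re, Complex.one_im, add_zero]
    have a : (1 + s.im ^ 2) / 4 ≤ s.re * s.re + s.im * s.im := by nlinarith
    have b : 1 + s.im ^ 2 ≤ (s.re + 1) * (s.re + 1) + s.im * s.im := by nlinarith
    calc ((1 + s.im ^ 2) / 2) ^ 2 = (1 + s.im ^ 2) / 4 * (1 + s.im ^ 2) := by ring
      _ ≤ _ := mul_le_mul a b h1.le (by linarith)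
  have h3 := (pow_le_pow_iff_left₀ (by positivity) (norm_nonneg _) two_ne_zero).1 h2
  rw [norm_inv]
  calc (‖s * (s + 1)‖)⁻¹ ≤ ((1 + s.im ^ 2) / 2)⁻¹ := inv_anti₀ (by positivity) h3
    _ = _ := by rw [inv_div]; ring

theorem integrable_inv_mul_add_one {σ : ℝ} (hσ : 1 / 2 ≤ σ) :
    MeasureTheory.Integrable
      (fun y : ℝ => (((σ : ℂ) + y * Complex.I) * (σ + y * Complex.I + 1))⁻¹) := by
  refine MeasureTheory.Integrable.mono' (integrable_inv_one_add_sq.const_mul 2) ?_ ?_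
  · apply Continuous.aestronglyMeasurable
    refine Continuous.inv₀ (by fun_prop) fun y h => ?_
    have h1 : ((σ : ℂ) + y * Complex.I).re = σ := by simp
    rcases mul_eq_zero.1 h with h | h <;> replace h := congrArg Complex.re h <;>
      simp at h <;> linarith
  · filter_upwards with y
    have := norm_inv_mul_add_one_le (s := (σ : ℂ) + y * Complex.I) (by simpa using hσ)
    simpa using this

/-- The function `u ↦ max (1 - u) 0` on the positive half line, in a form adapted to Mellin
transforms. -/
noncomputable def tent (u : ℝ) : ℂ :=
  (Set.Ioc (0 : ℝ) 1).indicator (fun _ => (1 : ℂ)) u -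
    (Set.Ioc (0 : ℝ) 1).indicator (fun t => (t : ℂ) ^ (1 : ℂ)) u

theorem tent_eq {u : ℝ} (hu : 0 < u) : tent u = ((max (1 - u) 0 : ℝ) : ℂ) := by
  rw [tent]
  by_cases h : u ≤ 1
  · have hm : u ∈ Set.Ioc (0 : ℝ) 1 := ⟨hu, h⟩
    rw [Set.indicator_of_mem hm, Set.indicator_of_mem hm, max_eq_left (by linarith)]
    simp
  · rw [Set.indicator_of_notMem fun h' => h h'.2, Set.indicator_of_notMem fun h' => h h'.2,
      max_eq_right (by linarith)]
    simp

theorem hasMellin_tent {s : ℂ} (hs : 0 < s.re) : HasMellin tent s (s * (s + 1))⁻¹ := by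
  have h1 := hasMellin_one_Ioc hs
  have h2 := hasMellin_cpow_Ioc 1 (s := s) (by rw [Complex.one_re]; linarith)
  have h3 := hasMellin_sub h1.1 h2.1
  rw [h1.2, h2.2] at h3
  have e1 : (s * (s + 1))⁻¹ = 1 / s - 1 / (s + 1) := by
    have a : s ≠ 0 := fun h => by simp [h] at hs
    have b : s + 1 ≠ 0 := fun h => by
      have := congrArg Complex.re h
      simp at this
      linarith
    field_simp
    ring
  rw [e1]
  exact h3

theorem integral_cpow_mul_inv {σ u : ℝ} (hσ : 1 / 2 ≤ σ) (hu : 0 < u) :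
    ∫ y : ℝ, (u : ℂ) ^ (-((σ : ℂ) + y * Complex.I)) *
      (((σ : ℂ) + y * Complex.I) * (σ + y * Complex.I + 1))⁻¹ =
      2 * Real.pi * ((max (1 - u) 0 : ℝ) : ℂ) := by
  have hm : ∀ y : ℝ, mellin tent ((σ : ℂ) + y * Complex.I) =
      (((σ : ℂ) + y * Complex.I) * (σ + y * Complex.I + 1))⁻¹ := fun y =>
    (hasMellin_tent (by simp; linarith)).2
  have hcont : ContinuousAt tent u := by
    have h1 : ContinuousAt (fun u : ℝ => ((max (1 - u) 0 : ℝ) : ℂ)) u := by fun_prop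
    refine h1.congr ?_
    filter_upwards [lt_mem_nhds hu] with v hv
    exact (tent_eq hv).symm
  have h := mellinInv_mellin_eq σ tent hu (hasMellin_tent (s := σ) (by simp; linarith)).1 (by
    rw [Complex.VerticalIntegrable]
    simp only [hm]
    exact integrable_inv_mul_add_one hσ) hcont
  rw [mellinInv, tent_eq hu] at h
  simp only [hm, smul_eq_mul] at h
  have hpi : (2 * Real.pi : ℂ) ≠ 0 := by exact_mod_cast Real.two_pi_pos.ne'
  rw [← h, Complex.real_smul, ← mul_assoc]
  push_cast
  rw [mul_one_div_cancel hpi, one_mul]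

/-- A smoothed Perron formula for the Möbius function. -/
theorem sum_moebius_mul_eq_integral {σ x : ℝ} (hσ : 1 < σ) (hx : 0 < x) :
    2 * Real.pi *
        ((∑ n ∈ Icc 1 ⌊x⌋₊, (ArithmeticFunction.moebius n : ℝ) * (1 - n / x) : ℝ) : ℂ) =
      ∫ y : ℝ, (riemannZeta ((σ : ℂ) + y * Complex.I))⁻¹ *
        ((x : ℂ) ^ ((σ : ℂ) + y * Complex.I) *
          (((σ : ℂ) + y * Complex.I) * (σ + y * Complex.I + 1))⁻¹) := by
  have hre : ∀ y : ℝ, ((σ : ℂ) + y * Complex.I).re = σ := by intro; simp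
  let a : ℕ → ℂ := fun n => (ArithmeticFunction.moebius n : ℂ)
  let k : ℝ → ℂ := fun y => (x : ℂ) ^ ((σ : ℂ) + y * Complex.I) *
    (((σ : ℂ) + y * Complex.I) * (σ + y * Complex.I + 1))⁻¹
  let F : ℕ → ℝ → ℂ := fun n y => LSeries.term a ((σ : ℂ) + y * Complex.I) n * k y
  have hxc : (x : ℂ) ≠ 0 := by exact_mod_cast hx.ne'
  have hcpow : ∀ {b : ℂ}, b ≠ 0 → Continuous fun y : ℝ => b ^ ((σ : ℂ) + y * Complex.I) := by
    intro b hb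
    exact Continuous.const_cpow (by fun_prop) (Or.inl hb)
  have hk : MeasureTheory.Integrable k := by
    refine (integrable_inv_mul_add_one (by linarith)).bdd_mul (c := x ^ σ)
      (hcpow hxc).aestronglyMeasurable ?_
    filter_upwards with y
    rw [Complex.norm_cpow_eq_rpow_re_of_pos hx, hre]
  have hterm : ∀ (n : ℕ) (y : ℝ), ‖LSeries.term a ((σ : ℂ) + y * Complex.I) n‖ =
      ‖LSeries.term a (σ : ℂ) n‖ := by
    intro n y
    rw [LSeries.norm_term_eq, LSeries.norm_term_eq, hre, Complex.ofReal_re]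
  have hF : ∀ n, MeasureTheory.Integrable (F n) := by
    intro n
    refine hk.bdd_mul (c := ‖LSeries.term a (σ : ℂ) n‖) ?_ ?_
    · apply Continuous.aestronglyMeasurable
      rcases eq_or_ne n 0 with rfl | hn
      · simp only [LSeries.term_zero]
        exact continuous_const
      · have hn0 : (n : ℂ) ≠ 0 := by exact_mod_cast hn
        simp only [LSeries.term_of_ne_zero hn]
        refine continuous_const.div (hcpow hn0) fun y => ?_
        simp [Complex.cpow_eq_zero_iff, hn0]
    · filter_upwards with y
      exact (hterm n y).le
  have hsum : Summable fun n => ∫ y, ‖F n y‖ := by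
    have h1 : ∀ n, ∫ y, ‖F n y‖ = ‖LSeries.term a (σ : ℂ) n‖ * ∫ y, ‖k y‖ := by
      intro n
      rw [← MeasureTheory.integral_const_mul]
      refine MeasureTheory.integral_congr_ae (Filter.Eventually.of_forall fun y => ?_)
      simp only [F, norm_mul, hterm]
    simp only [h1]
    exact (ArithmeticFunction.LSeriesSummable_moebius_iff (s := (σ : ℂ)).2 hσ).norm.mul_right _
  have hmain := MeasureTheory.hasSum_integral_of_summable_integral_norm hF hsum
  have hright : ∀ y : ℝ, ∑' n, F n y = (riemannZeta ((σ : ℂ) + y * Complex.I))⁻¹ * k y := by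
    intro y
    have hs : 1 < ((σ : ℂ) + y * Complex.I).re := by rwa [hre]
    have h1 := ArithmeticFunction.LSeries_zeta_mul_Lseries_moebius hs
    rw [ArithmeticFunction.LSeries_zeta_eq_riemannZeta hs] at h1
    rw [inv_eq_of_mul_eq_one_right h1, tsum_mul_right]
    rfl
  have hleft : ∀ n, ∫ y, F n y = 2 * Real.pi * (((ArithmeticFunction.moebius n : ℝ) *
      max (1 - n / x) 0 : ℝ) : ℂ) := by
    intro n
    rcases eq_or_ne n 0 with rfl | hn
    · simp [F]
    have hnpos : (0 : ℝ) < n := by exact_mod_cast Nat.pos_of_ne_zero hn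
    have h1 : ∀ y, F n y = a n * (((n / x : ℝ) : ℂ) ^ (-((σ : ℂ) + y * Complex.I)) *
        (((σ : ℂ) + y * Complex.I) * (σ + y * Complex.I + 1))⁻¹) := by
      intro y
      simp only [F, k, LSeries.term_of_ne_zero hn]
      rw [div_eq_mul_inv (n : ℝ) x, Complex.ofReal_mul,
        Complex.mul_cpow_ofReal_nonneg hnpos.le (by positivity), Complex.cpow_neg, Complex.cpow_neg,
        Complex.ofReal_inv, Complex.inv_cpow _ _ (by
          rw [Complex.arg_ofReal_of_nonneg hx.le]
          exact Real.pi_ne_zero.symm), inv_inv, Complex.ofReal_natCast]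
      ring
    simp only [h1]
    rw [MeasureTheory.integral_const_mul, integral_cpow_mul_inv (by linarith) (by positivity)]
    simp only [a]
    push_cast
    ring
  simp only [hright, hleft] at hmain
  have hfin := hasSum_sum_of_ne_finset_zero (L := .unconditional ℕ) (s := Icc 1 ⌊x⌋₊)
    (f := fun n : ℕ => (2 * Real.pi * (((ArithmeticFunction.moebius n : ℝ) *
      max (1 - n / x) 0 : ℝ) : ℂ) : ℂ)) (fun n hn => by
      rcases eq_or_ne n 0 with rfl | hn0
      · simp
      · have h1 : ⌊x⌋₊ < n := by
          rw [mem_Icc] at hn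
          omega
        have h2 : x < n := (Nat.floor_lt hx.le).1 h1
        rw [max_eq_right (by
          rw [sub_nonpos, le_div_iff₀ hx]
          linarith)]
        simp)
  refine Eq.trans ?_ (hmain.unique hfin).symm
  rw [Complex.ofReal_sum, mul_sum]
  refine sum_congr rfl fun n hn => ?_
  have h2 : (n : ℝ) ≤ x := (Nat.le_floor_iff hx.le).1 (mem_Icc.1 hn).2
  rw [max_eq_left (by
    rw [sub_nonneg, div_le_one hx]
    exact h2)]

theorem norm_setIntegral_Ioi_le {g : ℝ → ℂ} {D H : ℝ} (hH : 0 < H)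
    (hg : ∀ y, ‖g y‖ ≤ D * (1 + y ^ 2)⁻¹) : ‖∫ y in Set.Ioi H, g y‖ ≤ D / H := by
  have hD : 0 ≤ D := by simpa using (norm_nonneg _).trans (hg 0)
  have h1 : MeasureTheory.IntegrableOn (fun y : ℝ => D * y ^ (-2 : ℝ)) (Set.Ioi H) :=
    (integrableOn_Ioi_rpow_of_lt (by norm_num) hH).const_mul D
  refine (MeasureTheory.norm_integral_le_of_norm_le h1 ?_).trans (le_of_eq ?_)
  · refine (MeasureTheory.ae_restrict_iff' measurableSet_Ioi).2 (.of_forall fun y hy => ?_)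
    have hy0 : 0 < y := hH.trans hy
    refine (hg y).trans ?_
    rw [Real.rpow_neg hy0.le, Real.rpow_ofNat]
    gcongr
    linarith
  · rw [MeasureTheory.integral_const_mul, integral_Ioi_rpow_of_lt (by norm_num) hH]
    norm_num
    rw [Real.rpow_neg_one, div_eq_mul_inv]

theorem norm_integral_sub_le {g : ℝ → ℂ} {D H : ℝ} (hH : 0 < H) (hgi : MeasureTheory.Integrable g)
    (hg : ∀ y, ‖g y‖ ≤ D * (1 + y ^ 2)⁻¹) :
    ‖(∫ y, g y) - ∫ y in -H..H, g y‖ ≤ 2 * D / H := by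
  have h1 := intervalIntegral.integral_Iic_add_Ioi (b := H) hgi.integrableOn hgi.integrableOn
  have h2 := intervalIntegral.integral_Iic_sub_Iic (a := -H) (b := H) hgi.integrableOn
    hgi.integrableOn
  have h3 : (∫ y, g y) - ∫ y in -H..H, g y =
      (∫ y in Set.Iic (-H), g y) + ∫ y in Set.Ioi H, g y := by
    rw [← h1, ← h2]
    ring
  rw [h3, ← integral_comp_neg_Ioi]
  refine (norm_add_le _ _).trans ?_
  have h4 := norm_setIntegral_Ioi_le hH hg
  have h5 := norm_setIntegral_Ioi_le (g := fun y => g (-y)) (D := D) hH (fun y => by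
    simpa using hg (-y))
  calc _ ≤ D / H + D / H := add_le_add h5 h4
    _ = _ := by ring

/-- Moving the line of integration into a region where the reciprocal of the zeta function is
bounded. -/
theorem abs_sum_moebius_mul_le {x a σ H P Q : ℝ} (hx : 1 ≤ x) (hσ : 1 < σ) (hσ2 : σ ≤ 2)
    (ha : 1 / 2 ≤ a) (ha1 : a ≤ 1) (hH : 1 ≤ H)
    (hP : ∀ s : ℂ, |s.im| ≤ H → a ≤ s.re → s.re ≤ 2 →
      riemannZeta₁ s ≠ 0 ∧ ‖(s - 1) / riemannZeta₁ s‖ ≤ P)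
    (hQ : ∀ y : ℝ, ‖(riemannZeta (σ + y * Complex.I))⁻¹‖ ≤ Q) :
    |∑ n ∈ Icc 1 ⌊x⌋₊, (ArithmeticFunction.moebius n : ℝ) * (1 - n / x)| ≤
      (P + Q) * x ^ σ / H + P * x ^ a := by
  have hre : ∀ u y : ℝ, ((u : ℂ) + y * Complex.I).re = u := by intros; simp
  have him : ∀ u y : ℝ, ((u : ℂ) + y * Complex.I).im = y := by intros; simp
  have hx0 : 0 < x := by linarith
  have hxc : (x : ℂ) ≠ 0 := by exact_mod_cast hx0.ne'
  have hQ0 : 0 ≤ Q := (norm_nonneg _).trans (hQ 0)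
  have hP0 : 0 ≤ P := (norm_nonneg _).trans (hP 1 (by simp; linarith) (by simpa) (by simp)).2
  let k : ℂ → ℂ := fun s => (x : ℂ) ^ s * (s * (s + 1))⁻¹
  let f : ℂ → ℂ := fun s => (s - 1) / riemannZeta₁ s * k s
  have hknorm : ∀ s : ℂ, 1 / 2 ≤ s.re → ‖k s‖ ≤ x ^ s.re * (2 * (1 + s.im ^ 2)⁻¹) := by
    intro s hs
    rw [norm_mul, Complex.norm_cpow_eq_rpow_re_of_pos hx0]
    gcongr
    exact norm_inv_mul_add_one_le hs
  have hfnorm : ∀ s : ℂ, |s.im| ≤ H → a ≤ s.re → s.re ≤ 2 →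
      ‖f s‖ ≤ P * (x ^ s.re * (2 * (1 + s.im ^ 2)⁻¹)) := by
    intro s h1 h2 h3
    rw [norm_mul]
    gcongr
    · exact (hP s h1 h2 h3).2
    · exact hknorm s (by linarith)
  have hfd : ∀ s : ℂ, |s.im| ≤ H → a ≤ s.re → s.re ≤ 2 → DifferentiableAt ℂ f s := by
    intro s h1 h2 h3
    have e0 : s ≠ 0 := fun h => by
      rw [h, Complex.zero_re] at h2
      linarith
    have e1 : s + 1 ≠ 0 := fun h => by
      have := congrArg Complex.re h
      simp at this
      linarith
    have d1 : DifferentiableAt ℂ (fun s : ℂ => (x : ℂ) ^ s) s :=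
      differentiableAt_id.const_cpow (Or.inl hxc)
    have d2 : DifferentiableAt ℂ (fun s : ℂ => (s * (s + 1))⁻¹) s :=
      DifferentiableAt.fun_inv (by fun_prop) (mul_ne_zero e0 e1)
    have d3 : DifferentiableAt ℂ (fun s : ℂ => (s - 1) / riemannZeta₁ s) s :=
      DifferentiableAt.fun_div (by fun_prop) (differentiable_riemannZeta₁ s) (hP s h1 h2 h3).1
    exact d3.fun_mul (d1.fun_mul d2)
  let g : ℝ → ℂ := fun y => (riemannZeta (σ + y * Complex.I))⁻¹ * k (σ + y * Complex.I)
  have hline : ∀ y : ℝ, (σ : ℂ) + y * Complex.I ≠ 1 := fun y h => by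
    have := congrArg Complex.re h
    rw [hre, Complex.one_re] at this
    linarith
  have hgf : ∀ y : ℝ, g y = f (σ + y * Complex.I) := by
    intro y
    simp only [g, f]
    rw [riemannZeta_eq_inv_sub_mul (hline y), mul_inv, inv_inv, div_eq_mul_inv]
  have hkint : MeasureTheory.Integrable fun y : ℝ => k (σ + y * Complex.I) := by
    refine (integrable_inv_mul_add_one (by linarith : 1 / 2 ≤ σ)).bdd_mul (c := x ^ σ)
      (Continuous.const_cpow (by fun_prop) (Or.inl hxc)).aestronglyMeasurable ?_
    filter_upwards with y
    rw [Complex.norm_cpow_eq_rpow_re_of_pos hx0, hre]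
  have hgi : MeasureTheory.Integrable g := by
    refine hkint.bdd_mul (c := Q) (Continuous.aestronglyMeasurable ?_) (.of_forall hQ)
    refine Continuous.inv₀ ?_ fun y => riemannZeta_ne_zero_of_one_lt_re (by rwa [hre])
    refine continuous_iff_continuousAt.2 fun y => ?_
    exact (differentiableAt_riemannZeta (hline y)).continuousAt.comp'
      (f := fun y : ℝ => (σ : ℂ) + y * Complex.I) (by fun_prop)
  have hgnorm : ∀ y, ‖g y‖ ≤ 2 * (Q * x ^ σ) * (1 + y ^ 2)⁻¹ := by
    intro y
    have h1 := hknorm (σ + y * Complex.I) (by rw [hre]; linarith)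
    rw [hre, him] at h1
    calc ‖g y‖ = _ := norm_mul _ _
      _ ≤ Q * (x ^ σ * (2 * (1 + y ^ 2)⁻¹)) := by
          gcongr
          exact hQ y
      _ = _ := by ring
  have htail := norm_integral_sub_le (by linarith : 0 < H) hgi hgnorm
  have hrect := Complex.integral_boundary_rect_eq_zero_of_differentiableOn f
    (a + (-H : ℝ) * Complex.I) (σ + H * Complex.I) (by
      intro s hs
      rw [Complex.mem_reProdIm, hre, hre, him, him, Set.uIcc_of_le (by linarith),
        Set.uIcc_of_le (by linarith)] at hs
      exact (hfd s (abs_le.2 hs.2) hs.1.1 (hs.1.2.trans hσ2)).differentiableWithinAt)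
  rw [hre, hre, him, him] at hrect
  have hHinv : (1 + H ^ 2)⁻¹ ≤ H⁻¹ := inv_anti₀ (by linarith) (by nlinarith)
  have hhor : ∀ y : ℝ, |y| = H →
      ‖∫ u in a..σ, f (u + y * Complex.I)‖ ≤ 3 * (P * x ^ σ / H) := by
    intro y hy
    have h1 := intervalIntegral.norm_integral_le_of_norm_le_const (a := a) (b := σ)
      (f := fun u : ℝ => f (u + y * Complex.I)) (C := P * (x ^ σ * (2 * H⁻¹))) (fun u hu => by
        rw [Set.uIoc_of_le (by linarith)] at hu
        have h2 := hfnorm (u + y * Complex.I) (by rw [him, hy])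
          (by rw [hre]; exact hu.1.le) (by rw [hre]; linarith [hu.2])
        rw [hre, him, ← sq_abs, hy] at h2
        refine h2.trans ?_
        gcongr
        exact hu.2)
    refine h1.trans ?_
    rw [abs_of_nonneg (by linarith)]
    calc _ ≤ P * (x ^ σ * (2 * H⁻¹)) * (3 / 2) := by
          gcongr
          linarith
      _ = _ := by ring
  have hvert : ‖∫ y in -H..H, f (a + y * Complex.I)‖ ≤ 2 * Real.pi * (P * x ^ a) := by
    have hint : MeasureTheory.Integrable fun y : ℝ => 2 * (P * x ^ a) * (1 + y ^ 2)⁻¹ :=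
      integrable_inv_one_add_sq.const_mul _
    have h1 := intervalIntegral.norm_integral_le_of_norm_le (a := -H) (b := H)
      (f := fun y : ℝ => f (a + y * Complex.I)) (g := fun y => 2 * (P * x ^ a) * (1 + y ^ 2)⁻¹)
      (by linarith) (.of_forall fun y hy => by
        have h2 := hfnorm (a + y * Complex.I) (by rw [him, abs_le]; exact ⟨hy.1.le, hy.2⟩)
          (by rw [hre]) (by rw [hre]; linarith)
        rw [hre, him] at h2
        refine h2.trans (le_of_eq ?_)
        ring) hint.intervalIntegrable
    refine h1.trans ?_
    rw [intervalIntegral.integral_of_le (by linarith)]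
    refine (MeasureTheory.setIntegral_le_integral hint (.of_forall fun y => by positivity)).trans
      (le_of_eq ?_)
    rw [MeasureTheory.integral_const_mul, integral_univ_inv_one_add_sq]
    ring
  have hmid : ‖∫ y in -H..H, g y‖ ≤ 6 * (P * x ^ σ / H) + 2 * Real.pi * (P * x ^ a) := by
    have h1 : Complex.I * ∫ y in -H..H, g y = Complex.I * (∫ y in -H..H, f (a + y * Complex.I)) -
        (∫ u in a..σ, f (u + (-H : ℝ) * Complex.I)) + ∫ u in a..σ, f (u + H * Complex.I) := by
      simp only [hgf]
      simp only [smul_eq_mul] at hrect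
      linear_combination hrect
    have h2 : ‖∫ y in -H..H, g y‖ = ‖Complex.I * ∫ y in -H..H, g y‖ := by simp
    rw [h2, h1]
    refine (norm_add_le _ _).trans ((add_le_add_left (norm_sub_le _ _) _).trans ?_)
    rw [norm_mul, Complex.norm_I, one_mul]
    have h3 := hhor (-H) (by rw [abs_neg, abs_of_pos (by linarith)])
    have h4 := hhor H (by rw [abs_of_pos (by linarith)])
    linarith
  have hperron := sum_moebius_mul_eq_integral hσ hx0
  set S := ∑ n ∈ Icc 1 ⌊x⌋₊, (ArithmeticFunction.moebius n : ℝ) * (1 - n / x) with hS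
  have hint : ‖∫ y, g y‖ = 2 * Real.pi * |S| := by
    change 2 * (Real.pi : ℂ) * (S : ℂ) = ∫ y, g y at hperron
    rw [← hperron, norm_mul, norm_mul, Complex.norm_real, Complex.norm_real, Real.norm_eq_abs,
      Real.norm_eq_abs, abs_of_pos Real.pi_pos]
    norm_num
  have hfin := norm_le_norm_add_norm_sub' (∫ y, g y) (∫ y in -H..H, g y)
  have hpi := Real.pi_gt_three
  have b1 : 0 ≤ P * x ^ σ / H := by positivity
  have b2 : 0 ≤ Q * x ^ σ / H := by positivity
  have htail2 : 2 * (2 * (Q * x ^ σ)) / H = 4 * (Q * x ^ σ / H) := by ring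
  have hgoal : (P + Q) * x ^ σ / H = P * x ^ σ / H + Q * x ^ σ / H := by ring
  rw [hint] at hfin
  rw [htail2] at htail
  rw [hgoal]
  have hkey : 2 * Real.pi * |S| ≤
      2 * Real.pi * (P * x ^ σ / H + Q * x ^ σ / H + P * x ^ a) := by
    nlinarith
  exact le_of_mul_le_mul_left hkey (by positivity)

theorem le_one_of_cube_mul_eq_one {T δ : ℝ} (hT : 3 ≤ T) (h : δ ^ 3 * (T ^ 2 * Real.log T) = 1) :
    δ ≤ 1 := by
  by_contra! h1
  have h2 : 1 < δ ^ 3 := one_lt_pow₀ h1 (by norm_num)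
  have h3 : 1 ≤ Real.log T := by
    rw [Real.le_log_iff_exp_le (by linarith)]
    linarith [Real.exp_one_lt_d9]
  have h4 : 1 ≤ T ^ 2 * Real.log T :=
    one_le_mul_of_one_le_of_one_le (one_le_pow₀ (by linarith)) h3
  nlinarith

/-- The smoothed form of the bound for the Mertens function. -/
theorem exists_abs_sum_moebius_mul_le : ∃ C c T₀ : ℝ, 0 < C ∧ 0 < c ∧ c ≤ 1 ∧ 3 ≤ T₀ ∧
    ∀ T δ x : ℝ, T₀ ≤ T → 0 < δ → δ ^ 3 * (T ^ 2 * Real.log T) = 1 → 1 ≤ x →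
    T ≤ δ * Real.log x → Real.log x ≤ 2 * T ^ 2 →
    |∑ n ∈ Icc 1 ⌊x⌋₊, (ArithmeticFunction.moebius n : ℝ) * (1 - n / x)| ≤
      C * x * Real.exp (-(c * T)) := by
  obtain ⟨κ₀, T₁, hκ₀, hT₁, hzero⟩ := exists_norm_div_riemannZeta₁_le_cube
  obtain ⟨κ, hκ⟩ : ∃ κ, κ = min κ₀ (1 / 2) := ⟨_, rfl⟩
  have hκpos : 0 < κ := by rw [hκ]; positivity
  have hκ2 : κ ≤ 1 / 2 := by rw [hκ]; exact min_le_right _ _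
  have hκκ : κ ≤ κ₀ := by rw [hκ]; exact min_le_left _ _
  refine ⟨100 * (48 / κ ^ 3), κ / 2, max T₁ 3, by positivity, by positivity, by linarith,
    le_max_right _ _, ?_⟩
  intro T δ x hT hδ hδT hx hTδ hxT
  have hTT₁ : T₁ ≤ T := (le_max_left _ _).trans hT
  have hT3 : 3 ≤ T := (le_max_right _ _).trans hT
  have hδ1 := le_one_of_cube_mul_eq_one hT3 hδT
  set L := Real.log x with hL
  have hx0 : 0 < x := by linarith
  have hTL : T ≤ L := by
    have hL0 : 0 ≤ L := Real.log_nonneg hx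
    nlinarith
  have hLpos : 0 < L := by linarith
  have hLinv : 1 / L ≤ 1 := by
    rw [div_le_one hLpos]
    linarith
  have hexpT : 4 ≤ Real.exp T := by
    have := Real.add_one_le_exp T
    linarith
  have hre : ∀ u y : ℝ, ((u : ℂ) + y * Complex.I).re = u := by intros; simp
  have hκδ : κ * δ ≤ κ := mul_le_of_le_one_right hκpos.le hδ1
  have hmain := abs_sum_moebius_mul_le (x := x) (a := 1 - κ * δ) (σ := 1 + 1 / L)
    (H := Real.exp T / 4) (P := T ^ 3) (Q := 3 * L) hx (by
      have : 0 < 1 / L := by positivity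
      linarith) (by linarith) (by linarith) (by nlinarith [mul_pos hκpos hδ]) (by linarith)
    (fun s h1 h2 h3 => hzero T δ hTT₁ hδ hδT s h1 (by
      have : κ * δ ≤ κ₀ * δ := by gcongr
      linarith) h3)
    (fun y => by
      have h1 : 0 < 1 / L := by positivity
      refine (norm_inv_riemannZeta_le (s := (1 + 1 / L : ℝ) + y * Complex.I)
        (by rw [hre]; linarith)).trans ?_
      rw [hre]
      refine (norm_riemannZeta_ofReal_le (by linarith) (by linarith)).trans (le_of_eq ?_)
      rw [add_sub_cancel_left]
      field_simp)
  refine hmain.trans ?_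
  have e1 : x ^ (1 + 1 / L) = x * Real.exp 1 := by
    rw [Real.rpow_add hx0, Real.rpow_one, Real.rpow_def_of_pos hx0, ← hL]
    congr 2
    field_simp
  have e2 : x ^ (1 - κ * δ) ≤ x * Real.exp (-(κ * T)) := by
    rw [sub_eq_add_neg, Real.rpow_add hx0, Real.rpow_one, Real.rpow_def_of_pos hx0, ← hL]
    gcongr
    nlinarith [mul_le_mul_of_nonneg_left hTδ hκpos.le]
  have e3 : (Real.exp T)⁻¹ ≤ Real.exp (-(κ * T)) := by
    rw [← Real.exp_neg]
    gcongr
    nlinarith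
  have e4 : T ^ 3 + 3 * L ≤ 3 * T ^ 3 := by nlinarith [sq_nonneg T]
  have e5 : T ^ 3 ≤ 48 / κ ^ 3 * Real.exp (κ / 2 * T) := by
    have h1 := Real.pow_div_factorial_le_exp (κ / 2 * T) (by positivity) 3
    have h2 : T ^ 3 = 48 / κ ^ 3 * ((κ / 2 * T) ^ 3 / (Nat.factorial 3 : ℕ)) := by
      simp [Nat.factorial]
      field_simp
      norm_num
    rw [h2]
    gcongr
  have e6 := Real.exp_one_lt_d9
  have e7 : Real.exp (κ / 2 * T) * Real.exp (-(κ * T)) = Real.exp (-(κ / 2 * T)) := by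
    rw [← Real.exp_add]
    congr 1
    ring
  rw [e1]
  calc (T ^ 3 + 3 * L) * (x * Real.exp 1) / (Real.exp T / 4) + T ^ 3 * x ^ (1 - κ * δ)
      = (T ^ 3 + 3 * L) * (x * Real.exp 1) * 4 * (Real.exp T)⁻¹ + T ^ 3 * x ^ (1 - κ * δ) := by
        field_simp
    _ ≤ 3 * T ^ 3 * (x * 3) * 4 * Real.exp (-(κ * T)) + T ^ 3 * (x * Real.exp (-(κ * T))) := by
        gcongr
        linarith
    _ = 37 * (T ^ 3 * (x * Real.exp (-(κ * T)))) := by ring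
    _ ≤ 100 * (48 / κ ^ 3 * Real.exp (κ / 2 * T) * (x * Real.exp (-(κ * T)))) := by
        gcongr
        norm_num
    _ = 100 * (48 / κ ^ 3) * x * (Real.exp (κ / 2 * T) * Real.exp (-(κ * T))) := by ring
    _ = _ := by rw [e7]

/-- Removing the smoothing from sums of the Möbius function. -/
theorem abs_sum_moebius_mul_le_add {x h : ℝ} (hx : 0 ≤ x) (hh : 0 ≤ h) :
    |∑ n ∈ Icc 1 ⌊x⌋₊, (ArithmeticFunction.moebius n : ℝ)| * h ≤
      |∑ n ∈ Icc 1 ⌊x + h⌋₊, (ArithmeticFunction.moebius n : ℝ) * (x + h - n)| +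
      |∑ n ∈ Icc 1 ⌊x⌋₊, (ArithmeticFunction.moebius n : ℝ) * (x - n)| + h * (h + 1) := by
  have hfl : ⌊x⌋₊ ≤ ⌊x + h⌋₊ := Nat.floor_mono (by linarith)
  have hsplit : ∑ n ∈ Icc 1 ⌊x + h⌋₊, (ArithmeticFunction.moebius n : ℝ) * (x + h - n) =
      ∑ n ∈ Icc 1 ⌊x⌋₊, (ArithmeticFunction.moebius n : ℝ) * (x + h - n) +
        ∑ n ∈ Ioc ⌊x⌋₊ ⌊x + h⌋₊, (ArithmeticFunction.moebius n : ℝ) * (x + h - n) := by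
    rw [← sum_union]
    · congr 1
      ext n
      simp only [mem_union, mem_Icc, mem_Ioc]
      omega
    · rw [disjoint_left]
      intro n h1 h2
      rw [mem_Icc] at h1
      rw [mem_Ioc] at h2
      omega
  have hfirst : ∑ n ∈ Icc 1 ⌊x⌋₊, (ArithmeticFunction.moebius n : ℝ) * (x + h - n) =
      ∑ n ∈ Icc 1 ⌊x⌋₊, (ArithmeticFunction.moebius n : ℝ) * (x - n) +
        (∑ n ∈ Icc 1 ⌊x⌋₊, (ArithmeticFunction.moebius n : ℝ)) * h := by
    rw [sum_mul, ← sum_add_distrib]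
    exact sum_congr rfl fun n _ => by ring
  have hlast : |∑ n ∈ Ioc ⌊x⌋₊ ⌊x + h⌋₊, (ArithmeticFunction.moebius n : ℝ) * (x + h - n)| ≤
      h * (h + 1) := by
    calc _ ≤ ∑ n ∈ Ioc ⌊x⌋₊ ⌊x + h⌋₊, |(ArithmeticFunction.moebius n : ℝ) * (x + h - n)| :=
          abs_sum_le_sum_abs _ _
      _ ≤ ∑ n ∈ Ioc ⌊x⌋₊ ⌊x + h⌋₊, h := by
          refine sum_le_sum fun n hn => ?_
          rw [mem_Ioc] at hn
          have h1 : x < n := (Nat.floor_lt hx).1 hn.1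
          have h2 : (n : ℝ) ≤ x + h := (Nat.le_floor_iff (by linarith)).1 hn.2
          have h3 : |(ArithmeticFunction.moebius n : ℝ)| ≤ 1 := by
            exact_mod_cast ArithmeticFunction.abs_moebius_le_one
          rw [abs_mul, abs_of_nonneg (by linarith : 0 ≤ x + h - n)]
          calc _ ≤ 1 * (x + h - n) := by
                gcongr
            _ ≤ h := by linarith
      _ = (⌊x + h⌋₊ - ⌊x⌋₊ : ℝ) * h := by
          rw [sum_const, Nat.card_Ioc, nsmul_eq_mul, Nat.cast_sub hfl]
      _ ≤ (h + 1) * h := by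
          gcongr
          have h1 := Nat.floor_le (by linarith : 0 ≤ x + h)
          have h2 := Nat.lt_floor_add_one x
          linarith
      _ = _ := mul_comm _ _
  rw [hfirst] at hsplit
  rw [← abs_of_nonneg hh, ← abs_mul, abs_of_nonneg hh]
  rw [abs_le] at hlast
  have h1 := abs_le.1 (le_refl
    |∑ n ∈ Icc 1 ⌊x + h⌋₊, (ArithmeticFunction.moebius n : ℝ) * (x + h - n)|)
  have h2 := abs_le.1 (le_refl
    |∑ n ∈ Icc 1 ⌊x⌋₊, (ArithmeticFunction.moebius n : ℝ) * (x - n)|)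
  rw [abs_le]
  constructor <;> linarith [h1.1, h1.2, h2.1, h2.2, hlast.1, hlast.2]

theorem exists_abs_sum_moebius_le : ∃ C c T₀ : ℝ, 0 < C ∧ 0 < c ∧ 3 ≤ T₀ ∧
    ∀ T δ x : ℝ, T₀ ≤ T → 0 < δ → δ ^ 3 * (T ^ 2 * Real.log T) = 1 → 1 ≤ x →
    T ≤ δ * Real.log x → Real.log x ≤ T ^ 2 →
    |∑ n ∈ Icc 1 ⌊x⌋₊, (ArithmeticFunction.moebius n : ℝ)| ≤ C * x * Real.exp (-(c * T)) := by
  obtain ⟨C, c, T₀, hC, hc, hc1, hT₀, hmain⟩ := exists_abs_sum_moebius_mul_le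
  refine ⟨5 * C + 2, c / 2, T₀, by positivity, by positivity, hT₀, ?_⟩
  intro T δ x hT hδ hδT hx hTδ hxT
  have hx0 : 0 < x := by linarith
  have hδ1 := le_one_of_cube_mul_eq_one (hT₀.trans hT) hδT
  have hTL : T ≤ Real.log x := by nlinarith [Real.log_nonneg hx]
  obtain ⟨e, he⟩ : ∃ e, e = Real.exp (-(c / 2 * T)) := ⟨_, rfl⟩
  have he0 : 0 < e := by rw [he]; positivity
  have he1 : e ≤ 1 := by
    rw [he]
    apply Real.exp_le_one_iff.2
    have : 0 ≤ c / 2 * T := mul_nonneg (by positivity) (by linarith)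
    linarith
  have he2 : Real.exp (-(c * T)) = e ^ 2 := by
    rw [he, ← Real.exp_nat_mul]
    congr 1
    push_cast
    ring
  have hex : 1 ≤ x * e := by
    rw [he]
    nth_rewrite 1 [← Real.exp_log hx0]
    rw [← Real.exp_add]
    apply Real.one_le_exp
    nlinarith
  have hB : ∀ y : ℝ, x ≤ y → y ≤ 2 * x →
      |∑ n ∈ Icc 1 ⌊y⌋₊, (ArithmeticFunction.moebius n : ℝ) * (y - n)| ≤ C * y ^ 2 * e ^ 2 := by
    intro y h1 h2
    have hy0 : 0 < y := by linarith
    have hly : Real.log x ≤ Real.log y := Real.log_le_log hx0 h1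
    have h3 := hmain T δ y hT hδ hδT (by linarith) (hTδ.trans (by gcongr)) (by
      have h4 : Real.log y ≤ Real.log 2 + Real.log x := by
        rw [← Real.log_mul two_ne_zero hx0.ne']
        exact Real.log_le_log hy0 h2
      have := Real.log_two_lt_d9
      norm_num at this
      linarith)
    have h5 : ∑ n ∈ Icc 1 ⌊y⌋₊, (ArithmeticFunction.moebius n : ℝ) * (y - n) =
        y * ∑ n ∈ Icc 1 ⌊y⌋₊, (ArithmeticFunction.moebius n : ℝ) * (1 - n / y) := by
      rw [mul_sum]
      refine sum_congr rfl fun n _ => ?_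
      field_simp
    rw [h5, abs_mul, abs_of_pos hy0]
    calc _ ≤ y * (C * y * Real.exp (-(c * T))) := by gcongr
      _ = _ := by rw [he2]; ring
  have hh : 0 < x * e := by positivity
  have hhx : x * e ≤ x := mul_le_of_le_one_right hx0.le he1
  have h1 := abs_sum_moebius_mul_le_add hx0.le hh.le
  have h2 := hB (x + x * e) (by linarith) (by linarith)
  have h3 := hB x le_rfl (by linarith)
  have h4 : C * (x + x * e) ^ 2 * e ^ 2 ≤ C * (2 * x) ^ 2 * e ^ 2 := by
    gcongr
    linarith
  rw [← he]
  refine le_of_mul_le_mul_right ?_ hh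
  calc _ ≤ _ := h1
    _ ≤ C * (2 * x) ^ 2 * e ^ 2 + C * x ^ 2 * e ^ 2 + x * e * (x * e + x * e) := by
        gcongr
        exact h2.trans h4
    _ = _ := by ring

/-- The bound for the Mertens function for large arguments. -/
theorem exists_abs_sum_moebius_le_exp : ∃ C c L₀ : ℝ, 0 < C ∧ 0 < c ∧
    ∀ x : ℝ, 1 ≤ x → L₀ ≤ Real.log x →
    |∑ n ∈ Icc 1 ⌊x⌋₊, (ArithmeticFunction.moebius n : ℝ)| ≤ C * x *
      Real.exp (-(c * (Real.log x ^ ((3 : ℝ) / 5) * Real.log (Real.log x) ^ (-(1 : ℝ) / 5)))) := by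
  obtain ⟨C, c, T₀, hC, hc, hT₀, hmain⟩ := exists_abs_sum_moebius_le
  refine ⟨C, c, max (Real.exp 6) (T₀ ^ 2), hC, hc, fun x hx hLx => ?_⟩
  set L := Real.log x with hL
  set l := Real.log L with hl
  set T := L ^ ((3 : ℝ) / 5) * l ^ (-(1 : ℝ) / 5) with hT
  have hL6 : Real.exp 6 ≤ L := (le_max_left _ _).trans hLx
  have hLT₀ : T₀ ^ 2 ≤ L := (le_max_right _ _).trans hLx
  have hL0 : 0 < L := (Real.exp_pos _).trans_le hL6
  have hl6 : 6 ≤ l := (Real.le_log_iff_exp_le hL0).2 hL6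
  have hl0 : 0 < l := by linarith
  have hT0 : 0 < T := by rw [hT]; positivity
  have hT5 : T ^ 5 * l = L ^ 3 := by
    rw [hT, mul_pow, ← Real.rpow_natCast, ← Real.rpow_natCast, ← Real.rpow_mul hL0.le,
      ← Real.rpow_mul hl0.le]
    norm_num
    rw [Real.rpow_neg_one]
    field_simp
  have hlL : l ^ 2 ≤ L := by
    have h1 := Real.pow_div_factorial_le_exp l hl0.le 3
    rw [hl, Real.exp_log hL0, ← hl] at h1
    norm_num [Nat.factorial] at h1
    nlinarith [sq_nonneg l]
  have hLT : L ≤ T ^ 2 := by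
    have h1 : L ^ 5 * l ^ 2 ≤ (T ^ 2) ^ 5 * l ^ 2 := by
      calc L ^ 5 * l ^ 2 ≤ L ^ 5 * L := by gcongr
        _ = (T ^ 5 * l) ^ 2 := by rw [hT5]; ring
        _ = _ := by ring
    have h2 := le_of_mul_le_mul_right h1 (by positivity)
    exact (pow_le_pow_iff_left₀ hL0.le (by positivity) (by norm_num)).1 h2
  have hTT₀ : T₀ ≤ T :=
    (pow_le_pow_iff_left₀ (by linarith) hT0.le two_ne_zero).1 (hLT₀.trans hLT)
  have hlT : 1 ≤ Real.log T := by
    rw [Real.le_log_iff_exp_le hT0]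
    linarith [Real.exp_one_lt_d9]
  have hTL : T ≤ L := by
    by_contra! h
    have h1 : L ^ 3 < T ^ 5 * 1 := by
      calc L ^ 3 < T ^ 3 := by gcongr
        _ ≤ T ^ 5 * 1 := by
          rw [mul_one]
          exact pow_le_pow_right₀ (by linarith) (by norm_num)
    have h2 : T ^ 5 * 1 ≤ T ^ 5 * l := by
      gcongr
      linarith
    linarith
  have hlTl : Real.log T ≤ l := Real.log_le_log hT0 hTL
  obtain ⟨δ, hδ⟩ : ∃ δ, δ = (T ^ 2 * Real.log T)⁻¹ ^ (1 / 3 : ℝ) := ⟨_, rfl⟩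
  have hδ0 : 0 < δ := by rw [hδ]; positivity
  have hδ3 : δ ^ 3 * (T ^ 2 * Real.log T) = 1 := by
    rw [hδ, ← Real.rpow_natCast, ← Real.rpow_mul (by positivity)]
    norm_num
    field_simp
  have hTδ : T ≤ δ * L := by
    have h1 : T ^ 3 ≤ (δ * L) ^ 3 := by
      calc T ^ 3 = δ ^ 3 * (T ^ 2 * Real.log T) * T ^ 3 := by rw [hδ3, one_mul]
        _ = δ ^ 3 * (T ^ 5 * Real.log T) := by ring
        _ ≤ δ ^ 3 * (T ^ 5 * l) := by gcongr
        _ = (δ * L) ^ 3 := by rw [hT5]; ring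
    exact (pow_le_pow_iff_left₀ hT0.le (by positivity) (by norm_num)).1 h1
  exact hmain T δ x hTT₀ hδ0 hδ3 hx hTδ hLT

theorem abs_sum_moebius_le {x : ℝ} (hx : 0 ≤ x) :
    |∑ n ∈ Icc 1 ⌊x⌋₊, (ArithmeticFunction.moebius n : ℝ)| ≤ x := by
  calc _ ≤ ∑ n ∈ Icc 1 ⌊x⌋₊, |(ArithmeticFunction.moebius n : ℝ)| := abs_sum_le_sum_abs _ _
    _ ≤ ∑ n ∈ Icc 1 ⌊x⌋₊, 1 := sum_le_sum fun n _ => by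
        exact_mod_cast ArithmeticFunction.abs_moebius_le_one
    _ = ⌊x⌋₊ := by simp
    _ ≤ x := Nat.floor_le hx

end VinogradovKorobov

open VinogradovKorobov in
/-- The strongest known unconditional bound for the Mertens sum:
`|M(x)| ≤ c · x · exp(−C (log x)^{3/5} (log log x)^{−1/5})` for `x ≥ 3`. -/
theorem mertensM_bound :
    ∃ c : ℝ, 0 < c ∧ ∃ C : ℝ, 0 < C ∧ ∀ x : ℝ, 3 ≤ x →
      |(mertensM x : ℝ)| ≤ c * x *
        Real.exp (-C * Real.log x ^ ((3 : ℝ) / 5) *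
          Real.log (Real.log x) ^ (-(1 : ℝ) / 5)) := by
  obtain ⟨C, c, L₀, hC, hc, hmain⟩ := exists_abs_sum_moebius_le_exp
  have hlog3 : 1 < Real.log 3 := by
    rw [Real.lt_log_iff_exp_lt (by norm_num)]
    linarith [Real.exp_one_lt_d9]
  obtain ⟨l, hl⟩ : ∃ l, l = Real.log (Real.log 3) := ⟨_, rfl⟩
  have hl0 : 0 < l := by rw [hl]; exact Real.log_pos hlog3
  obtain ⟨W, hW⟩ : ∃ W, W = L₀ ^ ((3 : ℝ) / 5) * l ^ (-(1 : ℝ) / 5) := ⟨_, rfl⟩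
  refine ⟨max C (Real.exp (c * W)), by positivity, c, hc, fun x hx => ?_⟩
  have hx0 : 0 < x := by linarith
  have hcast : (mertensM x : ℝ) =
      ∑ n ∈ Finset.Icc 1 ⌊x⌋₊, (ArithmeticFunction.moebius n : ℝ) := by
    rw [mertensM]
    push_cast
    rfl
  have hexp : -c * Real.log x ^ ((3 : ℝ) / 5) * Real.log (Real.log x) ^ (-(1 : ℝ) / 5) =
      -(c * (Real.log x ^ ((3 : ℝ) / 5) * Real.log (Real.log x) ^ (-(1 : ℝ) / 5))) := by ring
  rw [hcast, hexp]
  rcases le_total L₀ (Real.log x) with h | h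
  · refine (hmain x (by linarith) h).trans ?_
    gcongr
    exact le_max_left _ _
  · have h3x : Real.log 3 ≤ Real.log x := Real.log_le_log (by norm_num) hx
    have hlx : l ≤ Real.log (Real.log x) := by
      rw [hl]
      exact Real.log_le_log (by linarith) h3x
    have hWle : Real.log x ^ ((3 : ℝ) / 5) * Real.log (Real.log x) ^ (-(1 : ℝ) / 5) ≤ W := by
      rw [hW]
      apply mul_le_mul
      · exact Real.rpow_le_rpow (by linarith) h (by norm_num)
      · exact Real.rpow_le_rpow_of_nonpos hl0 hlx (by norm_num)
      · exact Real.rpow_nonneg (hl0.le.trans hlx) _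
      · exact Real.rpow_nonneg (by linarith) _
    refine (abs_sum_moebius_le hx0.le).trans ?_
    calc x = Real.exp (c * W) * x * Real.exp (-(c * W)) := by
          rw [Real.exp_neg]
          field_simp
      _ ≤ _ := by
          gcongr
          exact le_max_right _ _
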